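/- Consider the linear hyperbolic system ∂_t u + a(x,t)∂_x u + b(x,t)u = 0 on (0,1)×ℝ with the reflection boundary conditions and initial condition u(x,s) = φ(x), where a = diag(a₁,…,aₙ) and b = (b_{jk}) have bounded continuous partial derivatives up to first order on [0,1]×ℝ and a satisfies the Λ₀-condition. Then for every s ∈ ℝ and every φ ∈ L²((0,1);ℝⁿ) there exists a unique L²-generalized solution u of this initial–boundary value problem. Moreover, setting U(t,s)φ := u(·,t) defines bounded linear operators on L²((0,1);ℝⁿ) such that U(t,t) = I and U(t,s) = U(t,r)U(r,s) for all t ≥ r ≥ s, the map (t,s) ↦ U(t,s)φ is continuous for t ≥ s for each φ, and there exist K ≥ 1 and ν ∈ ℝ with ‖U(t,s)‖ ≤ K e^{ν(t−s)} for all t ≥ s. -/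

import Mathlib

noncomputable section

open MeasureTheory Set Filter

/-- `ℝⁿ` with the Euclidean norm. -/
abbrev Vn (n : ℕ) : Type := EuclideanSpace ℝ (Fin n)

/-- The strip `[0,1] × ℝ`. -/
def strip : Set (ℝ × ℝ) := Set.Icc (0:ℝ) 1 ×ˢ (Set.univ : Set ℝ)

/-- `g` is `C^k` on the strip `[0,1] × ℝ` with the function and all its partial
derivatives up to order `k` bounded by `C` there (the `BC^k`-norm is `≤ C`). -/
def BCle (k : ℕ) (g : ℝ → ℝ → ℝ) (C : ℝ) : Prop :=
  ContDiffOn ℝ k (fun q : ℝ × ℝ => g q.1 q.2) strip ∧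
  ∀ i : ℕ, i ≤ k → ∀ q ∈ strip,
    ‖iteratedFDerivWithin ℝ i (fun q : ℝ × ℝ => g q.1 q.2) strip q‖ ≤ C

/-- The reflection boundary conditions relating the boundary values
`w0 = u(0,t)` and `w1 = u(1,t)`. -/
def BCrel (n m : ℕ) (p : Fin n → Fin n → ℝ) (w0 w1 : Vn n) : Prop :=
  ∀ j : Fin n,
    ((j : ℕ) < m →
      w0 j = ∑ k : Fin n, if m ≤ (k : ℕ) then p j k * w0 k else p j k * w1 k) ∧
    (m ≤ (j : ℕ) →
      w1 j = ∑ k : Fin n, if m ≤ (k : ℕ) then p j k * w0 k else p j k * w1 k)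

/-- Assumption (H3). -/
def H3cond (n : ℕ) (p : Fin n → Fin n → ℝ) : Prop :=
  ∀ i : Fin (n + 1) → Fin n, ∏ l : Fin n, p (i l.castSucc) (i l.succ) = 0

/-- The `Λ₀`-condition on the diagonal coefficients `a`. -/
def LamCond (n m : ℕ) (Λ₀ : ℝ) (a : ℝ → ℝ → Fin n → ℝ) : Prop :=
  ∀ x ∈ Set.Icc (0:ℝ) 1, ∀ t : ℝ,
    (∀ j : Fin n, ((j : ℕ) < m → Λ₀ ≤ a x t j) ∧ (m ≤ (j : ℕ) → a x t j ≤ -Λ₀)) ∧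
    ∀ j k : Fin n, j ≠ k → Λ₀ ≤ |a x t j - a x t k|

/-- A classical solution `u` (with partial derivatives `ux`, `ut`) of the linear
problem `∂ₜu + a ∂ₓu + b u = f` on `[0,1] × [s,∞)` with the reflection boundary
conditions and initial datum `φ` at time `s`. -/
def IsLinSol (n m : ℕ) (p : Fin n → Fin n → ℝ)
    (a : ℝ → ℝ → Fin n → ℝ) (b : ℝ → ℝ → Fin n → Fin n → ℝ)
    (f : ℝ → ℝ → Fin n → ℝ) (s : ℝ) (φ : ℝ → Vn n)
    (u ux ut : ℝ → ℝ → Vn n) : Prop :=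
  ContinuousOn (fun q : ℝ × ℝ => u q.1 q.2) (Set.Icc 0 1 ×ˢ Set.Ici s) ∧
  ContinuousOn (fun q : ℝ × ℝ => ux q.1 q.2) (Set.Icc 0 1 ×ˢ Set.Ici s) ∧
  ContinuousOn (fun q : ℝ × ℝ => ut q.1 q.2) (Set.Icc 0 1 ×ˢ Set.Ici s) ∧
  (∀ x ∈ Set.Icc (0:ℝ) 1, ∀ t ∈ Set.Ici s, ∀ j : Fin n,
    HasDerivWithinAt (fun y => u y t j) (ux x t j) (Set.Icc 0 1) x ∧
    HasDerivWithinAt (fun τ => u x τ j) (ut x t j) (Set.Ici s) t) ∧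
  (∀ x ∈ Set.Icc (0:ℝ) 1, ∀ t ∈ Set.Ici s, ∀ j : Fin n,
    ut x t j + a x t j * ux x t j + ∑ k : Fin n, b x t j k * u x t k = f x t j) ∧
  (∀ t ∈ Set.Ici s, BCrel n m p (u 0 t) (u 1 t)) ∧
  (∀ x ∈ Set.Icc (0:ℝ) 1, u x s = φ x)

/-- Lebesgue measure restricted to `(0,1)`. -/
abbrev μ01 : Measure ℝ := volume.restrict (Set.Ioo (0:ℝ) 1)

/-- The space `L²((0,1); ℝⁿ)`. -/
abbrev L2 (n : ℕ) := Lp (Vn n) 2 μ01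

/-- An evolution family of bounded linear operators. -/
def IsEvoFam {X : Type*} [NormedAddCommGroup X] [NormedSpace ℝ X]
    (U : ℝ → ℝ → X →L[ℝ] X) : Prop :=
  (∀ t : ℝ, U t t = ContinuousLinearMap.id ℝ X) ∧
  (∀ s r t : ℝ, s ≤ r → r ≤ t → ∀ x : X, U t r (U r s x) = U t s x)

/-- `U` is the evolution family on `L²((0,1);ℝⁿ)` generated by the linear
problem with coefficients `a`, `b`: it is a strongly continuous, exponentially
bounded evolution family which, on `C¹` data with compact support in `(0,1)`,
is given by the classical solutions. -/
def GeneratedBy (n m : ℕ) (p : Fin n → Fin n → ℝ)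
    (a : ℝ → ℝ → Fin n → ℝ) (b : ℝ → ℝ → Fin n → Fin n → ℝ)
    (U : ℝ → ℝ → L2 n →L[ℝ] L2 n) : Prop :=
  IsEvoFam U ∧
  (∀ φ : L2 n, ContinuousOn (fun q : ℝ × ℝ => U q.1 q.2 φ) {q : ℝ × ℝ | q.2 ≤ q.1}) ∧
  (∃ K : ℝ, 1 ≤ K ∧ ∃ ν : ℝ, ∀ s t : ℝ, s ≤ t →
    ‖U t s‖ ≤ K * Real.exp (ν * (t - s))) ∧
  ∀ s : ℝ, ∀ φ : ℝ → Vn n, ContDiff ℝ 1 φ → tsupport φ ⊆ Set.Ioo 0 1 →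
    ∀ φh : L2 n, (∀ᵐ x ∂μ01, φh x = φ x) →
    ∀ u ux ut : ℝ → ℝ → Vn n,
      IsLinSol n m p a b (fun _ _ _ => 0) s φ u ux ut →
      ∀ t : ℝ, s ≤ t → ∀ᵐ x ∂μ01, (U t s φh) x = u x t

/-- Exponential dichotomy on `ℝ` with exponent `α` and bound `M`. -/
def HasExpDichotomy {X : Type*} [NormedAddCommGroup X] [NormedSpace ℝ X]
    (U : ℝ → ℝ → X →L[ℝ] X) (α M : ℝ) : Prop :=
  ∃ P : ℝ → X →L[ℝ] X, ∃ W : ℝ → ℝ → X →L[ℝ] X,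
    (∀ t, (P t).comp (P t) = P t) ∧
    (∀ x : X, Continuous fun t => P t x) ∧
    (∀ x : X, ∃ C : ℝ, ∀ t, ‖P t x‖ ≤ C) ∧
    (∀ s t : ℝ, s ≤ t → (U t s).comp (P s) = (P t).comp (U t s)) ∧
    (∀ s t : ℝ, s ≤ t → ∀ x : X, W s t (U t s (x - P s x)) = x - P s x) ∧
    (∀ s t : ℝ, s ≤ t → ∀ x : X, U t s (W s t (x - P t x)) = x - P t x) ∧
    (∀ s t : ℝ, s ≤ t → ∀ x : X, P s (W s t (x - P t x)) = 0) ∧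
    (∀ s t : ℝ, s ≤ t → ‖(U t s).comp (P s)‖ ≤ M * Real.exp (-α * (t - s))) ∧
    (∀ s t : ℝ, s ≤ t →
      ‖(W s t).comp (ContinuousLinearMap.id ℝ X - P t)‖ ≤ M * Real.exp (-α * (t - s)))

/-- `u : [s,∞) → L²` is the `L²`-generalized solution of the homogeneous linear
problem with initial datum `φ` at time `s`: it is continuous and is the local
uniform limit of the classical solutions corresponding to any sequence of
`C¹`-data with compact support in `(0,1)` converging to `φ` in `L²`. -/
def IsGenSol (n m : ℕ) (p : Fin n → Fin n → ℝ)
    (a : ℝ → ℝ → Fin n → ℝ) (b : ℝ → ℝ → Fin n → Fin n → ℝ)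
    (s : ℝ) (φ : L2 n) (u : ℝ → L2 n) : Prop :=
  ContinuousOn u (Set.Ici s) ∧
  ∀ (φl : ℕ → ℝ → Vn n) (φlh : ℕ → L2 n)
    (ul ulx ult : ℕ → ℝ → ℝ → Vn n) (ulh : ℕ → ℝ → L2 n),
    (∀ l, ContDiff ℝ 1 (φl l)) →
    (∀ l, tsupport (φl l) ⊆ Set.Ioo 0 1) →
    (∀ l, ∀ᵐ x ∂μ01, (φlh l) x = φl l x) →
    Filter.Tendsto (fun l => ‖φlh l - φ‖) Filter.atTop (nhds 0) →
    (∀ l, IsLinSol n m p a b (fun _ _ _ => 0) s (φl l) (ul l) (ulx l) (ult l)) →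
    (∀ l, ∀ t ∈ Set.Ici s, ∀ᵐ x ∂μ01, (ulh l t) x = ul l x t) →
    ∀ T : ℝ, 0 < T →
      TendstoUniformlyOn (fun l θ => ulh l θ) u Filter.atTop (Set.Icc s (s + T))

/-! ### Preliminaries -/

lemma bc1_extract {g : ℝ → ℝ → ℝ} {C : ℝ} (h : BCle 1 g C) :
    ∃ gx gt : ℝ → ℝ → ℝ,
      ContinuousOn (fun q : ℝ × ℝ => g q.1 q.2) strip ∧
      ContinuousOn (fun q : ℝ × ℝ => gx q.1 q.2) strip ∧
      ContinuousOn (fun q : ℝ × ℝ => gt q.1 q.2) strip ∧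
      (∀ x ∈ Icc (0:ℝ) 1, ∀ t, |g x t| ≤ C ∧ |gx x t| ≤ C ∧ |gt x t| ≤ C ∧
        HasDerivWithinAt (fun y => g y t) (gx x t) (Icc 0 1) x ∧
        HasDerivAt (fun τ => g x τ) (gt x t) t) := by
  obtain ⟨hc, hb⟩ := h
  have hu : UniqueDiffOn ℝ strip := (uniqueDiffOn_Icc zero_lt_one).prod uniqueDiffOn_univ
  have hc' : ContDiffOn ℝ 1 (fun q : ℝ × ℝ => g q.1 q.2) strip := by exact_mod_cast hc
  have hfc := hc'.continuousOn_fderivWithin hu le_rfl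
  refine ⟨fun x t => fderivWithin ℝ (fun q : ℝ × ℝ => g q.1 q.2) strip (x, t) (1, 0),
    fun x t => fderivWithin ℝ (fun q : ℝ × ℝ => g q.1 q.2) strip (x, t) (0, 1),
    hc'.continuousOn, ?_, ?_, ?_⟩
  · exact hfc.clm_apply continuousOn_const
  · exact hfc.clm_apply continuousOn_const
  · intro x hx t
    have hq : ((x, t) : ℝ × ℝ) ∈ strip := ⟨hx, mem_univ _⟩
    have h0 := hb 0 (by norm_num) _ hq
    have h1 := hb 1 le_rfl _ hq
    rw [norm_iteratedFDerivWithin_zero] at h0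
    rw [norm_iteratedFDerivWithin_one _ (hu _ hq)] at h1
    have hD : HasFDerivWithinAt (fun q : ℝ × ℝ => g q.1 q.2)
        (fderivWithin ℝ (fun q : ℝ × ℝ => g q.1 q.2) strip (x, t)) strip (x, t) :=
      ((hc'.differentiableOn (by norm_num)) _ hq).hasFDerivWithinAt
    refine ⟨h0, ?_, ?_, ?_, ?_⟩
    · have h2 := (fderivWithin ℝ (fun q : ℝ × ℝ => g q.1 q.2) strip (x, t)).le_opNorm (1, 0)
      rw [Real.norm_eq_abs] at h2
      refine h2.trans ?_
      simpa using h1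
    · have h2 := (fderivWithin ℝ (fun q : ℝ × ℝ => g q.1 q.2) strip (x, t)).le_opNorm (0, 1)
      rw [Real.norm_eq_abs] at h2
      refine h2.trans ?_
      simpa using h1
    · have hl : HasDerivWithinAt (fun y : ℝ => ((y, t) : ℝ × ℝ)) (1, 0) (Icc 0 1) x :=
        ((hasDerivAt_id x).prodMk (hasDerivAt_const x t)).hasDerivWithinAt
      exact hD.comp_hasDerivWithinAt x hl
        (show MapsTo (fun y : ℝ => ((y, t) : ℝ × ℝ)) (Icc 0 1) strip from
          fun y hy => ⟨hy, mem_univ _⟩)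
    · have hl : HasDerivWithinAt (fun τ : ℝ => ((x, τ) : ℝ × ℝ)) (0, 1) univ t :=
        ((hasDerivAt_const t x).prodMk (hasDerivAt_id t)).hasDerivWithinAt
      have := hD.comp_hasDerivWithinAt t hl
        (show MapsTo (fun τ : ℝ => ((x, τ) : ℝ × ℝ)) univ strip from
          fun y hy => ⟨hx, mem_univ _⟩)
      rw [hasDerivWithinAt_univ] at this
      exact this

lemma hasDerivAt_param (G G' : ℝ → ℝ → ℝ) (a b t δ : ℝ) (hδ : 0 < δ)
    (hG : ContinuousOn (fun q : ℝ × ℝ => G q.1 q.2) (uIcc a b ×ˢ Icc (t - δ) (t + δ)))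
    (hG' : ContinuousOn (fun q : ℝ × ℝ => G' q.1 q.2) (uIcc a b ×ˢ Icc (t - δ) (t + δ)))
    (hd : ∀ y ∈ uIcc a b, ∀ τ ∈ Ioo (t - δ) (t + δ),
      HasDerivAt (fun τ => G y τ) (G' y τ) τ) :
    HasDerivAt (fun τ => ∫ y in a..b, G y τ) (∫ y in a..b, G' y t) t := by
  have hcpt : IsCompact (uIcc a b ×ˢ Icc (t - δ) (t + δ)) := isCompact_uIcc.prod isCompact_Icc
  obtain ⟨M, hM⟩ := hcpt.exists_bound_of_continuousOn hG'
  have hslice : ∀ τ ∈ Icc (t - δ) (t + δ), ContinuousOn (fun y => G y τ) (uIcc a b) := by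
    intro τ hτ
    exact hG.comp (f := fun y : ℝ => ((y, τ) : ℝ × ℝ)) (by fun_prop) (fun y hy => ⟨hy, hτ⟩)
  have hslice' : ∀ τ ∈ Icc (t - δ) (t + δ), ContinuousOn (fun y => G' y τ) (uIcc a b) := by
    intro τ hτ
    exact hG'.comp (f := fun y : ℝ => ((y, τ) : ℝ × ℝ)) (by fun_prop) (fun y hy => ⟨hy, hτ⟩)
  have hn : Ioo (t - δ) (t + δ) ∈ nhds t := Ioo_mem_nhds (by linarith) (by linarith)
  have ht : t ∈ Icc (t - δ) (t + δ) := ⟨by linarith, by linarith⟩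
  refine (intervalIntegral.hasDerivAt_integral_of_dominated_loc_of_deriv_le
    (F := fun τ y => G y τ) (F' := fun τ y => G' y τ) (bound := fun _ => M) hn ?_ ?_ ?_ ?_ ?_ ?_).2
  · filter_upwards [hn] with τ hτ
    exact (((hslice τ (Ioo_subset_Icc_self hτ)).mono uIoc_subset_uIcc).aestronglyMeasurable
      measurableSet_uIoc)
  · exact (hslice t ht).intervalIntegrable
  · exact (((hslice' t ht).mono uIoc_subset_uIcc).aestronglyMeasurable measurableSet_uIoc)
  · exact Eventually.of_forall fun y hy τ hτ =>
      hM (y, τ) ⟨uIoc_subset_uIcc hy, Ioo_subset_Icc_self hτ⟩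
  · exact intervalIntegrable_const
  · exact Eventually.of_forall fun y hy τ hτ => hd y (uIoc_subset_uIcc hy) τ hτ

/-- projection of the line onto `[0,1]`. -/
def pj (x : ℝ) : ℝ := max 0 (min 1 x)

lemma pj_mem (x : ℝ) : pj x ∈ Icc (0:ℝ) 1 :=
  ⟨le_max_left _ _, max_le zero_le_one (min_le_left _ _)⟩

lemma pj_eq {x : ℝ} (hx : x ∈ Icc (0:ℝ) 1) : pj x = x := by
  unfold pj; rw [min_eq_right hx.2, max_eq_right hx.1]

lemma pj_pj (x : ℝ) : pj (pj x) = pj x := pj_eq (pj_mem x)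

@[fun_prop]
lemma continuous_pj : Continuous pj := by unfold pj; fun_prop

lemma continuous_pj_of_strip {g : ℝ → ℝ → ℝ}
    (h : ContinuousOn (fun q : ℝ × ℝ => g q.1 q.2) strip) :
    Continuous (fun q : ℝ × ℝ => g (pj q.1) q.2) := by
  have : Continuous (fun q : ℝ × ℝ => ((pj q.1, q.2) : ℝ × ℝ)) := by fun_prop
  exact h.comp_continuous this (fun q => ⟨pj_mem _, mem_univ _⟩)

/-! ### Energy estimate -/

lemma continuousOn_param {G : ℝ → ℝ → ℝ} {s : ℝ}
    (hG : ContinuousOn (fun q : ℝ × ℝ => G q.1 q.2) (Icc 0 1 ×ˢ Ici s)) :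
    ContinuousOn (fun t => ∫ x in (0:ℝ)..1, G x t) (Ici s) := by
  have h1 : Continuous (fun q : ℝ × ℝ => G (pj q.2) (max s q.1)) := by
    have : Continuous (fun q : ℝ × ℝ => ((pj q.2, max s q.1) : ℝ × ℝ)) := by fun_prop
    exact hG.comp_continuous this (fun q => ⟨pj_mem _, le_max_left s q.1⟩)
  have h2 : Continuous (fun t => ∫ x in (0:ℝ)..1, G (pj x) (max s t)) :=
    intervalIntegral.continuous_parametric_intervalIntegral_of_continuous'
      (f := fun t x => G (pj x) (max s t)) h1 0 1
  refine h2.continuousOn.congr ?_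
  intro t ht
  refine intervalIntegral.integral_congr ?_
  intro x hx
  rw [uIcc_of_le zero_le_one] at hx
  simp only [pj_eq hx, max_eq_right (show s ≤ t from ht)]

lemma gronwall_aux {E E' : ℝ → ℝ} {s ν N : ℝ} (hν : 0 ≤ ν) (hN : 0 ≤ N)
    (hc : ContinuousOn E (Ici s)) (hd : ∀ t, s < t → HasDerivAt E (E' t) t)
    (hE : ∀ t, s < t → E' t ≤ ν * E t + N) (t : ℝ) (ht : s ≤ t) :
    E t ≤ Real.exp (ν * (t - s)) * (E s + N * (t - s)) := by
  set h : ℝ → ℝ := fun τ => Real.exp (-(ν * (τ - s))) * E τ - N * (τ - s) with hh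
  have hder : ∀ τ, s < τ → HasDerivAt h (Real.exp (-(ν * (τ - s))) * (-(ν)) * E τ +
      Real.exp (-(ν * (τ - s))) * E' τ - N) τ := by
    intro τ hτ
    have h1 : HasDerivAt (fun τ => Real.exp (-(ν * (τ - s))))
        (Real.exp (-(ν * (τ - s))) * (-ν)) τ := by
      have : HasDerivAt (fun τ => -(ν * (τ - s))) (-ν) τ := by
        simpa using (((hasDerivAt_id τ).sub_const s).const_mul ν).fun_neg
      exact this.exp
    have h2 : HasDerivAt (fun τ => N * (τ - s)) N τ := by
      simpa using (((hasDerivAt_id τ).sub_const s).const_mul N)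
    exact (h1.mul (hd τ hτ)).sub h2
  have hanti : AntitoneOn h (Ici s) := by
    refine antitoneOn_of_deriv_nonpos (convex_Ici s) ?_ ?_ ?_
    · refine ContinuousOn.sub (ContinuousOn.mul (by fun_prop) hc) (by fun_prop)
    · intro τ hτ
      rw [interior_Ici] at hτ
      exact (hder τ hτ).differentiableAt.differentiableWithinAt
    · intro τ hτ
      rw [interior_Ici] at hτ
      have hτ' : s < τ := hτ
      rw [(hder τ hτ).deriv]
      have he0 := Real.exp_pos (-(ν * (τ - s)))
      have he1 : Real.exp (-(ν * (τ - s))) ≤ 1 := by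
        rw [Real.exp_le_one_iff]
        have := mul_nonneg hν (sub_nonneg.2 hτ'.le)
        linarith
      have := hE τ hτ
      nlinarith [mul_le_mul_of_nonneg_left this he0.le, mul_le_mul_of_nonneg_right he1 hN]
  have h3 := hanti (self_mem_Ici (a := s)) (show t ∈ Ici s from ht) ht
  simp only [hh, sub_self, mul_zero, neg_zero, Real.exp_zero, one_mul, sub_zero] at h3
  have he : Real.exp (ν * (t - s)) * Real.exp (-(ν * (t - s))) = 1 := by
    rw [← Real.exp_add]; simp
  calc E t = Real.exp (ν * (t - s)) * (Real.exp (-(ν * (t - s))) * E t) := by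
        rw [← mul_assoc, he, one_mul]
    _ ≤ _ := by
        apply mul_le_mul_of_nonneg_left _ (Real.exp_pos _).le
        linarith

set_option maxHeartbeats 4000000 in
theorem energy_est (n m : ℕ) (hn : 1 ≤ n) (p : Fin n → Fin n → ℝ)
    (a : ℝ → ℝ → Fin n → ℝ) (b : ℝ → ℝ → Fin n → Fin n → ℝ)
    (hab : ∃ C : ℝ, ∀ j : Fin n, BCle 1 (fun x t => a x t j) C ∧
      ∀ k : Fin n, BCle 1 (fun x t => b x t j k) C)
    (Λ₀ : ℝ) (hΛ₀ : 0 < Λ₀) (hLam : LamCond n m Λ₀ a) :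
    ∃ K ν : ℝ, 1 ≤ K ∧ 0 ≤ ν ∧ ∀ (s F : ℝ) (f : ℝ → ℝ → Fin n → ℝ) (φ : ℝ → Vn n)
      (u ux ut : ℝ → ℝ → Vn n), IsLinSol n m p a b f s φ u ux ut →
      (∀ x ∈ Icc (0:ℝ) 1, ∀ t ∈ Ici s, ∀ j, |f x t j| ≤ F) → ∀ t, s ≤ t →
      ∫ x in (0:ℝ)..1, ‖u x t‖ ^ 2 ≤
        K * Real.exp (ν * (t - s)) * ((∫ x in (0:ℝ)..1, ‖u x s‖ ^ 2) + F ^ 2 * (t - s)) := by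
  obtain ⟨C, hC⟩ := hab
  choose ax at' hac haxc hatc hae using fun j => bc1_extract (hC j).1
  have hbb : ∀ x ∈ Icc (0:ℝ) 1, ∀ t j k, |b x t j k| ≤ C := by
    intro x hx t j k
    obtain ⟨gx, gt, -, -, -, h⟩ := bc1_extract ((hC j).2 k)
    exact (h x hx t).1
  set A : ℝ := |C| + 1 with hA
  have hA0 : 0 < A := by positivity
  have hCA : C ≤ A := by rw [hA]; linarith [le_abs_self C]
  set P2 : ℝ := ∑ j, ∑ k, p j k ^ 2 with hP2
  have hP20 : 0 ≤ P2 := by positivity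
  obtain ⟨ε, hε0, hε1, hεP⟩ : ∃ ε : ℝ, 0 < ε ∧ ε ≤ 1 ∧ ε * A * P2 ≤ Λ₀ := by
    refine ⟨min 1 (Λ₀ / (A * (P2 + 1))), by positivity, min_le_left _ _, ?_⟩
    have h1 : min 1 (Λ₀ / (A * (P2 + 1))) * (A * (P2 + 1)) ≤ Λ₀ := by
      rw [← le_div_iff₀ (by positivity)]; exact min_le_right _ _
    have h2 : 0 < min 1 (Λ₀ / (A * (P2 + 1))) := by positivity
    nlinarith [mul_pos h2 hA0]
  set ρ : Fin n → ℝ → ℝ := fun j x =>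
    if (j : ℕ) < m then ε + (1 - ε) * x else 1 - (1 - ε) * x with hρ
  set ρ' : Fin n → ℝ := fun j => if (j : ℕ) < m then (1 - ε) else -(1 - ε) with hρ'
  have hρd : ∀ j x, HasDerivAt (ρ j) (ρ' j) x := by
    intro j x
    simp only [hρ, hρ']
    split_ifs
    · simpa using ((hasDerivAt_id x).const_mul (1 - ε)).const_add ε
    · simpa using ((hasDerivAt_id x).const_mul (1 - ε)).const_sub 1
  have hρc : ∀ j, Continuous (ρ j) := fun j =>
    continuous_iff_continuousAt.2 fun x => (hρd j x).continuousAt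
  have hρb : ∀ j, ∀ x ∈ Icc (0:ℝ) 1, ε ≤ ρ j x ∧ ρ j x ≤ 1 := by
    intro j x hx
    simp only [hρ]
    split_ifs
    · constructor <;> nlinarith [hx.1, hx.2]
    · constructor <;> nlinarith [hx.1, hx.2]
  have hρ'b : ∀ j, |ρ' j| ≤ 1 := by
    intro j
    simp only [hρ']
    split_ifs
    · rw [abs_le]; constructor <;> linarith
    · rw [abs_le]; constructor <;> linarith
  have hn' : (1:ℝ) ≤ n := by exact_mod_cast hn
  refine ⟨n / ε, (1 + 2 * A + 2 * n * A) / ε, ?_, by positivity, ?_⟩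
  · rw [le_div_iff₀ hε0]; linarith
  intro s F f φ u ux ut hsol hf t ht
  obtain ⟨huc, huxc, hutc, hder, heq, hbc, -⟩ := hsol
  set ν : ℝ := (1 + 2 * A + 2 * n * A) / ε with hν
  have hνε : ν * ε = 1 + 2 * A + 2 * n * A := by rw [hν]; field_simp
  have hν0 : 0 ≤ ν := by positivity
  set D := (Icc (0:ℝ) 1 ×ˢ Ici s) with hD
  have huj : ∀ j, ContinuousOn (fun q : ℝ × ℝ => u q.1 q.2 j) D := fun j =>
    (EuclideanSpace.proj j : Vn n →L[ℝ] ℝ).continuous.comp_continuousOn huc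
  have huxj : ∀ j, ContinuousOn (fun q : ℝ × ℝ => ux q.1 q.2 j) D := fun j =>
    (EuclideanSpace.proj j : Vn n →L[ℝ] ℝ).continuous.comp_continuousOn huxc
  have hutj : ∀ j, ContinuousOn (fun q : ℝ × ℝ => ut q.1 q.2 j) D := fun j =>
    (EuclideanSpace.proj j : Vn n →L[ℝ] ℝ).continuous.comp_continuousOn hutc
  have hρD : ∀ j, ContinuousOn (fun q : ℝ × ℝ => ρ j q.1) D := fun j =>
    ((hρc j).comp continuous_fst).continuousOn
  set e : ℝ → ℝ → ℝ := fun x t => ∑ j, ρ j x * u x t j ^ 2 with he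
  set et : ℝ → ℝ → ℝ := fun x t => ∑ j, ρ j x * (2 * u x t j * ut x t j) with het
  have hec : ContinuousOn (fun q : ℝ × ℝ => e q.1 q.2) D :=
    continuousOn_finsetSum _ fun j _ => (hρD j).mul ((huj j).pow 2)
  have hetc : ContinuousOn (fun q : ℝ × ℝ => et q.1 q.2) D :=
    continuousOn_finsetSum _ fun j _ =>
      (hρD j).mul ((continuousOn_const.mul (huj j)).mul (hutj j))
  have hnorm : ∀ x t, ‖u x t‖ ^ 2 = ∑ j, u x t j ^ 2 := by
    intro x t
    rw [EuclideanSpace.norm_sq_eq]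
    simp
  have hnc : ContinuousOn (fun q : ℝ × ℝ => ‖u q.1 q.2‖ ^ 2) D := huc.norm.pow 2
  have hslice : ∀ (G : ℝ → ℝ → ℝ), ContinuousOn (fun q : ℝ × ℝ => G q.1 q.2) D → ∀ τ, s ≤ τ →
      ContinuousOn (fun x => G x τ) (Icc 0 1) := by
    intro G hG τ hτ
    exact hG.comp (f := fun y : ℝ => ((y, τ) : ℝ × ℝ)) (by fun_prop) (fun y hy => ⟨hy, hτ⟩)
  have hIntv : ∀ (G : ℝ → ℝ), ContinuousOn G (Icc 0 1) →
      IntervalIntegrable G volume 0 1 := by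
    intro G hG
    apply ContinuousOn.intervalIntegrable
    rwa [uIcc_of_le zero_le_one]
  -- comparison of energies
  have hlow : ∀ τ, s ≤ τ → ε * ∫ x in (0:ℝ)..1, ‖u x τ‖ ^ 2 ≤ ∫ x in (0:ℝ)..1, e x τ := by
    intro τ hτ
    rw [← intervalIntegral.integral_const_mul]
    refine intervalIntegral.integral_mono_on zero_le_one
      ((hIntv _ (hslice (fun x t => ‖u x t‖ ^ 2) hnc τ hτ)).const_mul ε) (hIntv _ (hslice e hec τ hτ)) ?_
    intro x hx
    rw [hnorm, Finset.mul_sum]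
    exact Finset.sum_le_sum fun j _ => mul_le_mul_of_nonneg_right (hρb j x hx).1 (sq_nonneg _)
  have hup : ∀ τ, s ≤ τ → ∫ x in (0:ℝ)..1, e x τ ≤ ∫ x in (0:ℝ)..1, ‖u x τ‖ ^ 2 := by
    intro τ hτ
    refine intervalIntegral.integral_mono_on zero_le_one (hIntv _ (hslice e hec τ hτ))
      (hIntv _ (hslice (fun x t => ‖u x t‖ ^ 2) hnc τ hτ)) ?_
    intro x hx
    rw [hnorm]
    refine Finset.sum_le_sum fun j _ => ?_
    nlinarith [(hρb j x hx).2, sq_nonneg (u x τ j)]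
  have hEc : ContinuousOn (fun t => ∫ x in (0:ℝ)..1, e x t) (Ici s) := continuousOn_param hec
  have hEd : ∀ τ, s < τ → HasDerivAt (fun t => ∫ x in (0:ℝ)..1, e x t)
      (∫ x in (0:ℝ)..1, et x τ) τ := by
    intro τ hτ
    have hsub : (uIcc (0:ℝ) 1 ×ˢ Icc (τ - (τ - s)) (τ + (τ - s))) ⊆ D := by
      rw [uIcc_of_le zero_le_one]
      refine prod_mono_right ?_
      intro r hr
      have := hr.1
      show s ≤ r
      linarith
    refine hasDerivAt_param e et 0 1 τ (τ - s) (by linarith) (hec.mono hsub) (hetc.mono hsub) ?_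
    intro y hy r hr
    rw [uIcc_of_le zero_le_one] at hy
    have hr' : s < r := by have := hr.1; linarith
    refine HasDerivAt.fun_sum fun j _ => ?_
    have h1 := ((hder y hy r hr'.le j).2).hasDerivAt (Ici_mem_nhds hr')
    have h2 := (h1.fun_pow 2).const_mul (ρ j y)
    refine h2.congr_deriv ?_
    push_cast; ring
  have hkey : ∀ τ, s < τ → ∫ x in (0:ℝ)..1, et x τ ≤ ν * (∫ x in (0:ℝ)..1, e x τ) + n * F ^ 2 := by
    intro τ hτ
    have hτ' : τ ∈ Ici s := hτ.le
    set fl : ℝ → ℝ := fun x => ∑ j, ρ j x * a x τ j * u x τ j ^ 2 with hfl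
    set fl' : ℝ → ℝ := fun x => ∑ j, ((ρ' j * a x τ j + ρ j x * ax j x τ) * u x τ j ^ 2 +
      ρ j x * a x τ j * (2 * u x τ j * ux x τ j)) with hfl'
    have hflc : ContinuousOn fl' (Icc 0 1) := by
      have hst : ∀ g : ℝ → ℝ → ℝ, ContinuousOn (fun q : ℝ × ℝ => g q.1 q.2) strip →
          ContinuousOn (fun x => g x τ) (Icc 0 1) := by
        intro g hg
        exact hg.comp (f := fun y : ℝ => ((y, τ) : ℝ × ℝ)) (by fun_prop)
          (fun y hy => ⟨hy, mem_univ _⟩)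
      refine continuousOn_finsetSum _ fun j _ => ?_
      have c1 := hst (fun x t => a x t j) (hac j)
      have c2 := hst (ax j) (haxc j)
      have c3 := hslice (fun x t => u x t j) (huj j) τ hτ.le
      have c4 := hslice (fun x t => ux x t j) (huxj j) τ hτ.le
      have c5 := (hρc j).continuousOn (s := Icc (0:ℝ) 1)
      exact (((continuousOn_const.mul c1).add (c5.mul c2)).mul (c3.pow 2)).add
        ((c5.mul c1).mul ((continuousOn_const.mul c3).mul c4))
    have hfld : ∀ x ∈ Icc (0:ℝ) 1, HasDerivWithinAt fl (fl' x) (Icc 0 1) x := by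
      intro x hx
      refine HasDerivWithinAt.fun_sum fun j _ => ?_
      have d1 := (hae j x hx τ).2.2.2.1
      have d2 := (hder x hx τ hτ' j).1
      have d3 := ((hρd j x).hasDerivWithinAt (s := Icc (0:ℝ) 1)).fun_mul d1
      have d4 := d3.fun_mul (d2.fun_pow 2)
      refine d4.congr_deriv ?_
      push_cast; ring
    have hftc : ∫ x in (0:ℝ)..1, fl' x = fl 1 - fl 0 := by
      refine intervalIntegral.integral_eq_sub_of_hasDerivAt_of_le zero_le_one
        (fun x hx => (hfld x hx).continuousWithinAt) ?_ (hIntv _ hflc)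
      intro x hx
      exact (hfld x (Ioo_subset_Icc_self hx)).hasDerivAt (Icc_mem_nhds hx.1 hx.2)
    have hbdry : 0 ≤ fl 1 - fl 0 := by
      -- outgoing values
      set o : Fin n → ℝ := fun k => if m ≤ (k : ℕ) then u 0 τ k else u 1 τ k with ho
      have hcs : ∀ j, (∑ k, p j k * o k) ^ 2 ≤ (∑ k, p j k ^ 2) * ∑ k, o k ^ 2 := fun j =>
        Finset.sum_mul_sq_le_sq_mul_sq _ _ _
      have hsum : ∀ j, (∑ k : Fin n, if m ≤ (k : ℕ) then p j k * u 0 τ k else p j k * u 1 τ k)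
          = ∑ k, p j k * o k := by
        intro j
        refine Finset.sum_congr rfl fun k _ => ?_
        simp only [ho]; split_ifs <;> rfl
      have hj : ∀ j, Λ₀ * o j ^ 2 - ε * A * (∑ k, p j k * o k) ^ 2 ≤
          ρ j 1 * a 1 τ j * u 1 τ j ^ 2 - ρ j 0 * a 0 τ j * u 0 τ j ^ 2 := by
        intro j
        have l0 := (hLam 0 ⟨le_rfl, zero_le_one⟩ τ).1 j
        have l1 := (hLam 1 ⟨zero_le_one, le_rfl⟩ τ).1 j
        have a0 := abs_le.1 (hae j 0 ⟨le_rfl, zero_le_one⟩ τ).1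
        have a1 := abs_le.1 (hae j 1 ⟨zero_le_one, le_rfl⟩ τ).1
        have hb := hbc τ hτ' j
        rw [hsum] at hb
        by_cases hjm : (j : ℕ) < m
        · have h0 := hb.1 hjm
          have hoj : o j = u 1 τ j := by simp only [ho]; rw [if_neg (by omega)]
          have r1 : ρ j 1 = 1 := by simp only [hρ]; rw [if_pos hjm]; ring
          have r0 : ρ j 0 = ε := by simp only [hρ]; rw [if_pos hjm]; ring
          rw [r1, r0, hoj, ← h0]
          have q1 := mul_le_mul_of_nonneg_right (l1.1 hjm) (sq_nonneg (u 1 τ j))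
          have q2 : a 0 τ j * (ε * u 0 τ j ^ 2) ≤ A * (ε * u 0 τ j ^ 2) :=
            mul_le_mul_of_nonneg_right (a0.2.trans hCA) (by positivity)
          linarith
        · have hjm' : m ≤ (j : ℕ) := by omega
          have h0 := hb.2 hjm'
          have hoj : o j = u 0 τ j := by simp only [ho]; rw [if_pos hjm']
          have r1 : ρ j 1 = ε := by simp only [hρ]; rw [if_neg hjm]; ring
          have r0 : ρ j 0 = 1 := by simp only [hρ]; rw [if_neg hjm]; ring
          rw [r1, r0, hoj, ← h0]
          have q1 := mul_le_mul_of_nonneg_right (l0.2 hjm') (sq_nonneg (u 0 τ j))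
          have q2 : -A * (ε * u 1 τ j ^ 2) ≤ a 1 τ j * (ε * u 1 τ j ^ 2) :=
            mul_le_mul_of_nonneg_right ((by linarith : -A ≤ -C).trans a1.1) (by positivity)
          linarith
      have hsumj : Λ₀ * ∑ j, o j ^ 2 - ε * A * (P2 * ∑ k, o k ^ 2) ≤ fl 1 - fl 0 := by
        have h1 := Finset.sum_le_sum fun j (_ : j ∈ Finset.univ) => hj j
        rw [Finset.sum_sub_distrib, Finset.sum_sub_distrib, ← Finset.mul_sum,
          ← Finset.mul_sum] at h1
        have h2 : ∑ j, (∑ k, p j k * o k) ^ 2 ≤ P2 * ∑ k, o k ^ 2 := by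
          rw [hP2, Finset.sum_mul]
          exact Finset.sum_le_sum fun j _ => hcs j
        have h3 := mul_le_mul_of_nonneg_left h2 (show 0 ≤ ε * A by positivity)
        simp only [hfl]
        linarith
      have hos : 0 ≤ ∑ k, o k ^ 2 := by positivity
      nlinarith [mul_le_mul_of_nonneg_right hεP hos]
    have hpt : ∀ x ∈ Icc (0:ℝ) 1, et x τ + fl' x ≤ ν * e x τ + n * F ^ 2 := by
      intro x hx
      have hS : (1 + 2 * A + 2 * n * A) * ∑ j, u x τ j ^ 2 ≤ ν * e x τ := by
        rw [← hνε, mul_assoc]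
        refine mul_le_mul_of_nonneg_left ?_ hν0
        rw [Finset.mul_sum]
        exact Finset.sum_le_sum fun j _ =>
          mul_le_mul_of_nonneg_right (hρb j x hx).1 (sq_nonneg _)
      have hterm : ∀ j, ρ j x * (2 * u x τ j * ut x τ j) +
          ((ρ' j * a x τ j + ρ j x * ax j x τ) * u x τ j ^ 2 +
            ρ j x * a x τ j * (2 * u x τ j * ux x τ j)) ≤
          (1 + 2 * A) * u x τ j ^ 2 + F ^ 2 + ∑ k, A * (u x τ j ^ 2 + u x τ k ^ 2) := by
        intro j
        have hpde := heq x hx τ hτ' j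
        have hff := hf x hx τ hτ' j
        obtain ⟨ha1, ha2, -⟩ := hae j x hx τ
        obtain ⟨r0, r1⟩ := hρb j x hx
        have hr0 : 0 ≤ ρ j x := hε0.le.trans r0
        have hut : ut x τ j = f x τ j - a x τ j * ux x τ j - ∑ k, b x τ j k * u x τ k := by
          linarith
        have t1 : ρ j x * (2 * u x τ j * f x τ j) ≤ u x τ j ^ 2 + F ^ 2 := by
          have h1 : 2 * u x τ j * f x τ j ≤ u x τ j ^ 2 + f x τ j ^ 2 := by
            nlinarith [sq_nonneg (u x τ j - f x τ j)]
          have h2 : f x τ j ^ 2 ≤ F ^ 2 := sq_le_sq' (abs_le.1 hff).1 (abs_le.1 hff).2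
          have h3 : 0 ≤ u x τ j ^ 2 + f x τ j ^ 2 := by positivity
          nlinarith [mul_le_mul_of_nonneg_left h1 hr0, mul_le_mul_of_nonneg_right r1 h3]
        have t2 : (ρ' j * a x τ j + ρ j x * ax j x τ) * u x τ j ^ 2 ≤ 2 * A * u x τ j ^ 2 := by
          refine mul_le_mul_of_nonneg_right ?_ (sq_nonneg _)
          have h1 : ρ' j * a x τ j ≤ 1 * A := by
            refine (le_abs_self _).trans ?_
            rw [abs_mul]
            exact mul_le_mul (hρ'b j) (ha1.trans hCA) (abs_nonneg _) zero_le_one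
          have h2 : ρ j x * ax j x τ ≤ 1 * A := by
            refine (le_abs_self _).trans ?_
            rw [abs_mul, abs_of_nonneg hr0]
            exact mul_le_mul r1 (ha2.trans hCA) (abs_nonneg _) zero_le_one
          linarith
        have t3 : -(ρ j x * (2 * u x τ j * ∑ k, b x τ j k * u x τ k)) ≤
            ∑ k, A * (u x τ j ^ 2 + u x τ k ^ 2) := by
          rw [Finset.mul_sum, Finset.mul_sum, ← Finset.sum_neg_distrib]
          refine Finset.sum_le_sum fun k _ => ?_
          have hb1 := (hbb x hx τ j k).trans hCA
          have h1 : |2 * u x τ j * u x τ k| ≤ u x τ j ^ 2 + u x τ k ^ 2 := by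
            rw [abs_le]
            constructor
            · nlinarith [sq_nonneg (u x τ j + u x τ k)]
            · nlinarith [sq_nonneg (u x τ j - u x τ k)]
          have h2 : |ρ j x * b x τ j k| ≤ A := by
            rw [abs_mul, abs_of_nonneg hr0]
            calc ρ j x * |b x τ j k| ≤ 1 * A :=
                  mul_le_mul r1 hb1 (abs_nonneg _) zero_le_one
              _ = A := one_mul _
          calc -(ρ j x * (2 * u x τ j * (b x τ j k * u x τ k)))
              ≤ |ρ j x * b x τ j k| * |2 * u x τ j * u x τ k| := by
                rw [← abs_mul]
                refine le_trans (le_of_eq ?_) (neg_le_abs _)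
                ring
            _ ≤ _ := mul_le_mul h2 h1 (abs_nonneg _) hA0.le
        rw [hut]
        have : ρ j x * (2 * u x τ j * (f x τ j - a x τ j * ux x τ j -
            ∑ k, b x τ j k * u x τ k)) = ρ j x * (2 * u x τ j * f x τ j) -
            ρ j x * a x τ j * (2 * u x τ j * ux x τ j) -
            ρ j x * (2 * u x τ j * ∑ k, b x τ j k * u x τ k) := by ring
        rw [this]
        linarith
      have hsumt := Finset.sum_le_sum fun j (_ : j ∈ Finset.univ) => hterm j
      have hrhs : ∑ j : Fin n, ((1 + 2 * A) * u x τ j ^ 2 + F ^ 2 +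
          ∑ k, A * (u x τ j ^ 2 + u x τ k ^ 2)) =
          (1 + 2 * A + 2 * n * A) * ∑ j, u x τ j ^ 2 + n * F ^ 2 := by
        have : ∀ j, ∑ k, A * (u x τ j ^ 2 + u x τ k ^ 2) =
            n * A * u x τ j ^ 2 + A * ∑ k, u x τ k ^ 2 := by
          intro j
          rw [← Finset.mul_sum, Finset.sum_add_distrib]
          simp
          ring
        simp only [this, Finset.sum_add_distrib, ← Finset.mul_sum, Finset.sum_const,
          Finset.card_univ, Fintype.card_fin, nsmul_eq_mul]
        ring
      rw [hrhs, Finset.sum_add_distrib] at hsumt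
      simp only [het, hfl']
      linarith
    have hmono : ∫ x in (0:ℝ)..1, (et x τ + fl' x) ≤
        ∫ x in (0:ℝ)..1, (ν * e x τ + n * F ^ 2) := by
      refine intervalIntegral.integral_mono_on zero_le_one
        ((hIntv _ (hslice et hetc τ hτ.le)).add (hIntv _ hflc))
        (((hIntv _ (hslice e hec τ hτ.le)).const_mul ν).add intervalIntegrable_const) hpt
    rw [intervalIntegral.integral_add (hIntv _ (hslice et hetc τ hτ.le)) (hIntv _ hflc),
      intervalIntegral.integral_add ((hIntv _ (hslice e hec τ hτ.le)).const_mul ν)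
        intervalIntegrable_const, intervalIntegral.integral_const_mul,
      intervalIntegral.integral_const, hftc] at hmono
    simp only [sub_zero, one_smul] at hmono
    linarith
  have hgr := gronwall_aux (N := n * F ^ 2) hν0 (by positivity) hEc hEd hkey t ht
  have h1 := hlow t ht
  have h2 := hup s le_rfl
  have hS0 : 0 ≤ ∫ x in (0:ℝ)..1, ‖u x s‖ ^ 2 :=
    intervalIntegral.integral_nonneg zero_le_one fun x _ => by positivity
  rw [show (n:ℝ) / ε * Real.exp (ν * (t - s)) *
      ((∫ x in (0:ℝ)..1, ‖u x s‖ ^ 2) + F ^ 2 * (t - s)) =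
    (Real.exp (ν * (t - s)) * (n * (∫ x in (0:ℝ)..1, ‖u x s‖ ^ 2) + n * F ^ 2 * (t - s))) / ε by
      field_simp, le_div_iff₀ hε0]
  rw [mul_comm]
  refine (h1.trans hgr).trans ?_
  refine mul_le_mul_of_nonneg_left ?_ (Real.exp_pos _).le
  nlinarith

/-! ### Characteristics -/

lemma lip_of_deriv {c ct : ℝ → ℝ} {L : ℝ} (hd : ∀ t, HasDerivAt c (ct t) t)
    (hL : ∀ t, |ct t| ≤ L) (t1 t2 : ℝ) : |c t1 - c t2| ≤ L * |t1 - t2| := by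
  have := Convex.norm_image_sub_le_of_norm_hasDerivWithin_le (f := c) (f' := ct) (s := univ)
    (C := L) (fun x _ => (hd x).hasDerivWithinAt) (fun x _ => hL x) convex_univ
    (mem_univ t2) (mem_univ t1)
  exact this

/-- `γ` solves the characteristic equation on `[0,1]`. -/
def IsChar (c : ℝ → ℝ → ℝ) (γ : ℝ → ℝ) : Prop :=
  ∀ y ∈ Icc (0:ℝ) 1, HasDerivWithinAt γ (c y (γ y)) (Icc 0 1) y

lemma IsChar.continuousOn {c : ℝ → ℝ → ℝ} {γ : ℝ → ℝ} (h : IsChar c γ) :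
    ContinuousOn γ (Icc 0 1) := fun y hy => (h y hy).continuousWithinAt

lemma IsChar.hasDerivAt {c : ℝ → ℝ → ℝ} {γ : ℝ → ℝ} (h : IsChar c γ) {y : ℝ}
    (hy : y ∈ Ioo (0:ℝ) 1) : HasDerivAt γ (c y (γ y)) y :=
  (h y (Ioo_subset_Icc_self hy)).hasDerivAt (Icc_mem_nhds hy.1 hy.2)

lemma char_compare {c : ℝ → ℝ → ℝ} {L : ℝ} (hL0 : 0 ≤ L)
    (hL : ∀ y t1 t2, |c y t1 - c y t2| ≤ L * |t1 - t2|) {γ₁ γ₂ : ℝ → ℝ}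
    (h1 : IsChar c γ₁) (h2 : IsChar c γ₂) {x y : ℝ} (hx : x ∈ Icc (0:ℝ) 1)
    (hy : y ∈ Icc (0:ℝ) 1) : |γ₁ y - γ₂ y| ≤ Real.exp L * |γ₁ x - γ₂ x| := by
  set D : ℝ → ℝ := fun y => γ₁ y - γ₂ y with hD
  have hDc : ContinuousOn D (Icc 0 1) := h1.continuousOn.sub h2.continuousOn
  have key : ∀ κ : ℝ, ∀ z ∈ Ioo (0:ℝ) 1, HasDerivAt (fun z => D z ^ 2 * Real.exp (κ * z))
      (Real.exp (κ * z) * (2 * D z * (c z (γ₁ z) - c z (γ₂ z)) + κ * D z ^ 2)) z := by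
    intro κ z hz
    have d1 := ((h1.hasDerivAt hz).fun_sub (h2.hasDerivAt hz)).fun_pow 2
    have d2 : HasDerivAt (fun z => Real.exp (κ * z)) (Real.exp (κ * z) * κ) z := by
      have : HasDerivAt (fun z => κ * z) κ z := by simpa using (hasDerivAt_id z).const_mul κ
      exact this.exp
    refine (d1.fun_mul d2).congr_deriv ?_
    simp only [hD]; push_cast; ring
  have hest : ∀ z, |2 * D z * (c z (γ₁ z) - c z (γ₂ z))| ≤ 2 * L * D z ^ 2 := by
    intro z
    rw [abs_mul, abs_mul, abs_two]
    have := hL z (γ₁ z) (γ₂ z)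
    have h3 : |D z| * |D z| = D z ^ 2 := by rw [abs_mul_abs_self]; ring
    nlinarith [abs_nonneg (D z), mul_le_mul_of_nonneg_left this (abs_nonneg (D z))]
  have hcont : ∀ κ : ℝ, ContinuousOn (fun z => D z ^ 2 * Real.exp (κ * z)) (Icc 0 1) :=
    fun κ => (hDc.pow 2).mul (by fun_prop)
  have hanti : AntitoneOn (fun z => D z ^ 2 * Real.exp (-(2 * L) * z)) (Icc 0 1) := by
    refine antitoneOn_of_deriv_nonpos (convex_Icc 0 1) (hcont _) ?_ ?_
    · intro z hz
      rw [interior_Icc] at hz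
      exact (key _ z hz).differentiableAt.differentiableWithinAt
    · intro z hz
      rw [interior_Icc] at hz
      rw [(key _ z hz).deriv]
      have := (abs_le.1 (hest z)).2
      exact mul_nonpos_of_nonneg_of_nonpos (Real.exp_pos _).le (by linarith)
  have hmono : MonotoneOn (fun z => D z ^ 2 * Real.exp ((2 * L) * z)) (Icc 0 1) := by
    refine monotoneOn_of_deriv_nonneg (convex_Icc 0 1) (hcont _) ?_ ?_
    · intro z hz
      rw [interior_Icc] at hz
      exact (key _ z hz).differentiableAt.differentiableWithinAt
    · intro z hz
      rw [interior_Icc] at hz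
      rw [(key _ z hz).deriv]
      have := (abs_le.1 (hest z)).1
      exact mul_nonneg (Real.exp_pos _).le (by linarith)
  have hsq : D y ^ 2 ≤ (Real.exp L * |D x|) ^ 2 := by
    have hgen : ∀ κ : ℝ, D y ^ 2 * Real.exp (κ * y) ≤ D x ^ 2 * Real.exp (κ * x) →
        κ * (x - y) ≤ 2 * L → D y ^ 2 ≤ (Real.exp L * |D x|) ^ 2 := by
      intro κ h hκ
      have e1 : D y ^ 2 = (D y ^ 2 * Real.exp (κ * y)) * Real.exp (-(κ * y)) := by
        rw [mul_assoc, ← Real.exp_add]; simp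
      rw [e1]
      refine (mul_le_mul_of_nonneg_right h (Real.exp_pos _).le).trans ?_
      rw [mul_assoc, ← Real.exp_add, mul_pow, sq_abs, ← Real.exp_nat_mul, mul_comm]
      refine mul_le_mul_of_nonneg_right (Real.exp_le_exp.2 ?_) (sq_nonneg _)
      push_cast
      linarith
    rcases le_total x y with hxy | hxy
    · refine hgen (-(2 * L)) (hanti hx hy hxy) ?_
      nlinarith [hx.1, hy.2]
    · refine hgen (2 * L) (hmono hy hx hxy) ?_
      nlinarith [hx.2, hy.1]
  have := abs_le_of_sq_le_sq hsq (by positivity)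
  exact this

lemma char_exists {c : ℝ → ℝ → ℝ} {B L : ℝ}
    (hc : Continuous (fun q : ℝ × ℝ => c q.1 q.2)) (hB0 : 0 ≤ B) (hL0 : 0 ≤ L)
    (hB : ∀ y t, |c y t| ≤ B)
    (hL : ∀ y t1 t2, |c y t1 - c y t2| ≤ L * |t1 - t2|) {x : ℝ} (hx : x ∈ Icc (0:ℝ) 1) (t : ℝ) :
    ∃ γ : ℝ → ℝ, γ x = t ∧ IsChar c γ := by
  have hpl : IsPicardLindelof c (tmin := 0) (tmax := 1) ⟨x, hx⟩ t ⟨B, hB0⟩ 0 ⟨B, hB0⟩ ⟨L, hL0⟩ := by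
    refine ⟨?_, ?_, ?_, ?_⟩
    · intro y _
      refine LipschitzOnWith.of_dist_le_mul fun t1 _ t2 _ => ?_
      rw [Real.dist_eq, Real.dist_eq]
      exact hL y t1 t2
    · intro r _
      exact (hc.comp (by fun_prop : Continuous fun y : ℝ => ((y, r) : ℝ × ℝ))).continuousOn
    · intro y _ r _
      exact hB y r
    · show B * max (1 - x) (x - 0) ≤ B - 0
      have : max (1 - x) (x - 0) ≤ 1 := max_le (by linarith [hx.1]) (by linarith [hx.2])
      nlinarith
  obtain ⟨γ, h1, h2⟩ := hpl.exists_eq_forall_mem_Icc_hasDerivWithinAt₀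
  exact ⟨γ, h1, h2⟩

lemma char_lip {c : ℝ → ℝ → ℝ} {B : ℝ} (hB : ∀ y t, |c y t| ≤ B) {γ : ℝ → ℝ}
    (h : IsChar c γ) {x y : ℝ} (hx : x ∈ Icc (0:ℝ) 1) (hy : y ∈ Icc (0:ℝ) 1) :
    |γ y - γ x| ≤ B * |y - x| :=
  Convex.norm_image_sub_le_of_norm_hasDerivWithin_le (f := γ) (s := Icc 0 1) h
    (fun z _ => hB z _) (convex_Icc 0 1) hx hy

/-- exact formula for the difference of two characteristics -/
lemma char_diff {c : ℝ → ℝ → ℝ} {L : ℝ} (hL0 : 0 ≤ L)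
    (hc : Continuous (fun q : ℝ × ℝ => c q.1 q.2))
    (hL : ∀ y t1 t2, |c y t1 - c y t2| ≤ L * |t1 - t2|) {γ₁ γ₂ : ℝ → ℝ}
    (h1 : IsChar c γ₁) (h2 : IsChar c γ₂) {x y : ℝ} (hx : x ∈ Icc (0:ℝ) 1)
    (hy : y ∈ Icc (0:ℝ) 1) (hne : γ₁ x ≠ γ₂ x) :
    γ₁ y - γ₂ y = (γ₁ x - γ₂ x) * Real.exp (∫ z in x..y,
      (c (pj z) (γ₁ (pj z)) - c (pj z) (γ₂ (pj z))) / (γ₁ (pj z) - γ₂ (pj z))) := by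
  have hne' : ∀ z ∈ Icc (0:ℝ) 1, γ₁ z - γ₂ z ≠ 0 := by
    intro z hz h0
    have := char_compare hL0 hL h1 h2 hz hx
    rw [h0, abs_zero, mul_zero] at this
    have := abs_nonpos_iff.1 this
    exact hne (sub_eq_zero.1 this)
  have hpc : ∀ {γ : ℝ → ℝ}, IsChar c γ → Continuous fun z => γ (pj z) := fun hγ =>
    hγ.continuousOn.comp_continuous continuous_pj pj_mem
  set g : ℝ → ℝ := fun z =>
    (c (pj z) (γ₁ (pj z)) - c (pj z) (γ₂ (pj z))) / (γ₁ (pj z) - γ₂ (pj z)) with hg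
  have hcc : ∀ {γ : ℝ → ℝ}, IsChar c γ → Continuous fun z => c (pj z) (γ (pj z)) := fun hγ =>
    hc.comp (continuous_pj.prodMk (hpc hγ))
  have hgc : Continuous g :=
    ((hcc h1).sub (hcc h2)).div ((hpc h1).sub (hpc h2)) fun z => hne' _ (pj_mem z)
  set W : ℝ → ℝ := fun z => (γ₁ z - γ₂ z) * Real.exp (-∫ r in (0:ℝ)..z, g r) with hW
  have hWd : ∀ z ∈ Icc (0:ℝ) 1, HasDerivWithinAt W 0 (Icc 0 1) z := by
    intro z hz
    have d1 : HasDerivAt (fun z => ∫ r in (0:ℝ)..z, g r) (g z) z :=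
      hgc.integral_hasStrictDerivAt 0 z |>.hasDerivAt
    have d2 := (d1.fun_neg.exp).hasDerivWithinAt (s := Icc (0:ℝ) 1)
    refine (((h1 z hz).fun_sub (h2 z hz)).fun_mul d2).congr_deriv ?_
    have : g z * (γ₁ z - γ₂ z) = c z (γ₁ z) - c z (γ₂ z) := by
      simp only [hg, pj_eq hz]
      exact div_mul_cancel₀ _ (hne' z hz)
    rw [← this]; ring
  have hconst : ∀ z ∈ Icc (0:ℝ) 1, W z = W 0 := by
    refine constant_of_has_deriv_right_zero (fun z hz => (hWd z hz).continuousWithinAt) ?_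
    intro z hz
    have := hWd z (Ico_subset_Icc_self hz)
    exact this.mono_of_mem_nhdsWithin (Icc_mem_nhdsGE_of_mem hz)
  have hxy : W y = W x := by rw [hconst y hy, hconst x hx]
  have hii : ∀ u v, IntervalIntegrable g volume u v := fun u v => hgc.intervalIntegrable u v
  have hsplit : ∫ z in x..y, g z = (∫ z in (0:ℝ)..y, g z) - ∫ z in (0:ℝ)..x, g z :=
    (intervalIntegral.integral_interval_sub_left (hii 0 y) (hii 0 x)).symm
  rw [hsplit]
  simp only [hW] at hxy
  have e1 : γ₁ y - γ₂ y = (γ₁ y - γ₂ y) * Real.exp (-∫ r in (0:ℝ)..y, g r) *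
      Real.exp (∫ r in (0:ℝ)..y, g r) := by
    rw [mul_assoc, ← Real.exp_add]; simp
  rw [e1, hxy, mul_assoc, ← Real.exp_add]
  congr 2; ring

theorem flow_exists {c ct : ℝ → ℝ → ℝ} {B L : ℝ}
    (hc : Continuous (fun q : ℝ × ℝ => c q.1 q.2))
    (hct : Continuous (fun q : ℝ × ℝ => ct q.1 q.2))
    (hd : ∀ y t, HasDerivAt (c y) (ct y t) t)
    (hB : ∀ y t, |c y t| ≤ B) (hLt : ∀ y t, |ct y t| ≤ L) :
    ∃ T θ : ℝ → ℝ → ℝ → ℝ,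
      Continuous (fun q : ℝ × ℝ × ℝ => T q.1 q.2.1 q.2.2) ∧
      Continuous (fun q : ℝ × ℝ × ℝ => θ q.1 q.2.1 q.2.2) ∧
      (∀ x ∈ Icc (0:ℝ) 1, ∀ t, T x x t = t) ∧
      (∀ x ∈ Icc (0:ℝ) 1, ∀ t, IsChar c (fun y => T y x t)) ∧
      (∀ x ∈ Icc (0:ℝ) 1, ∀ y ∈ Icc (0:ℝ) 1, ∀ z ∈ Icc (0:ℝ) 1, ∀ t,
        T y z (T z x t) = T y x t) ∧
      (∀ x ∈ Icc (0:ℝ) 1, ∀ y ∈ Icc (0:ℝ) 1, ∀ t, HasDerivAt (T y x) (θ y x t) t) ∧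
      (∀ y x t, |θ y x t| ≤ Real.exp L) := by
  have hB0 : 0 ≤ B := (abs_nonneg _).trans (hB 0 0)
  have hL0 : 0 ≤ L := (abs_nonneg _).trans (hLt 0 0)
  have hL : ∀ y t1 t2, |c y t1 - c y t2| ≤ L * |t1 - t2| := fun y =>
    lip_of_deriv (hd y) (hLt y)
  choose S hS0 hS using fun (x t : ℝ) => char_exists hc hB0 hL0 hB hL (pj_mem x) t
  set T : ℝ → ℝ → ℝ → ℝ := fun y x t => S x t (pj y) with hT
  have hTchar : ∀ x t, IsChar c (fun y => T y x t) := by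
    intro x t y hy
    have := hS x t y hy
    simp only [hT]
    rw [pj_eq hy]
    exact this.congr_of_mem (fun z hz => by rw [pj_eq hz]) hy
  have hT0 : ∀ x t, T x x t = t := hS0
  have hTe : ∀ y y' x x' t t', |T y x t - T y' x' t'| ≤ B * |pj y - pj y'| +
      Real.exp L * (|t - t'| + B * |pj x - pj x'|) := by
    intro y y' x x' t t'
    have e1 : |T y x t - T y' x t| ≤ B * |pj y - pj y'| :=
      char_lip hB (hS x t) (pj_mem y') (pj_mem y)
    have e2 : |T y' x t - T y' x' t'| ≤ Real.exp L * |T x x t - T x x' t'| :=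
      char_compare hL0 hL (hS x t) (hS x' t') (pj_mem x) (pj_mem y')
    have e3 : |T x x t - T x x' t'| ≤ |t - t'| + B * |pj x - pj x'| := by
      have e4 : |T x x' t' - T x' x' t'| ≤ B * |pj x - pj x'| :=
        char_lip hB (hS x' t') (pj_mem x') (pj_mem x)
      rw [hT0 x' t'] at e4
      rw [hT0 x t]
      have : t - T x x' t' = (t - t') - (T x x' t' - t') := by ring
      rw [this]
      exact (abs_sub _ _).trans (by linarith)
    have e5 : T y x t - T y' x' t' = (T y x t - T y' x t) + (T y' x t - T y' x' t') := by ring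
    rw [e5]
    refine (abs_add_le _ _).trans (add_le_add e1 (e2.trans ?_))
    exact mul_le_mul_of_nonneg_left e3 (Real.exp_pos _).le
  have hTc : Continuous (fun q : ℝ × ℝ × ℝ => T q.1 q.2.1 q.2.2) := by
    rw [continuous_iff_continuousAt]
    rintro ⟨y0, x0, t0⟩
    rw [ContinuousAt, tendsto_iff_dist_tendsto_zero]
    have hz : Continuous (fun q : ℝ × ℝ × ℝ => B * |pj q.1 - pj y0| +
      Real.exp L * (|q.2.2 - t0| + B * |pj q.2.1 - pj x0|)) := by fun_prop
    have hz0 := hz.tendsto (y0, x0, t0)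
    simp only [sub_self, abs_zero, mul_zero, add_zero] at hz0
    exact squeeze_zero (fun _ => dist_nonneg)
      (fun q => by rw [Real.dist_eq]; exact hTe q.1 y0 q.2.1 x0 q.2.2 t0) hz0
  set P : ℝ → ℝ → ℝ → ℝ := fun y x t => ∫ z in (0:ℝ)..(pj y), ct z (T z x t) with hP
  have hPc : Continuous (fun q : ℝ × ℝ × ℝ => P q.1 q.2.1 q.2.2) := by
    refine intervalIntegral.continuous_parametric_intervalIntegral_of_continuous
      (f := fun (q : ℝ × ℝ × ℝ) z => ct z (T z q.2.1 q.2.2)) ?_ (by fun_prop)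
    have h1 : Continuous (fun r : (ℝ × ℝ × ℝ) × ℝ => T r.2 r.1.2.1 r.1.2.2) :=
      hTc.comp (by fun_prop : Continuous fun r : (ℝ × ℝ × ℝ) × ℝ =>
        ((r.2, r.1.2.1, r.1.2.2) : ℝ × ℝ × ℝ))
    exact hct.comp (continuous_snd.prodMk h1)
  have hgc : ∀ x t, Continuous fun z => ct z (T z x t) := by
    intro x t
    have h1 : Continuous (fun z : ℝ => T z x t) :=
      hTc.comp (by fun_prop : Continuous fun z : ℝ => ((z, x, t) : ℝ × ℝ × ℝ))
    exact hct.comp (continuous_id.prodMk h1)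
  have hPsub : ∀ y x t, P y x t - P x x t = ∫ z in (pj x)..(pj y), ct z (T z x t) := by
    intro y x t
    exact intervalIntegral.integral_interval_sub_left ((hgc x t).intervalIntegrable _ _)
      ((hgc x t).intervalIntegrable _ _)
  refine ⟨T, fun y x t => Real.exp (P y x t - P x x t), hTc, ?_, fun x _ t => hT0 x t,
    fun x _ t => hTchar x t, ?_, ?_, ?_⟩
  · refine Real.continuous_exp.comp (hPc.sub ?_)
    exact hPc.comp (by fun_prop : Continuous fun q : ℝ × ℝ × ℝ =>
        ((q.2.1, q.2.1, q.2.2) : ℝ × ℝ × ℝ))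
  · intro x hx y hy z hz t
    have := char_compare hL0 hL (hTchar z (T z x t)) (hTchar x t) hz hy
    simp only [hT0, sub_self, abs_zero, mul_zero] at this
    exact sub_eq_zero.1 (abs_nonpos_iff.1 this)
  · intro x hx y hy t
    show HasDerivAt (T y x) (Real.exp (P y x t - P x x t)) t
    rw [hasDerivAt_iff_tendsto_slope, hPsub, pj_eq hx, pj_eq hy]
    have hTt : ∀ z, Continuous (fun t' => T z x t') := fun z =>
      hTc.comp (by fun_prop : Continuous fun t' : ℝ => ((z, x, t') : ℝ × ℝ × ℝ))
    have hne : ∀ t', t' ≠ t → ∀ z ∈ Icc (0:ℝ) 1, T z x t' ≠ T z x t := by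
      intro t' ht' z hz h0
      have := char_compare hL0 hL (hTchar x t') (hTchar x t) hz hx
      simp only [hT0, h0, sub_self, abs_zero, mul_zero] at this
      exact ht' (sub_eq_zero.1 (abs_nonpos_iff.1 this))
    have hlim : Tendsto (fun t' => ∫ z in x..y,
        (c (pj z) (T (pj z) x t') - c (pj z) (T (pj z) x t)) / (T (pj z) x t' - T (pj z) x t))
        (nhdsWithin t {t}ᶜ) (nhds (∫ z in x..y, ct z (T z x t))) := by
      refine intervalIntegral.tendsto_integral_filter_of_dominated_convergence (fun _ => L)
        ?_ ?_ intervalIntegrable_const ?_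
      · filter_upwards [self_mem_nhdsWithin] with t' ht'
        refine Continuous.aestronglyMeasurable ?_
        have k1 : ∀ t', Continuous (fun z : ℝ => T (pj z) x t') := fun t' =>
          hTc.comp (by fun_prop : Continuous fun z : ℝ => ((pj z, x, t') : ℝ × ℝ × ℝ))
        have k2 : ∀ t', Continuous (fun z : ℝ => c (pj z) (T (pj z) x t')) := fun t' =>
          hc.comp (continuous_pj.prodMk (k1 t'))
        exact ((k2 t').sub (k2 t)).div ((k1 t').sub (k1 t)) fun z =>
          sub_ne_zero.2 (hne t' ht' _ (pj_mem z))
      · filter_upwards [self_mem_nhdsWithin] with t' ht'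
        refine Eventually.of_forall fun z _ => ?_
        rw [Real.norm_eq_abs, abs_div, div_le_iff₀
          (abs_pos.2 (sub_ne_zero.2 (hne t' ht' _ (pj_mem z))))]
        exact hL _ _ _
      · refine Eventually.of_forall fun z hz => ?_
        have hz' : z ∈ Icc (0:ℝ) 1 := by
          have := uIoc_subset_uIcc hz
          exact (uIcc_subset_Icc hx hy) this
        rw [pj_eq hz']
        have s1 := hasDerivAt_iff_tendsto_slope.1 (hd z (T z x t))
        have s2 : Tendsto (fun t' => T z x t') (nhdsWithin t {t}ᶜ)
            (nhdsWithin (T z x t) {T z x t}ᶜ) := by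
          refine tendsto_nhdsWithin_iff.2 ⟨((hTt z).tendsto t).mono_left nhdsWithin_le_nhds, ?_⟩
          filter_upwards [self_mem_nhdsWithin] with t' ht'
          exact hne t' ht' z hz'
        refine (s1.comp s2).congr fun t' => ?_
        simp only [Function.comp, slope_def_field]
    refine ((Real.continuous_exp.tendsto _).comp hlim).congr' ?_
    filter_upwards [self_mem_nhdsWithin] with t' ht'
    have hne' : t' - t ≠ 0 := sub_ne_zero.2 ht'
    have := char_diff hL0 hc hL (hTchar x t') (hTchar x t) hx hy
      (by simp only [hT0]; exact ht')
    simp only [hT0] at this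
    rw [slope_def_field, this]
    simp only [Function.comp]
    field_simp
  · intro y x t
    show |Real.exp (P y x t - P x x t)| ≤ Real.exp L
    rw [abs_of_pos (Real.exp_pos _), Real.exp_le_exp, hPsub]
    have h1 : ‖∫ z in (pj x)..(pj y), ct z (T z x t)‖ ≤ L * |pj y - pj x| :=
      intervalIntegral.norm_integral_le_of_norm_le_const fun z _ => hLt z _
    rw [Real.norm_eq_abs] at h1
    have h2 : |pj y - pj x| ≤ 1 := by
      have := pj_mem x; have := pj_mem y
      rw [abs_le]; constructor <;> linarith [(pj_mem x).1, (pj_mem x).2, (pj_mem y).1, (pj_mem y).2]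
    have := le_abs_self (∫ z in (pj x)..(pj y), ct z (T z x t))
    nlinarith

/-! ### Weighted fixed point -/

lemma weighted_fixed_point {X : Type*} [TopologicalSpace X] (ω : X → ℝ) (hω : Continuous ω)
    (hω0 : ∀ q, 0 < ω q) (Z : Set X) (Φ : (X → ℝ) → X → ℝ) (M₀ : ℝ)
    (h0 : ∀ q, |Φ (fun _ => 0) q| ≤ M₀ * ω q)
    (hcont : ∀ z, Continuous z → (∀ q ∈ Z, z q = 0) → Continuous (Φ z) ∧ ∀ q ∈ Z, Φ z q = 0)
    (hlip : ∀ z₁ z₂ M, Continuous z₁ → Continuous z₂ → (∀ q ∈ Z, z₁ q = 0) →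
      (∀ q ∈ Z, z₂ q = 0) → 0 ≤ M → (∀ q, |z₁ q - z₂ q| ≤ M * ω q) →
      ∀ q, |Φ z₁ q - Φ z₂ q| ≤ (M / 2) * ω q) :
    ∃ z, Continuous z ∧ (∀ q ∈ Z, z q = 0) ∧ Φ z = z := by
  classical
  let S : Set (BoundedContinuousFunction X ℝ) := {v | ∀ q ∈ Z, v q = 0}
  have hS : IsClosed S := by
    have : S = ⋂ q ∈ Z, {v : BoundedContinuousFunction X ℝ | v q = 0} := by
      ext v; simp [S]
    rw [this]
    refine isClosed_biInter fun q _ => isClosed_eq ?_ continuous_const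
    exact (BoundedContinuousFunction.lipschitz_eval_const q).continuous
  have hωne : ∀ q, ω q ≠ 0 := fun q => (hω0 q).ne'
  have hzc : ∀ v : S, Continuous (fun q => ω q * v.1 q) := fun v => hω.mul v.1.continuous
  have hzZ : ∀ v : S, ∀ q ∈ Z, ω q * v.1 q = 0 := fun v q hq => by rw [v.2 q hq, mul_zero]
  have hdiff : ∀ v₁ v₂ : S, ∀ q, |ω q * v₁.1 q - ω q * v₂.1 q| ≤ dist v₁ v₂ * ω q := by
    intro v₁ v₂ q
    rw [← mul_sub, abs_mul, abs_of_pos (hω0 q), mul_comm]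
    refine mul_le_mul_of_nonneg_right ?_ (hω0 q).le
    exact BoundedContinuousFunction.dist_coe_le_dist (f := v₁.1) (g := v₂.1) q
  have zS : (0 : BoundedContinuousFunction X ℝ) ∈ S := fun q _ => rfl
  have hΦd : ∀ v₁ v₂ : S, ∀ q, |Φ (fun q => ω q * v₁.1 q) q / ω q -
      Φ (fun q => ω q * v₂.1 q) q / ω q| ≤ dist v₁ v₂ / 2 := by
    intro v₁ v₂ q
    rw [← sub_div, abs_div, abs_of_pos (hω0 q), div_le_iff₀ (hω0 q)]
    exact hlip _ _ _ (hzc v₁) (hzc v₂) (hzZ v₁) (hzZ v₂) dist_nonneg (hdiff v₁ v₂) q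
  have hΦb : ∀ v : S, ∀ q, |Φ (fun q => ω q * v.1 q) q / ω q| ≤
      dist v ⟨0, zS⟩ / 2 + M₀ := by
    intro v q
    have h1 := hΦd v ⟨0, zS⟩ q
    have h2 : |Φ (fun q => ω q * (0 : BoundedContinuousFunction X ℝ) q) q / ω q| ≤ M₀ := by
      rw [abs_div, abs_of_pos (hω0 q), div_le_iff₀ (hω0 q)]
      simpa using h0 q
    have h3 := abs_add_le (Φ (fun q => ω q * v.1 q) q / ω q -
      Φ (fun q => ω q * (0 : BoundedContinuousFunction X ℝ) q) q / ω q)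
      (Φ (fun q => ω q * (0 : BoundedContinuousFunction X ℝ) q) q / ω q)
    rw [sub_add_cancel] at h3
    exact h3.trans (add_le_add h1 h2)
  let F : S → S := fun v =>
    ⟨BoundedContinuousFunction.ofNormedAddCommGroup
      (fun q => Φ (fun q => ω q * v.1 q) q / ω q)
      ((hcont _ (hzc v) (hzZ v)).1.div hω hωne) (dist v ⟨0, zS⟩ / 2 + M₀)
      (fun q => hΦb v q), fun q hq => by
        show Φ (fun q => ω q * v.1 q) q / ω q = 0
        rw [(hcont _ (hzc v) (hzZ v)).2 q hq, zero_div]⟩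
  have hF : ContractingWith (1/2) F := by
    refine ⟨?_, LipschitzWith.of_dist_le_mul fun v₁ v₂ => ?_⟩
    · rw [← NNReal.coe_lt_coe]; norm_num
    · rw [Subtype.dist_eq, BoundedContinuousFunction.dist_le (by positivity)]
      intro q
      have := hΦd v₁ v₂ q
      rw [Real.dist_eq]
      refine this.trans (le_of_eq ?_)
      push_cast; ring
  have : CompleteSpace S := hS.completeSpace_coe
  have : Nonempty S := ⟨⟨0, zS⟩⟩
  have hfix := hF.fixedPoint_isFixedPt
  set v := hF.fixedPoint F with hv
  refine ⟨fun q => ω q * v.1 q, hzc v, hzZ v, ?_⟩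
  funext q
  have : (F v).1 q = v.1 q := by rw [hfix]
  have h2 : Φ (fun q => ω q * v.1 q) q / ω q = v.1 q := this
  rw [div_eq_iff (hωne q)] at h2
  rw [h2]; ring

lemma exp_int_bound {e x N k : ℝ} (hN : 0 ≤ N) (hk : 0 < k) {G : ℝ → ℝ}
    (hG : ∀ y ∈ uIcc e x, |G y| ≤ N * Real.exp (-(k * |x - y|))) :
    |∫ y in e..x, G y| ≤ N / k := by
  rcases le_total e x with h | h
  · have h1 : ‖∫ y in e..x, G y‖ ≤ ∫ y in e..x, N * Real.exp (-(k * (x - y))) := by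
      refine intervalIntegral.norm_integral_le_of_norm_le h ?_ ?_
      · refine Eventually.of_forall fun y hy => ?_
        have := hG y (by rw [uIcc_of_le h]; exact Ioc_subset_Icc_self hy)
        rw [abs_of_nonneg (by linarith [hy.2] : 0 ≤ x - y)] at this
        exact this
      · exact Continuous.intervalIntegrable (by fun_prop) _ _
    have h2 : ∫ y in e..x, N * Real.exp (-(k * (x - y))) =
        N / k * Real.exp (-(k * (x - x))) - N / k * Real.exp (-(k * (x - e))) := by
      refine intervalIntegral.integral_eq_sub_of_hasDerivAt
        (f := fun y => N / k * Real.exp (-(k * (x - y)))) (fun y _ => ?_)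
        (Continuous.intervalIntegrable (by fun_prop) _ _)
      have d : HasDerivAt (fun y => -(k * (x - y))) k y := by
        have := (((hasDerivAt_id y).const_sub x).const_mul k).fun_neg
        simpa using this
      refine (d.exp.const_mul (N / k)).congr_deriv ?_
      field_simp
    rw [h2] at h1
    refine h1.trans ?_
    have : 0 ≤ N / k * Real.exp (-(k * (x - e))) := by positivity
    simp only [sub_self, mul_zero, neg_zero, Real.exp_zero, mul_one]
    linarith
  · rw [intervalIntegral.integral_symm, abs_neg]
    have h1 : ‖∫ y in x..e, G y‖ ≤ ∫ y in x..e, N * Real.exp (-(k * (y - x))) := by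
      refine intervalIntegral.norm_integral_le_of_norm_le h ?_ ?_
      · refine Eventually.of_forall fun y hy => ?_
        have := hG y (by rw [uIcc_of_ge h]; exact Ioc_subset_Icc_self hy)
        rw [abs_of_nonpos (by linarith [hy.1] : x - y ≤ 0), neg_sub] at this
        exact this
      · exact Continuous.intervalIntegrable (by fun_prop) _ _
    have h2 : ∫ y in x..e, N * Real.exp (-(k * (y - x))) =
        -(N / k) * Real.exp (-(k * (e - x))) - -(N / k) * Real.exp (-(k * (x - x))) := by
      refine intervalIntegral.integral_eq_sub_of_hasDerivAt
        (f := fun y => -(N / k) * Real.exp (-(k * (y - x)))) (fun y _ => ?_)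
        (Continuous.intervalIntegrable (by fun_prop) _ _)
      have d : HasDerivAt (fun y => -(k * (y - x))) (-k) y := by
        have := (((hasDerivAt_id y).sub_const x).const_mul k).fun_neg
        simpa using this
      refine (d.exp.const_mul (-(N / k))).congr_deriv ?_
      field_simp
    rw [h2] at h1
    refine h1.trans ?_
    have : 0 ≤ N / k * Real.exp (-(k * (e - x))) := by positivity
    simp only [sub_self, mul_zero, neg_zero, Real.exp_zero, mul_one]
    linarith

/-! ### The differentiated integral equation -/

/-- data of the integral equation along characteristics -/
structure SD (n : ℕ) where
  e : Fin n → ℝ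
  o : Fin n → ℝ
  he : ∀ j, e j ∈ Icc (0:ℝ) 1
  ho : ∀ j, o j ∈ Icc (0:ℝ) 1
  heo : ∀ j, |o j - e j| = 1
  p : Fin n → Fin n → ℝ
  T : Fin n → ℝ → ℝ → ℝ → ℝ
  θ : Fin n → ℝ → ℝ → ℝ → ℝ
  hTc : ∀ j, Continuous (fun q : ℝ × ℝ × ℝ => T j q.1 q.2.1 q.2.2)
  hθc : ∀ j, Continuous (fun q : ℝ × ℝ × ℝ => θ j q.1 q.2.1 q.2.2)
  A : ℝ
  hA : 0 < A
  hT : ∀ j, ∀ x ∈ Icc (0:ℝ) 1, ∀ y ∈ uIcc (e j) x, ∀ t, T j y x t ≤ t - |x - y| / A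
  E : ℝ
  hE : ∀ j y x t, |θ j y x t| ≤ E
  β : Fin n → Fin n → ℝ → ℝ → ℝ
  β' : Fin n → Fin n → ℝ → ℝ → ℝ
  hβc : ∀ j k, Continuous (fun q : ℝ × ℝ => β j k q.1 q.2)
  hβ'c : ∀ j k, Continuous (fun q : ℝ × ℝ => β' j k q.1 q.2)
  B : ℝ
  hβ : ∀ j k y t, |β j k y t| ≤ B
  hβ' : ∀ j k y t, |β' j k y t| ≤ B
  r : Fin n → ℝ → ℝ → ℝ
  hrc : ∀ j, Continuous (fun q : ℝ × ℝ => r j q.1 q.2)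
  R : ℝ
  hR : ∀ j y t, |r j y t| ≤ R
  t0 : ℝ
  Z : Set (ℝ × ℝ)
  hZ0 : ∀ x t, t ≤ t0 → (x, t) ∈ Z
  hrZ : ∀ j, ∀ x ∈ Icc (0:ℝ) 1, ∀ t, (x, t) ∈ Z → r j x t = 0
  hZ1 : ∀ j, ∀ x ∈ Icc (0:ℝ) 1, ∀ y ∈ uIcc (e j) x, ∀ t, (x, t) ∈ Z → (y, T j y x t) ∈ Z
  hZ2 : ∀ j k τ, (e j, τ) ∈ Z → (o k, τ) ∈ Z
  hZ3 : ∀ x t t', t' ≤ t → (x, t) ∈ Z → (x, t') ∈ Z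

namespace SD
variable {n : ℕ} (D : SD n)

def W (z : Fin n × ℝ × ℝ → ℝ) (k : Fin n) (y t : ℝ) : ℝ := ∫ τ in D.t0..t, z (k, y, τ)

def integrand (z : Fin n × ℝ × ℝ → ℝ) (j : Fin n) (x t y : ℝ) : ℝ :=
  D.θ j y x t * (D.r j y (D.T j y x t) -
    ∑ k, (D.β' j k y (D.T j y x t) * D.W z k y (D.T j y x t) +
      D.β j k y (D.T j y x t) * z (k, y, D.T j y x t)))

def bdry (z : Fin n × ℝ × ℝ → ℝ) (j : Fin n) (x t : ℝ) : ℝ :=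
  D.θ j (D.e j) x t * ∑ k, D.p j k * z (k, D.o k, D.T j (D.e j) x t)

def Φ (z : Fin n × ℝ × ℝ → ℝ) (q : Fin n × ℝ × ℝ) : ℝ :=
  D.bdry z q.1 (pj q.2.1) q.2.2 +
    ∫ y in (D.e q.1)..(pj q.2.1), D.integrand z q.1 (pj q.2.1) q.2.2 y

def ZX : Set (Fin n × ℝ × ℝ) := {q | (pj q.2.1, q.2.2) ∈ D.Z}

lemma mem_of_uIcc {j : Fin n} {x y : ℝ} (hx : x ∈ Icc (0:ℝ) 1) (hy : y ∈ uIcc (D.e j) x) :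
    y ∈ Icc (0:ℝ) 1 := uIcc_subset_Icc (D.he j) hx hy

lemma W_cont {z : Fin n × ℝ × ℝ → ℝ} (hz : Continuous z) (k : Fin n) :
    Continuous (fun q : ℝ × ℝ => D.W z k q.1 q.2) := by
  refine intervalIntegral.continuous_parametric_intervalIntegral_of_continuous
      (f := fun (q : ℝ × ℝ) τ => z (k, q.1, τ)) ?_ continuous_snd
  exact hz.comp (by fun_prop : Continuous fun r : (ℝ × ℝ) × ℝ =>
    ((k, r.1.1, r.2) : Fin n × ℝ × ℝ))

lemma integrand_cont {z : Fin n × ℝ × ℝ → ℝ} (hz : Continuous z) (j : Fin n) :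
    Continuous (fun q : (ℝ × ℝ) × ℝ => D.integrand z j q.1.1 q.1.2 q.2) := by
  have hT : Continuous (fun q : (ℝ × ℝ) × ℝ => D.T j q.2 q.1.1 q.1.2) :=
    (D.hTc j).comp (by fun_prop : Continuous fun q : (ℝ × ℝ) × ℝ =>
      ((q.2, q.1.1, q.1.2) : ℝ × ℝ × ℝ))
  have hθ : Continuous (fun q : (ℝ × ℝ) × ℝ => D.θ j q.2 q.1.1 q.1.2) :=
    (D.hθc j).comp (by fun_prop : Continuous fun q : (ℝ × ℝ) × ℝ =>
      ((q.2, q.1.1, q.1.2) : ℝ × ℝ × ℝ))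
  have hp : Continuous (fun q : (ℝ × ℝ) × ℝ => (q.2, D.T j q.2 q.1.1 q.1.2)) :=
    continuous_snd.prodMk hT
  refine hθ.mul (((D.hrc j).comp hp).sub (continuous_finsetSum _ fun k _ => ?_))
  exact (((D.hβ'c j k).comp hp).mul ((D.W_cont hz k).comp hp)).add
    (((D.hβc j k).comp hp).mul (hz.comp (continuous_const.prodMk hp)))

lemma bdry_cont {z : Fin n × ℝ × ℝ → ℝ} (hz : Continuous z) (j : Fin n) :
    Continuous (fun q : ℝ × ℝ => D.bdry z j q.1 q.2) := by
  have hT : Continuous (fun q : ℝ × ℝ => D.T j (D.e j) q.1 q.2) :=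
    (D.hTc j).comp (by fun_prop : Continuous fun q : ℝ × ℝ =>
      ((D.e j, q.1, q.2) : ℝ × ℝ × ℝ))
  have hθ : Continuous (fun q : ℝ × ℝ => D.θ j (D.e j) q.1 q.2) :=
    (D.hθc j).comp (by fun_prop : Continuous fun q : ℝ × ℝ =>
      ((D.e j, q.1, q.2) : ℝ × ℝ × ℝ))
  refine hθ.mul (continuous_finsetSum _ fun k _ => continuous_const.mul ?_)
  exact hz.comp (continuous_const.prodMk (continuous_const.prodMk hT))

lemma Φ_cont {z : Fin n × ℝ × ℝ → ℝ} (hz : Continuous z) : Continuous (D.Φ z) := by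
  rw [continuous_prod_of_discrete_left]
  intro j
  have hP : Continuous (fun q : ℝ × ℝ => (pj q.1, q.2)) :=
    (continuous_pj.comp continuous_fst).prodMk continuous_snd
  refine ((D.bdry_cont hz j).comp hP).add ?_
  show Continuous (fun q : ℝ × ℝ => ∫ y in (D.e j)..(pj q.1), D.integrand z j (pj q.1) q.2 y)
  refine intervalIntegral.continuous_parametric_intervalIntegral_of_continuous
      (f := fun (q : ℝ × ℝ) y => D.integrand z j (pj q.1) q.2 y) ?_
      (continuous_pj.comp continuous_fst)
  exact (D.integrand_cont hz j).comp
    ((hP.comp continuous_fst).prodMk continuous_snd)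

lemma W_zero {z : Fin n × ℝ × ℝ → ℝ} (hzZ : ∀ q ∈ D.ZX, z q = 0) (k : Fin n) {x t : ℝ}
    (hx : x ∈ Icc (0:ℝ) 1) (h : (x, t) ∈ D.Z) : D.W z k x t = 0 := by
  have : ∀ τ ∈ uIcc D.t0 t, z (k, x, τ) = 0 := by
    intro τ hτ
    apply hzZ
    show (pj x, τ) ∈ D.Z
    rw [pj_eq hx]
    rcases le_total t D.t0 with h1 | h1
    · rw [uIcc_of_ge h1] at hτ
      exact D.hZ0 _ _ hτ.2
    · rw [uIcc_of_le h1] at hτ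
      exact D.hZ3 _ _ _ hτ.2 h
  rw [W, intervalIntegral.integral_congr (g := fun _ => 0) this]
  simp

lemma Φ_zero {z : Fin n × ℝ × ℝ → ℝ} (hzZ : ∀ q ∈ D.ZX, z q = 0) :
    ∀ q ∈ D.ZX, D.Φ z q = 0 := by
  rintro ⟨j, x, t⟩ hq
  have hx := pj_mem x
  replace hq : (pj x, t) ∈ D.Z := hq
  have hz0 : ∀ k y τ, y ∈ Icc (0:ℝ) 1 → (y, τ) ∈ D.Z → z (k, y, τ) = 0 := by
    intro k y τ hy h
    apply hzZ
    show (pj y, τ) ∈ D.Z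
    rwa [pj_eq hy]
  have h1 : D.bdry z j (pj x) t = 0 := by
    have := D.hZ1 j _ hx (D.e j) left_mem_uIcc t hq
    rw [bdry]
    refine mul_eq_zero_of_right _ (Finset.sum_eq_zero fun k _ => ?_)
    rw [hz0 k _ _ (D.ho k) (D.hZ2 j k _ this), mul_zero]
  have h2 : ∀ y ∈ uIcc (D.e j) (pj x), D.integrand z j (pj x) t y = 0 := by
    intro y hy
    have hyI := D.mem_of_uIcc hx hy
    have := D.hZ1 j _ hx y hy t hq
    rw [integrand, D.hrZ j y hyI _ this]
    refine mul_eq_zero_of_right _ ?_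
    rw [zero_sub, neg_eq_zero]
    refine Finset.sum_eq_zero fun k _ => ?_
    rw [D.W_zero hzZ k hyI this, hz0 k _ _ hyI this]; simp
  show D.bdry z j (pj x) t + ∫ y in (D.e j)..(pj x), D.integrand z j (pj x) t y = 0
  rw [h1, intervalIntegral.integral_congr (g := fun _ => 0) h2]
  simp

lemma W_bound {z₁ z₂ : Fin n × ℝ × ℝ → ℝ} (hz1 : Continuous z₁) (hz2 : Continuous z₂)
    (h1 : ∀ q ∈ D.ZX, z₁ q = 0) (h2 : ∀ q ∈ D.ZX, z₂ q = 0) {M lam : ℝ} (hM : 0 ≤ M)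
    (hlam : 1 ≤ lam) {k : Fin n} {y : ℝ} (hy : y ∈ Icc (0:ℝ) 1)
    (h : ∀ τ, |z₁ (k, y, τ) - z₂ (k, y, τ)| ≤ M * Real.exp (lam * τ)) (t : ℝ) :
    |D.W z₁ k y t - D.W z₂ k y t| ≤ M * Real.exp (lam * t) := by
  rcases le_total t D.t0 with ht | ht
  · rw [D.W_zero h1 k hy (D.hZ0 _ _ ht), D.W_zero h2 k hy (D.hZ0 _ _ ht), sub_self, abs_zero]
    positivity
  · have c1 : Continuous (fun τ => z₁ (k, y, τ)) := hz1.comp (by fun_prop)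
    have c2 : Continuous (fun τ => z₂ (k, y, τ)) := hz2.comp (by fun_prop)
    rw [W, W, ← intervalIntegral.integral_sub (c1.intervalIntegrable _ _)
      (c2.intervalIntegrable _ _), intervalIntegral.integral_symm, abs_neg]
    have e1 : ‖∫ τ in D.t0..t, (z₁ (k, y, τ) - z₂ (k, y, τ))‖ ≤
        ∫ τ in D.t0..t, (M * Real.exp (lam * t)) * Real.exp (-(lam * (t - τ))) := by
      refine intervalIntegral.norm_integral_le_of_norm_le ht ?_
        (Continuous.intervalIntegrable (by fun_prop) _ _)
      refine Eventually.of_forall fun τ _ => ?_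
      rw [mul_assoc, ← Real.exp_add]
      refine (h τ).trans (le_of_eq ?_)
      congr 2; ring
    have e2 : |∫ τ in D.t0..t, (M * Real.exp (lam * t)) * Real.exp (-(lam * (t - τ)))| ≤
        (M * Real.exp (lam * t)) / lam := by
      refine exp_int_bound (by positivity) (by linarith) ?_
      intro τ hτ
      rw [uIcc_of_le ht] at hτ
      rw [abs_of_nonneg (by positivity), abs_of_nonneg (by linarith [hτ.2] : 0 ≤ t - τ)]
    rw [intervalIntegral.integral_symm, abs_neg]
    refine e1.trans ((le_abs_self _).trans (e2.trans ?_))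
    exact div_le_self (by positivity) hlam

theorem solve_z : ∃ z, Continuous z ∧ (∀ q ∈ D.ZX, z q = 0) ∧ D.Φ z = z := by
  -- constants
  set E := max D.E 0 with hEdef
  have hE0 : 0 ≤ E := le_max_right _ _
  have hE : ∀ j y x t, |D.θ j y x t| ≤ E := fun j y x t => (D.hE j y x t).trans (le_max_left _ _)
  set B := max D.B 0 with hBdef
  have hB0 : 0 ≤ B := le_max_right _ _
  have hβ : ∀ j k y t, |D.β j k y t| ≤ B := fun j k y t =>
    (D.hβ j k y t).trans (le_max_left _ _)
  have hβ' : ∀ j k y t, |D.β' j k y t| ≤ B := fun j k y t =>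
    (D.hβ' j k y t).trans (le_max_left _ _)
  set R := max D.R 0 with hRdef
  have hR0 : 0 ≤ R := le_max_right _ _
  have hR : ∀ j y t, |D.r j y t| ≤ R := fun j y t => (D.hR j y t).trans (le_max_left _ _)
  set P := ∑ j, ∑ k, |D.p j k| with hP
  have hPj : ∀ j, ∑ k, |D.p j k| ≤ P := fun j =>
    Finset.single_le_sum (f := fun j => ∑ k, |D.p j k|)
      (fun i _ => Finset.sum_nonneg fun k _ => abs_nonneg _) (Finset.mem_univ j)
  have hP0 : 0 ≤ P := Finset.sum_nonneg fun j _ => Finset.sum_nonneg fun k _ => abs_nonneg _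
  obtain ⟨mu, hmu0, hmu⟩ : ∃ mu : ℝ, 0 ≤ mu ∧ E * P * Real.exp (-mu) ≤ 1/4 := by
    refine ⟨4 * (E * P), by positivity, ?_⟩
    have h1 : 4 * (E * P) ≤ Real.exp (4 * (E * P)) := by
      linarith [Real.add_one_le_exp (4 * (E * P))]
    rw [Real.exp_neg, ← div_eq_mul_inv, div_le_iff₀ (Real.exp_pos _)]
    linarith
  obtain ⟨K, hKmu, hK1, hK⟩ : ∃ K : ℝ, mu ≤ K ∧ 1 ≤ D.A * K ∧
      0 < K ∧ (E * (n * (2 * B))) / K ≤ Real.exp (-mu) / 4 := by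
    refine ⟨mu + 1 / D.A + 1 + 4 * Real.exp mu * (E * (n * (2 * B))), ?_, ?_, ?_, ?_⟩
    · have := D.hA
      have : 0 ≤ 1 / D.A + 1 + 4 * Real.exp mu * (E * (n * (2 * B))) := by positivity
      linarith
    · have hA := D.hA
      have h1 : D.A * (1 / D.A) = 1 := by field_simp
      have h2 : 0 ≤ D.A * (mu + 1 + 4 * Real.exp mu * (E * (n * (2 * B)))) := by positivity
      nlinarith
    · have := D.hA
      positivity
    · have := D.hA
      rw [div_le_iff₀ (by positivity), Real.exp_neg]
      have h3 : (Real.exp mu)⁻¹ / 4 * (4 * Real.exp mu * (E * (n * (2 * B)))) =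
        E * (n * (2 * B)) := by field_simp
      have h4 : 0 ≤ (Real.exp mu)⁻¹ / 4 * (mu + 1 / D.A + 1) := by positivity
      linarith [mul_add ((Real.exp mu)⁻¹ / 4) (mu + 1 / D.A + 1)
        (4 * Real.exp mu * (E * (n * (2 * B))))]
  obtain ⟨hK0, hK⟩ := hK
  set lam := D.A * K with hlam
  have hTl : ∀ j, ∀ x ∈ Icc (0:ℝ) 1, ∀ y ∈ uIcc (D.e j) x, ∀ t,
      lam * D.T j y x t ≤ lam * t - K * |x - y| := by
    intro j x hx y hy t
    have h1 := mul_le_mul_of_nonneg_left (D.hT j x hx y hy t) (by linarith : 0 ≤ lam)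
    have h2 : lam * (t - |x - y| / D.A) = lam * t - K * |x - y| := by
      have := D.hA.ne'
      rw [hlam]; field_simp
    linarith
  have hxe1 : ∀ j, ∀ x ∈ Icc (0:ℝ) 1, |x - D.e j| ≤ 1 := by
    intro j x hx
    have := D.he j
    rw [abs_le]; constructor <;> linarith [this.1, this.2, hx.1, hx.2]
  refine weighted_fixed_point
    (fun q : Fin n × ℝ × ℝ => Real.exp (lam * q.2.2 - mu * |pj q.2.1 - D.e q.1|)) ?_
    (fun q => Real.exp_pos _) D.ZX D.Φ (E * (R * Real.exp (-(lam * D.t0))) * Real.exp mu)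
    ?_ (fun z hz hzZ => ⟨D.Φ_cont hz, D.Φ_zero hzZ⟩) ?_
  · rw [continuous_prod_of_discrete_left]
    intro j
    fun_prop
  · rintro ⟨j, x, t⟩
    have hx := pj_mem x
    show |D.bdry (fun _ => 0) j (pj x) t + ∫ y in (D.e j)..(pj x),
      D.integrand (fun _ => 0) j (pj x) t y| ≤ _
    have h1 : D.bdry (fun _ => 0) j (pj x) t = 0 := by simp [bdry]
    rw [h1, zero_add]
    have h2 : ∀ y ∈ uIoc (D.e j) (pj x), ‖D.integrand (fun _ => 0) j (pj x) t y‖ ≤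
        E * (R * Real.exp (-(lam * D.t0))) * Real.exp (lam * t) := by
      intro y hy
      replace hy := uIoc_subset_uIcc hy
      have hyI := D.mem_of_uIcc hx hy
      have e1 : D.integrand (fun _ => 0) j (pj x) t y =
          D.θ j y (pj x) t * D.r j y (D.T j y (pj x) t) := by
        simp [integrand, W]
      rw [e1, Real.norm_eq_abs, abs_mul, mul_assoc]
      refine mul_le_mul (hE _ _ _ _) ?_ (abs_nonneg _) hE0
      rcases le_total (D.T j y (pj x) t) D.t0 with h3 | h3
      · rw [D.hrZ j y hyI _ (D.hZ0 _ _ h3), abs_zero]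
        positivity
      · refine (hR _ _ _).trans ?_
        rw [mul_assoc, ← Real.exp_add]
        refine le_mul_of_one_le_right hR0 (Real.one_le_exp ?_)
        have h4 := D.hT j _ hx y hy t
        have h5 : 0 ≤ |pj x - y| / D.A := div_nonneg (abs_nonneg _) D.hA.le
        nlinarith
    have h3 := intervalIntegral.norm_integral_le_of_norm_le_const h2
    rw [Real.norm_eq_abs] at h3
    refine h3.trans ?_
    have h4 := hxe1 j _ hx
    have h5 : Real.exp (lam * t) ≤ Real.exp mu * Real.exp (lam * t - mu * |pj x - D.e j|) := by
      rw [← Real.exp_add]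
      refine Real.exp_le_exp.2 ?_
      nlinarith
    have h6 : 0 ≤ E * (R * Real.exp (-(lam * D.t0))) := by positivity
    calc _ ≤ E * (R * Real.exp (-(lam * D.t0))) * Real.exp (lam * t) * 1 :=
          mul_le_mul_of_nonneg_left h4 (by positivity)
      _ ≤ _ := by
          rw [mul_one, mul_assoc (E * (R * Real.exp (-(lam * D.t0))))]
          exact mul_le_mul_of_nonneg_left h5 h6
  · intro z₁ z₂ M hz1 hz2 h1 h2 hM hd
    rintro ⟨j, x, t⟩
    have hx := pj_mem x
    set X := pj x with hX
    show |(D.bdry z₁ j X t + ∫ y in (D.e j)..X, D.integrand z₁ j X t y) -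
      (D.bdry z₂ j X t + ∫ y in (D.e j)..X, D.integrand z₂ j X t y)| ≤
      M / 2 * Real.exp (lam * t - mu * |pj x - D.e j|)
    rw [← hX]
    have hzd : ∀ k, ∀ y ∈ Icc (0:ℝ) 1, ∀ τ, |z₁ (k, y, τ) - z₂ (k, y, τ)| ≤
        M * Real.exp (lam * τ - mu * |y - D.e k|) := by
      intro k y hy τ
      have := hd (k, y, τ)
      simp only [pj_eq hy] at this
      exact this
    have hzd' : ∀ k, ∀ y ∈ Icc (0:ℝ) 1, ∀ τ, |z₁ (k, y, τ) - z₂ (k, y, τ)| ≤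
        M * Real.exp (lam * τ) := by
      intro k y hy τ
      refine (hzd k y hy τ).trans (mul_le_mul_of_nonneg_left (Real.exp_le_exp.2 ?_) hM)
      have : 0 ≤ mu * |y - D.e k| := by positivity
      linarith
    have hb : |D.bdry z₁ j X t - D.bdry z₂ j X t| ≤
        M / 4 * Real.exp (lam * t - mu * |X - D.e j|) := by
      have e1 : D.bdry z₁ j X t - D.bdry z₂ j X t = D.θ j (D.e j) X t *
          ∑ k, D.p j k * (z₁ (k, D.o k, D.T j (D.e j) X t) - z₂ (k, D.o k, D.T j (D.e j) X t)) := by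
        simp only [bdry, mul_sub, Finset.sum_sub_distrib]
      have e2 : |∑ k, D.p j k * (z₁ (k, D.o k, D.T j (D.e j) X t) -
          z₂ (k, D.o k, D.T j (D.e j) X t))| ≤
          P * (M * (Real.exp (-mu) * Real.exp (lam * t - mu * |X - D.e j|))) := by
        refine (Finset.abs_sum_le_sum_abs _ _).trans ?_
        refine le_trans (Finset.sum_le_sum (g := fun k => |D.p j k| *
          (M * (Real.exp (-mu) * Real.exp (lam * t - mu * |X - D.e j|)))) fun k _ => ?_) ?_
        · rw [abs_mul]
          refine mul_le_mul_of_nonneg_left ?_ (abs_nonneg _)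
          refine (hzd k _ (D.ho k) _).trans (mul_le_mul_of_nonneg_left ?_ hM)
          rw [← Real.exp_add]
          refine Real.exp_le_exp.2 ?_
          rw [D.heo k]
          have := hTl j X hx (D.e j) left_mem_uIcc t
          have h3 : mu * |X - D.e j| ≤ K * |X - D.e j| :=
            mul_le_mul_of_nonneg_right hKmu (abs_nonneg _)
          linarith
        · rw [← Finset.sum_mul]
          exact mul_le_mul_of_nonneg_right (hPj j) (by positivity)
      rw [e1, abs_mul]
      refine (mul_le_mul (hE _ _ _ _) e2 (abs_nonneg _) hE0).trans ?_
      have : E * (P * (M * (Real.exp (-mu) * Real.exp (lam * t - mu * |X - D.e j|)))) =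
        (E * P * Real.exp (-mu)) * (M * Real.exp (lam * t - mu * |X - D.e j|)) := by ring
      rw [this]
      refine (mul_le_mul_of_nonneg_right hmu (by positivity)).trans (le_of_eq (by ring))
    have hi : |(∫ y in (D.e j)..X, D.integrand z₁ j X t y) -
        ∫ y in (D.e j)..X, D.integrand z₂ j X t y| ≤
        M / 4 * Real.exp (lam * t - mu * |X - D.e j|) := by
      have ci : ∀ z, Continuous z → Continuous (fun y => D.integrand z j X t y) := fun z hz =>
        (D.integrand_cont hz j).comp (by fun_prop : Continuous fun y : ℝ =>
          (((X, t), y) : (ℝ × ℝ) × ℝ))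
      rw [← intervalIntegral.integral_sub ((ci z₁ hz1).intervalIntegrable _ _)
        ((ci z₂ hz2).intervalIntegrable _ _)]
      refine (exp_int_bound (N := E * (n * (2 * B)) * (M * Real.exp (lam * t))) (k := K)
        (by positivity) hK0 ?_).trans ?_
      · intro y hy
        have hyI := D.mem_of_uIcc hx hy
        set τ := D.T j y X t with hτ
        have e1 : D.integrand z₁ j X t y - D.integrand z₂ j X t y = D.θ j y X t *
            -∑ k, (D.β' j k y τ * (D.W z₁ k y τ - D.W z₂ k y τ) +
              D.β j k y τ * (z₁ (k, y, τ) - z₂ (k, y, τ))) := by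
          simp only [integrand, ← hτ, mul_sub, Finset.sum_add_distrib, Finset.sum_sub_distrib]
          ring
        have e2 : ∀ k ∈ Finset.univ, |D.β' j k y τ * (D.W z₁ k y τ - D.W z₂ k y τ) +
              D.β j k y τ * (z₁ (k, y, τ) - z₂ (k, y, τ))| ≤
              2 * B * (M * Real.exp (lam * τ)) := by
          intro k _
          refine (abs_add_le _ _).trans ?_
          rw [abs_mul, abs_mul]
          have a1 := mul_le_mul (hβ' j k y τ)
            (D.W_bound hz1 hz2 h1 h2 hM hK1 hyI (hzd' k y hyI) τ) (abs_nonneg _) hB0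
          have a2 := mul_le_mul (hβ j k y τ) (hzd' k y hyI τ) (abs_nonneg _) hB0
          linarith
        have e3 := (Finset.abs_sum_le_sum_abs _ _).trans (Finset.sum_le_sum e2)
        rw [Finset.sum_const, Finset.card_univ, Fintype.card_fin, nsmul_eq_mul] at e3
        rw [e1, abs_mul, abs_neg]
        refine (mul_le_mul (hE _ _ _ _) e3 (abs_nonneg _) hE0).trans ?_
        have e4 : Real.exp (lam * τ) ≤ Real.exp (lam * t) * Real.exp (-(K * |X - y|)) := by
          rw [← Real.exp_add]
          refine Real.exp_le_exp.2 ?_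
          have := hTl j X hx y hy t
          linarith
        have e5 := mul_le_mul_of_nonneg_left e4 (by positivity : 0 ≤ E * (n * (2 * B)) * M)
        linarith
      · have e6 : E * (n * (2 * B)) * (M * Real.exp (lam * t)) / K =
          E * (n * (2 * B)) / K * (M * Real.exp (lam * t)) := by ring
        rw [e6]
        refine (mul_le_mul_of_nonneg_right hK (by positivity)).trans ?_
        have e7 : Real.exp (-mu) * Real.exp (lam * t) ≤
            Real.exp (lam * t - mu * |X - D.e j|) := by
          rw [← Real.exp_add]
          refine Real.exp_le_exp.2 ?_
          have := mul_le_mul_of_nonneg_left (hxe1 j X hx) hmu0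
          linarith
        have := mul_le_mul_of_nonneg_left e7 (by positivity : 0 ≤ M / 4)
        linarith
    have e8 : (D.bdry z₁ j X t + ∫ y in (D.e j)..X, D.integrand z₁ j X t y) -
      (D.bdry z₂ j X t + ∫ y in (D.e j)..X, D.integrand z₂ j X t y) =
      (D.bdry z₁ j X t - D.bdry z₂ j X t) + ((∫ y in (D.e j)..X, D.integrand z₁ j X t y) -
        ∫ y in (D.e j)..X, D.integrand z₂ j X t y) := by ring
    rw [e8]
    refine (abs_add_le _ _).trans ((add_le_add hb hi).trans (le_of_eq (by ring)))

end SD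

lemma hasDerivWithinAt_mul_vanish {f h : ℝ → ℝ} {f' x : ℝ} {s : Set ℝ}
    (hf : HasDerivWithinAt f f' s x) (hf0 : f x = 0) (hh : ContinuousWithinAt h s x) :
    HasDerivWithinAt (fun y => f y * h y) (f' * h x) s x := by
  rw [hasDerivWithinAt_iff_tendsto_slope] at hf ⊢
  have h1 : Tendsto h (nhdsWithin x (s \ {x})) (nhds (h x)) :=
    hh.mono_left (nhdsWithin_mono _ sdiff_subset)
  refine (hf.mul h1).congr fun y => ?_
  simp only [slope_def_field, hf0, zero_mul, sub_zero]
  ring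

lemma eq_of_deriv_eq {f g h : ℝ → ℝ} {t0 : ℝ} (hf : ∀ t, HasDerivAt f (h t) t)
    (hg : ∀ t, HasDerivAt g (h t) t) (h0 : f t0 = g t0) (t : ℝ) : f t = g t := by
  have hd : ∀ t, HasDerivAt (fun t => f t - g t) 0 t := fun t => by
    simpa using (hf t).fun_sub (hg t)
  have := is_const_of_deriv_eq_zero (f := fun t => f t - g t)
    (fun t => (hd t).differentiableAt) (fun t => (hd t).deriv) t t0
  simp only [h0, sub_self] at this
  linarith

namespace SD
variable {n : ℕ} (D : SD n)

theorem solve_w (c : Fin n → ℝ → ℝ → ℝ) (hcc : ∀ j, Continuous (fun q : ℝ × ℝ => c j q.1 q.2))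
    (hT0 : ∀ j, ∀ x ∈ Icc (0:ℝ) 1, ∀ t, D.T j x x t = t)
    (hchar : ∀ j, ∀ x ∈ Icc (0:ℝ) 1, ∀ t, IsChar (c j) (fun y => D.T j y x t))
    (hflow : ∀ j, ∀ x ∈ Icc (0:ℝ) 1, ∀ y ∈ Icc (0:ℝ) 1, ∀ z ∈ Icc (0:ℝ) 1, ∀ t,
      D.T j y z (D.T j z x t) = D.T j y x t)
    (hTd : ∀ j, ∀ x ∈ Icc (0:ℝ) 1, ∀ y ∈ Icc (0:ℝ) 1, ∀ t,
      HasDerivAt (D.T j y x) (D.θ j y x t) t)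
    (q : Fin n → ℝ → ℝ → ℝ) (hqc : ∀ j, Continuous (fun r : ℝ × ℝ => q j r.1 r.2))
    (hqd : ∀ j y t, HasDerivAt (q j y) (D.r j y t) t)
    (hq0 : ∀ j y t, t ≤ D.t0 → q j y t = 0)
    (hβd : ∀ j k y t, HasDerivAt (D.β j k y) (D.β' j k y t) t) :
    ∃ w wx wt : Fin n → ℝ → ℝ → ℝ,
      (∀ j, Continuous (fun r : ℝ × ℝ => w j r.1 r.2)) ∧
      (∀ j, Continuous (fun r : ℝ × ℝ => wx j r.1 r.2)) ∧
      (∀ j, Continuous (fun r : ℝ × ℝ => wt j r.1 r.2)) ∧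
      (∀ j, ∀ x ∈ Icc (0:ℝ) 1, ∀ t,
        HasDerivWithinAt (fun y => w j y t) (wx j x t) (Icc 0 1) x ∧
        HasDerivAt (fun τ => w j x τ) (wt j x t) t) ∧
      (∀ j, ∀ x ∈ Icc (0:ℝ) 1, ∀ t,
        wx j x t = q j x t - ∑ k, D.β j k x t * w k x t - c j x t * wt j x t) ∧
      (∀ j t, w j (D.e j) t = ∑ k, D.p j k * w k (D.o k) t) ∧
      (∀ j, ∀ x ∈ Icc (0:ℝ) 1, ∀ t, (x, t) ∈ D.Z → w j x t = 0) := by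
  obtain ⟨z, hz, hzZ, hzfix⟩ := D.solve_z
  have hwc := D.W_cont hz
  have hzc : ∀ j, Continuous (fun r : ℝ × ℝ => z (j, r.1, r.2)) := fun j =>
    hz.comp (by fun_prop)
  have hwd : ∀ k y t, HasDerivAt (fun τ => D.W z k y τ) (z (k, y, t)) t := by
    intro k y t
    have : Continuous (fun τ => z (k, y, τ)) := hz.comp (by fun_prop)
    exact (this.integral_hasStrictDerivAt D.t0 t).hasDerivAt
  have hw0 : ∀ k, ∀ x ∈ Icc (0:ℝ) 1, ∀ t, (x, t) ∈ D.Z → D.W z k x t = 0 :=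
    fun k x hx t h => D.W_zero hzZ k hx h
  -- the right hand side
  set g : Fin n → ℝ → ℝ → ℝ := fun j y t => q j y t - ∑ k, D.β j k y t * D.W z k y t with hg
  have hgc : ∀ j, Continuous (fun r : ℝ × ℝ => g j r.1 r.2) := fun j =>
    (hqc j).sub (continuous_finsetSum _ fun k _ => (D.hβc j k).mul (hwc k))
  have hgd : ∀ j y t, HasDerivAt (g j y) (D.r j y t -
      ∑ k, (D.β' j k y t * D.W z k y t + D.β j k y t * z (k, y, t))) t := by
    intro j y t
    refine (hqd j y t).fun_sub (HasDerivAt.fun_sum fun k _ => ?_)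
    exact (hβd j k y t).fun_mul (hwd k y t)
  have hTle : ∀ j, ∀ x ∈ Icc (0:ℝ) 1, ∀ y ∈ uIcc (D.e j) x, D.T j y x D.t0 ≤ D.t0 := by
    intro j x hx y hy
    have h1 := D.hT j x hx y hy D.t0
    have h2 : 0 ≤ |x - y| / D.A := div_nonneg (abs_nonneg _) D.hA.le
    linarith
  have hIntv : ∀ j, ∀ x ∈ Icc (0:ℝ) 1, ∀ t, D.W z j x t =
      (∑ k, D.p j k * D.W z k (D.o k) (D.T j (D.e j) x t)) +
        ∫ y in (D.e j)..x, g j y (D.T j y x t) := by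
    intro j x hx
    refine eq_of_deriv_eq (t0 := D.t0) (h := fun t => z (j, x, t)) (hwd j x) ?_ ?_
    · intro t
      have hval : z (j, x, t) = (∑ k, D.p j k * (z (k, D.o k, D.T j (D.e j) x t) *
          D.θ j (D.e j) x t)) + ∫ y in (D.e j)..x, D.integrand z j x t y := by
        have := congrFun hzfix (j, x, t)
        rw [← this]
        show D.bdry z j (pj x) t + ∫ y in (D.e j)..(pj x), D.integrand z j (pj x) t y = _
        rw [pj_eq hx, bdry, Finset.mul_sum]
        congr 1
        exact Finset.sum_congr rfl fun k _ => by ring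
      rw [hval]
      refine HasDerivAt.fun_add (HasDerivAt.fun_sum fun k _ => ?_) ?_
      · refine HasDerivAt.const_mul _ ?_
        exact (hwd k (D.o k) _).comp t (hTd j x hx _ (D.he j) t)
      · refine hasDerivAt_param (fun y t => g j y (D.T j y x t))
          (fun y t => D.integrand z j x t y) _ _ t 1 one_pos ?_ ?_ ?_
        · have h1 : Continuous (fun r : ℝ × ℝ => D.T j r.1 x r.2) :=
            (D.hTc j).comp (by fun_prop : Continuous fun r : ℝ × ℝ =>
              ((r.1, x, r.2) : ℝ × ℝ × ℝ))
          exact ((hgc j).comp (continuous_fst.prodMk h1)).continuousOn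
        · exact ((D.integrand_cont hz j).comp (by fun_prop : Continuous fun r : ℝ × ℝ =>
            (((x, r.2), r.1) : (ℝ × ℝ) × ℝ))).continuousOn
        · intro y hy τ _
          have hyI := D.mem_of_uIcc hx hy
          refine ((hgd j y _).comp τ (hTd j x hx y hyI τ)).congr_deriv ?_
          rw [integrand]; ring
    · have h1 : D.W z j x D.t0 = 0 := by simp [W]
      have h2 : ∀ y ∈ uIcc (D.e j) x, g j y (D.T j y x D.t0) = 0 := by
        intro y hy
        have hyI := D.mem_of_uIcc hx hy
        have h3 := hTle j x hx y hy
        simp only [hg]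
        rw [hq0 j y _ h3, zero_sub, neg_eq_zero]
        refine Finset.sum_eq_zero fun k _ => ?_
        rw [hw0 k y hyI _ (D.hZ0 _ _ h3), mul_zero]
      rw [h1, intervalIntegral.integral_congr (g := fun _ => 0) h2]
      have h4 : ∑ k, D.p j k * D.W z k (D.o k) (D.T j (D.e j) x D.t0) = 0 := by
        refine Finset.sum_eq_zero fun k _ => ?_
        rw [hw0 k _ (D.ho k) _ (D.hZ0 _ _ (hTle j x hx _ left_mem_uIcc)), mul_zero]
      rw [h4]; simp
  refine ⟨D.W z, fun j x t => g j x t - c j x t * z (j, x, t), fun j x t => z (j, x, t),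
    hwc, fun j => (hgc j).sub ((hcc j).mul (hzc j)), hzc, ?_, fun j x hx t => rfl, ?_, hw0⟩
  · intro j x hx t
    refine ⟨?_, hwd j x t⟩
    set γ : ℝ → ℝ := fun y => D.T j y x t with hγ
    have hγc : Continuous γ := (D.hTc j).comp (by fun_prop : Continuous fun y : ℝ =>
      ((y, x, t) : ℝ × ℝ × ℝ))
    have hγx : γ x = t := hT0 j x hx t
    have d1 : HasDerivWithinAt (fun y => D.W z j y (γ y)) (g j x t) (Icc 0 1) x := by
      have e1 : ∀ y ∈ Icc (0:ℝ) 1, D.W z j y (γ y) =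
          (∑ k, D.p j k * D.W z k (D.o k) (D.T j (D.e j) x t)) +
            ∫ y' in (D.e j)..y, g j y' (γ y') := by
        intro y hy
        rw [hIntv j y hy (γ y)]
        congr 1
        · refine Finset.sum_congr rfl fun k _ => ?_
          rw [hγ]
          simp only []
          rw [hflow j x hx _ (D.he j) y hy t]
        · refine intervalIntegral.integral_congr fun y' hy' => ?_
          have hy'I := D.mem_of_uIcc hy hy'
          simp only [hγ]
          rw [hflow j x hx y' hy'I y hy t]
      have e2 : Continuous (fun y => g j y (γ y)) := (hgc j).comp (continuous_id.prodMk hγc)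
      have e3 := ((e2.integral_hasStrictDerivAt (D.e j) x).hasDerivAt.const_add
        (∑ k, D.p j k * D.W z k (D.o k) (D.T j (D.e j) x t))).hasDerivWithinAt (s := Icc (0:ℝ) 1)
      rw [hγx] at e3
      exact e3.congr_of_mem e1 hx
    have d2 : HasDerivWithinAt (fun y => (γ y - t) * ∫ σ in (0:ℝ)..1,
        z (j, y, t + σ * (γ y - t))) (c j x t * z (j, x, t)) (Icc 0 1) x := by
      have f1 : HasDerivWithinAt (fun y => γ y - t) (c j x t) (Icc 0 1) x := by
        have := (hchar j x hx t x hx).sub_const t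
        have e4 : D.T j x x t = t := hγx
        simpa only [e4] using this
      have f2 : Continuous (fun y => ∫ σ in (0:ℝ)..1, z (j, y, t + σ * (γ y - t))) := by
        refine intervalIntegral.continuous_parametric_intervalIntegral_of_continuous'
          (f := fun y σ => z (j, y, t + σ * (γ y - t))) ?_ 0 1
        exact hz.comp (by fun_prop : Continuous fun r : ℝ × ℝ =>
          ((j, r.1, t + r.2 * (γ r.1 - t)) : Fin n × ℝ × ℝ))
      have := hasDerivWithinAt_mul_vanish f1 (by rw [hγx, sub_self])
        (f2.continuousWithinAt (s := Icc 0 1) (x := x))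
      simpa [hγx] using this
    have hdiff : ∀ y, (γ y - t) * ∫ σ in (0:ℝ)..1, z (j, y, t + σ * (γ y - t)) =
        D.W z j y (γ y) - D.W z j y t := by
      intro y
      have hcy : Continuous (fun τ => z (j, y, τ)) := hz.comp (by fun_prop)
      have h1 := intervalIntegral.integral_eq_sub_of_hasDerivAt (a := 0) (b := 1)
        (f := fun σ => D.W z j y (t + σ * (γ y - t)))
        (f' := fun σ => (γ y - t) * z (j, y, t + σ * (γ y - t))) (fun σ _ => by
          have e5 : HasDerivAt (fun σ : ℝ => t + σ * (γ y - t)) (γ y - t) σ := by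
            simpa using ((hasDerivAt_id σ).mul_const (γ y - t)).const_add t
          refine ((hwd j y _).comp σ e5).congr_deriv ?_
          ring) (Continuous.intervalIntegrable
            (continuous_const.mul (hcy.comp (by fun_prop))) _ _)
      rw [← intervalIntegral.integral_const_mul, h1]
      simp
    refine (d1.sub d2).congr_of_mem (fun y _ => ?_) hx
    simp only [Pi.sub_apply]
    rw [hdiff y]; ring
  · intro j t
    have := hIntv j (D.e j) (D.he j) t
    rw [hT0 j _ (D.he j), intervalIntegral.integral_same, add_zero] at this
    exact this

end SD

lemma char_mono {c : ℝ → ℝ → ℝ} {γ : ℝ → ℝ} (h : IsChar c γ) {k : ℝ}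
    (hk : ∀ y ∈ Icc (0:ℝ) 1, ∀ t, k ≤ c y t) {x y : ℝ} (hy : y ∈ Icc (0:ℝ) 1)
    (hx : x ∈ Icc (0:ℝ) 1) (hyx : y ≤ x) : k * (x - y) ≤ γ x - γ y := by
  refine (convex_Icc (0:ℝ) 1).mul_sub_le_image_sub_of_le_deriv h.continuousOn ?_ ?_ y hy x hx hyx
  · intro z hz
    rw [interior_Icc] at hz
    exact (h.hasDerivAt hz).differentiableAt.differentiableWithinAt
  · intro z hz
    rw [interior_Icc] at hz
    rw [(h.hasDerivAt hz).deriv]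
    exact hk z (Ioo_subset_Icc_self hz) _

lemma char_mono' {c : ℝ → ℝ → ℝ} {γ : ℝ → ℝ} (h : IsChar c γ) {k : ℝ}
    (hk : ∀ y ∈ Icc (0:ℝ) 1, ∀ t, c y t ≤ k) {x y : ℝ} (hy : y ∈ Icc (0:ℝ) 1)
    (hx : x ∈ Icc (0:ℝ) 1) (hyx : y ≤ x) : γ x - γ y ≤ k * (x - y) := by
  refine (convex_Icc (0:ℝ) 1).image_sub_le_mul_sub_of_deriv_le h.continuousOn ?_ ?_ y hy x hx hyx
  · intro z hz
    rw [interior_Icc] at hz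
    exact (h.hasDerivAt hz).differentiableAt.differentiableWithinAt
  · intro z hz
    rw [interior_Icc] at hz
    rw [(h.hasDerivAt hz).deriv]
    exact hk z (Ioo_subset_Icc_self hz) _

set_option maxHeartbeats 2000000 in
theorem strip_solve (n m : ℕ) (hn : 1 ≤ n)
    (p : Fin n → Fin n → ℝ)
    (a : ℝ → ℝ → Fin n → ℝ) (b : ℝ → ℝ → Fin n → Fin n → ℝ)
    (hab : ∃ C : ℝ, ∀ j : Fin n, BCle 1 (fun x t => a x t j) C ∧
      ∀ k : Fin n, BCle 1 (fun x t => b x t j k) C)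
    (Λ₀ : ℝ) (hΛ₀ : 0 < Λ₀) (hLam : LamCond n m Λ₀ a) :
    ∃ A : ℝ, 0 < A ∧ ∀ (t0 ε R : ℝ) (f ft : ℝ → ℝ → Fin n → ℝ), 0 < ε →
      (∀ j, Continuous (fun q : ℝ × ℝ => f q.1 q.2 j)) →
      (∀ j, Continuous (fun q : ℝ × ℝ => ft q.1 q.2 j)) →
      (∀ x t j, HasDerivAt (fun τ => f x τ j) (ft x t j) t) →
      (∀ x t j, |f x t j| ≤ R) → (∀ x t j, |ft x t j| ≤ R) →
      (∀ x ∈ Icc (0:ℝ) 1, ∀ t, (t ≤ t0 ∨ min x (1 - x) + A * (t - t0) < ε) →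
        ∀ j, f x t j = 0 ∧ ft x t j = 0) →
      ∃ w wx wt : ℝ → ℝ → Vn n,
        (∀ s, IsLinSol n m p a b f s (fun x => w x s) w wx wt) ∧
        (∀ x ∈ Icc (0:ℝ) 1, ∀ t, (t ≤ t0 ∨ min x (1 - x) + A * (t - t0) < ε) →
          w x t = 0) := by
  classical
  obtain ⟨C, hC⟩ := hab
  choose ax at' hac _ hatc hab1 using fun j => bc1_extract (hC j).1
  choose bx bt hbc _ hbtc hb1 using fun j k => bc1_extract ((hC j).2 k)
  have hC0 : 0 ≤ C := (abs_nonneg _).trans (hab1 ⟨0, hn⟩ 0 (by simp) 0).1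
  set A := max C 1 with hA
  have hA0 : 0 < A := lt_max_of_lt_right one_pos
  refine ⟨A, hA0, ?_⟩
  intro t0 ε R f ft hε hfc hftc hfd hfR hftR hfZ
  have hR0 : 0 ≤ R := (abs_nonneg _).trans (hfR 0 0 ⟨0, hn⟩)
  -- a is bounded below
  have haΛ : ∀ j y t, Λ₀ ≤ |a (pj y) t j| := by
    intro j y t
    have h := ((hLam (pj y) (pj_mem y) t).1 j)
    rcases lt_or_ge (j : ℕ) m with hj | hj
    · exact (h.1 hj).trans (le_abs_self _)
    · have := h.2 hj
      exact (by linarith : Λ₀ ≤ -a (pj y) t j).trans (neg_le_abs _)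
  have hane : ∀ j y t, a (pj y) t j ≠ 0 := fun j y t h => by
    have := haΛ j y t
    rw [h, abs_zero] at this
    linarith
  set c : Fin n → ℝ → ℝ → ℝ := fun j y t => (a (pj y) t j)⁻¹ with hc
  set ct : Fin n → ℝ → ℝ → ℝ := fun j y t => -(at' j (pj y) t) / (a (pj y) t j) ^ 2 with hct
  have hacont : ∀ j, Continuous (fun q : ℝ × ℝ => a (pj q.1) q.2 j) := fun j =>
    continuous_pj_of_strip (g := fun x t => a x t j) (hac j)
  have hccont : ∀ j, Continuous (fun q : ℝ × ℝ => c j q.1 q.2) := fun j =>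
    (hacont j).inv₀ fun q => hane j _ _
  have hctcont : ∀ j, Continuous (fun q : ℝ × ℝ => ct j q.1 q.2) := fun j =>
    ((continuous_pj_of_strip (hatc j)).neg).div ((hacont j).pow 2) fun q => pow_ne_zero _ (hane j _ _)
  have hcd : ∀ j y t, HasDerivAt (c j y) (ct j y t) t := fun j y t =>
    ((hab1 j (pj y) (pj_mem y) t).2.2.2.2).fun_inv (hane j y t)
  have hcB : ∀ j y t, |c j y t| ≤ 1 / Λ₀ := by
    intro j y t
    simp only [hc]
    rw [abs_inv, ← one_div]
    exact one_div_le_one_div_of_le hΛ₀ (haΛ j y t)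
  set L := C / Λ₀ ^ 2 with hL
  have hL0 : 0 ≤ L := by positivity
  have hctB : ∀ j y t, |ct j y t| ≤ L := by
    intro j y t
    simp only [hct]
    rw [abs_div, abs_neg, abs_pow]
    refine div_le_div₀ hC0 (hab1 j (pj y) (pj_mem y) t).2.2.1 (by positivity) ?_
    exact pow_le_pow_left₀ hΛ₀.le (haΛ j y t) 2
  choose T θ hTc hθc hT0 hTchar hTflow hTd hθB using fun j =>
    flow_exists (hccont j) (hctcont j) (hcd j) (hcB j) (hctB j)
  set e : Fin n → ℝ := fun j => if (j : ℕ) < m then 0 else 1 with he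
  have heI : ∀ j, e j ∈ Icc (0:ℝ) 1 := by
    intro j; simp only [he]; split_ifs <;> simp
  have haA : ∀ j, ∀ y t, |a (pj y) t j| ≤ A := fun j y t =>
    (hab1 j (pj y) (pj_mem y) t).1.trans (le_max_left _ _)
  have hTmon : ∀ j, ∀ x ∈ Icc (0:ℝ) 1, ∀ y ∈ uIcc (e j) x, ∀ t,
      T j y x t ≤ t - |x - y| / A := by
    intro j x hx y hy t
    have hyI : y ∈ Icc (0:ℝ) 1 := uIcc_subset_Icc (heI j) hx hy
    rcases lt_or_ge (j : ℕ) m with hj | hj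
    · have ej : e j = 0 := by simp [he, hj]
      rw [ej, uIcc_of_le hx.1] at hy
      have := char_mono (hTchar j x hx t) (k := 1 / A) (fun y _ t => by
        have h1 := ((hLam (pj y) (pj_mem y) t).1 j).1 hj
        simp only [hc]
        rw [← one_div]
        exact one_div_le_one_div_of_le (by linarith) ((le_abs_self _).trans (haA j y t)))
        hyI hx hy.2
      rw [abs_of_nonneg (by linarith [hy.2])]
      simp only [hT0 j x hx t] at this
      have h2 : 1 / A * (x - y) = (x - y) / A := by ring
      linarith
    · have ej : e j = 1 := by simp [he, not_lt.2 hj]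
      rw [ej, uIcc_of_ge hx.2] at hy
      have := char_mono' (hTchar j x hx t) (k := -(1 / A)) (fun y _ t => by
        have h1 := ((hLam (pj y) (pj_mem y) t).1 j).2 hj
        have h3 := (neg_le_abs _).trans (haA j y t)
        have h4 := one_div_le_one_div_of_le (by linarith : 0 < -a (pj y) t j) h3
        simp only [hc]
        rw [one_div (-a (pj y) t j), inv_neg] at h4
        linarith)
        hx hyI hy.1
      rw [abs_of_nonpos (by linarith [hy.1])]
      simp only [hT0 j x hx t] at this
      have h2 : -(1 / A) * (y - x) = -(-(x - y) / A) := by ring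
      linarith
  have hbcont : ∀ j k, Continuous (fun q : ℝ × ℝ => b (pj q.1) q.2 j k) := fun j k =>
    continuous_pj_of_strip (g := fun x t => b x t j k) (hbc j k)
  have hbtcont : ∀ j k, Continuous (fun q : ℝ × ℝ => bt j k (pj q.1) q.2) := fun j k =>
    continuous_pj_of_strip (hbtc j k)
  have hpjc : Continuous (fun q : ℝ × ℝ => ((pj q.1, q.2) : ℝ × ℝ)) := by fun_prop
  set Z : Set (ℝ × ℝ) := {q | q.2 ≤ t0 ∨ min q.1 (1 - q.1) + A * (q.2 - t0) < ε} with hZ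
  have hbd2 : ∀ {u v U V : ℝ}, |u| ≤ U → |v| ≤ V → |u * v| ≤ U * V := by
    intro u v U V h1 h2
    rw [abs_mul]
    exact mul_le_mul h1 h2 (abs_nonneg _) ((abs_nonneg _).trans h1)
  let D : SD n :=
    { e := e
      o := fun j => 1 - e j
      he := heI
      ho := fun j => ⟨by linarith [(heI j).2], by linarith [(heI j).1]⟩
      heo := fun j => by simp only [he]; split_ifs <;> norm_num
      p := p
      T := T
      θ := θ
      hTc := hTc
      hθc := hθc
      A := A
      hA := hA0
      hT := hTmon
      E := Real.exp L
      hE := hθB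
      β := fun j k y t => c j y t * b (pj y) t j k
      β' := fun j k y t => ct j y t * b (pj y) t j k + c j y t * bt j k (pj y) t
      hβc := fun j k => (hccont j).mul (hbcont j k)
      hβ'c := fun j k => ((hctcont j).mul (hbcont j k)).add ((hccont j).mul (hbtcont j k))
      B := L * C + 1 / Λ₀ * C
      hβ := fun j k y t => by
        have := hbd2 (hcB j y t) (hb1 j k (pj y) (pj_mem y) t).1
        have h2 : 0 ≤ L * C := by positivity
        linarith
      hβ' := fun j k y t => (abs_add_le _ _).trans (add_le_add
        (hbd2 (hctB j y t) (hb1 j k (pj y) (pj_mem y) t).1)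
        (hbd2 (hcB j y t) (hb1 j k (pj y) (pj_mem y) t).2.2.1))
      r := fun j y t => ct j y t * f (pj y) t j + c j y t * ft (pj y) t j
      hrc := fun j => ((hctcont j).mul ((hfc j).comp hpjc)).add
        ((hccont j).mul ((hftc j).comp hpjc))
      R := L * R + 1 / Λ₀ * R
      hR := fun j y t => (abs_add_le _ _).trans (add_le_add
        (hbd2 (hctB j y t) (hfR _ _ _)) (hbd2 (hcB j y t) (hftR _ _ _)))
      t0 := t0
      Z := Z
      hZ0 := fun x t h => Or.inl h
      hrZ := fun j x hx t h => by
        rw [pj_eq hx, (hfZ x hx t h j).1, (hfZ x hx t h j).2]; ring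
      hZ1 := fun j x hx y hy t h => by
        have h1 := hTmon j x hx y hy t
        have h2 : 0 ≤ |x - y| / A := div_nonneg (abs_nonneg _) hA0.le
        rcases h with h | h
        · exact Or.inl (by simp only at h ⊢; linarith)
        · refine Or.inr ?_
          simp only at h ⊢
          have h3 : A * (T j y x t - t0) ≤ A * (t - t0) - |x - y| := by
            have := mul_le_mul_of_nonneg_left h1 hA0.le
            have h4 : A * (t - |x - y| / A) = A * t - |x - y| := by field_simp
            linarith [mul_sub A (T j y x t) t0, mul_sub A t t0]
          have h4 : min y (1 - y) ≤ min x (1 - x) + |x - y| := by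
            have := neg_le_abs (x - y)
            have := le_abs_self (x - y)
            rcases min_choice x (1 - x) with h5 | h5 <;> rw [h5]
            · exact (min_le_left _ _).trans (by linarith)
            · exact (min_le_right _ _).trans (by linarith)
          linarith
      hZ2 := fun j k τ h => by
        rcases h with h | h
        · exact Or.inl h
        · refine Or.inr ?_
          simp only at h ⊢
          have h1 : ∀ j, min (e j) (1 - e j) = 0 := by
            intro j; simp only [he]; split_ifs <;> norm_num
          have h2 : min (1 - e k) (1 - (1 - e k)) = 0 := by
            rw [sub_sub_cancel, min_comm]; exact h1 k
          rw [h2]; rw [h1 j] at h; exact h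
      hZ3 := fun x t t' htt h => by
        rcases h with h | h
        · exact Or.inl (htt.trans h)
        · refine Or.inr ?_
          simp only at h ⊢
          have := mul_le_mul_of_nonneg_left htt hA0.le
          linarith [mul_sub A t t0, mul_sub A t' t0] }
  have hq0 : ∀ j y t, t ≤ t0 → c j y t * f (pj y) t j = 0 := fun j y t h => by
    rw [(hfZ (pj y) (pj_mem y) t (Or.inl h) j).1, mul_zero]
  obtain ⟨w, wx, wt, hwc, hwxc, hwtc, hder, hwx, hbc', hwZ⟩ :=
    D.solve_w c hccont hT0 hTchar hTflow hTd
      (fun j y t => c j y t * f (pj y) t j)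
      (fun j => (hccont j).mul ((hfc j).comp hpjc))
      (fun j y t => (hcd j y t).fun_mul (hfd (pj y) t j)) hq0
      (fun j k y t => (hcd j y t).fun_mul (hb1 j k (pj y) (pj_mem y) t).2.2.2.2)
  have hvc : ∀ {v : Fin n → ℝ → ℝ → ℝ}, (∀ j, Continuous (fun r : ℝ × ℝ => v j r.1 r.2)) →
      Continuous (fun r : ℝ × ℝ => (WithLp.toLp 2 (fun j => v j r.1 r.2) : Vn n)) := by
    intro v hv
    exact (PiLp.continuous_toLp 2 _).comp (continuous_pi hv)
  refine ⟨fun x t => WithLp.toLp 2 (fun j => w j x t), fun x t => WithLp.toLp 2 (fun j => wx j x t),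
    fun x t => WithLp.toLp 2 (fun j => wt j x t), ?_, ?_⟩
  · intro s
    refine ⟨(hvc hwc).continuousOn, (hvc hwxc).continuousOn, (hvc hwtc).continuousOn, ?_, ?_, ?_,
      fun x _ => rfl⟩
    · intro x hx t _ j
      exact ⟨(hder j x hx t).1, (hder j x hx t).2.hasDerivWithinAt⟩
    · intro x hx t _ j
      show wt j x t + a x t j * wx j x t + ∑ k, b x t j k * w k x t = f x t j
      rw [hwx j x hx t]
      show wt j x t + a x t j * (c j x t * f (pj x) t j - ∑ k, (c j x t * b (pj x) t j k) * w k x t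
        - c j x t * wt j x t) + ∑ k, b x t j k * w k x t = f x t j
      have h1 : a x t j * c j x t = 1 := by
        have := hane j x t
        simp only [hc, pj_eq hx] at this ⊢
        exact mul_inv_cancel₀ this
      have h2 : ∑ k, (c j x t * b (pj x) t j k) * w k x t =
          c j x t * ∑ k, b x t j k * w k x t := by
        rw [Finset.mul_sum, pj_eq hx]
        exact Finset.sum_congr rfl fun k _ => by ring
      rw [h2, pj_eq hx]
      linear_combination (f x t j - (∑ k, b x t j k * w k x t) - wt j x t) * h1
    · intro t _ j
      have h1 : w j (e j) t = ∑ k, p j k * w k (1 - e k) t := hbc' j t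
      have h2 : ∑ k, p j k * w k (1 - e k) t = ∑ k : Fin n,
          if m ≤ (k : ℕ) then p j k * w k 0 t else p j k * w k 1 t := by
        refine Finset.sum_congr rfl fun k _ => ?_
        simp only [he]
        rcases lt_or_ge (k : ℕ) m with hk | hk
        · simp [hk, not_le.2 hk]
        · simp [hk, not_lt.2 hk]
      rw [h2] at h1
      refine ⟨fun hj => ?_, fun hj => ?_⟩
      · have ej : e j = 0 := by simp [he, hj]
        rw [ej] at h1; exact h1
      · have ej : e j = 1 := by simp [he, not_lt.2 hj]
        rw [ej] at h1; exact h1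
  · intro x hx t h
    ext j
    exact hwZ j x hx t h

/-! ### L² helpers -/

lemma memLp_of_contOn {n : ℕ} {u : ℝ → Vn n} (hu : ContinuousOn u (Icc 0 1)) :
    MemLp u 2 μ01 := by
  have h1 : ContinuousOn u (Ioo 0 1) := hu.mono Ioo_subset_Icc_self
  obtain ⟨M, hM⟩ := isCompact_Icc.exists_bound_of_continuousOn hu
  refine MemLp.of_bound (h1.aestronglyMeasurable measurableSet_Ioo) M ?_
  filter_upwards [ae_restrict_mem measurableSet_Ioo] with x hx
  exact hM x (Ioo_subset_Icc_self hx)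

lemma l2_norm_sq {n : ℕ} (φ : L2 n) {u : ℝ → Vn n} (h : ∀ᵐ x ∂μ01, φ x = u x) :
    ‖φ‖ ^ 2 = ∫ x in (0:ℝ)..1, ‖u x‖ ^ 2 := by
  rw [← real_inner_self_eq_norm_sq, L2.inner_def,
    intervalIntegral.integral_of_le zero_le_one, integral_Ioc_eq_integral_Ioo]
  refine integral_congr_ae ?_
  filter_upwards [h] with x hx
  rw [hx, real_inner_self_eq_norm_sq]

lemma l2_norm_le {n : ℕ} (φ : L2 n) {u : ℝ → Vn n} (h : ∀ᵐ x ∂μ01, φ x = u x) {c : ℝ}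
    (hc : 0 ≤ c) (hle : ∫ x in (0:ℝ)..1, ‖u x‖ ^ 2 ≤ c ^ 2) : ‖φ‖ ≤ c := by
  rw [← l2_norm_sq φ h] at hle
  exact abs_le_of_sq_le_sq' hle hc |>.2

/-- classes of `C¹` functions with compact support in `(0,1)` -/
def C1c (n : ℕ) : Submodule ℝ (L2 n) where
  carrier := {φ | ∃ g : ℝ → Vn n, ContDiff ℝ 1 g ∧ tsupport g ⊆ Ioo 0 1 ∧ ∀ᵐ x ∂μ01, φ x = g x}
  add_mem' := by
    rintro φ ψ ⟨g, h1, h2, h3⟩ ⟨g', h1', h2', h3'⟩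
    refine ⟨g + g', h1.add h1', (tsupport_add g g').trans (union_subset h2 h2'), ?_⟩
    filter_upwards [h3, h3', Lp.coeFn_add φ ψ] with x e1 e2 e3
    rw [e3, Pi.add_apply, Pi.add_apply, e1, e2]
  zero_mem' := ⟨fun _ => 0, contDiff_const, by
    have : tsupport (fun _ : ℝ => (0 : Vn n)) = ∅ := by
      rw [tsupport_eq_empty_iff]; rfl
    rw [this]; exact empty_subset _, by
    filter_upwards [Lp.coeFn_zero (Vn n) 2 μ01] with x hx
    rw [hx]; rfl⟩
  smul_mem' := by
    rintro c φ ⟨g, h1, h2, h3⟩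
    refine ⟨fun x => c • g x, h1.const_smul c, ?_, ?_⟩
    · exact (tsupport_smul_subset_right (fun _ => c) g).trans h2
    · filter_upwards [h3, Lp.coeFn_smul c φ] with x e1 e2
      rw [e2, Pi.smul_apply, e1]

theorem C1c_dense (n : ℕ) : Dense (C1c n : Set (L2 n)) := by
  rw [Submodule.dense_iff_topologicalClosure_eq_top, Submodule.topologicalClosure_eq_top_iff,
    Submodule.eq_bot_iff]
  intro h hh
  rw [Submodule.mem_orthogonal] at hh
  have hIntv : Integrable h μ01 := (Lp.memLp h).integrable (by norm_num)
  have key : ∀ᵐ x ∂(volume : Measure ℝ), x ∈ Ioo (0:ℝ) 1 → h x = 0 := by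
    refine isOpen_Ioo.ae_eq_zero_of_integral_contDiff_smul_eq_zero
      (IntegrableOn.locallyIntegrableOn hIntv) ?_
    intro g hg hgc hgs
    have e0 : ∫ x, g x • h x = ∫ x in Ioo (0:ℝ) 1, g x • h x := by
      refine (setIntegral_eq_integral_of_forall_compl_eq_zero fun x hx => ?_).symm
      have : g x = 0 := by
        by_contra h0
        exact hx (hgs (subset_tsupport _ h0))
      rw [this, zero_smul]
    rw [e0]
    obtain ⟨M, hM⟩ := hgc.exists_bound_of_continuous hg.continuous
    have hgi : Integrable (fun x => g x • h x) μ01 :=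
      hIntv.bdd_smul M hg.continuous.aestronglyMeasurable (Eventually.of_forall hM)
    refine ext_inner_left ℝ fun v => ?_
    rw [← integral_inner hgi, inner_zero_right]
    set G : ℝ → Vn n := fun x => g x • v with hG
    have hG1 : ContDiff ℝ 1 G := (hg.of_le (by exact_mod_cast le_top)).smul contDiff_const
    have hm : MemLp G 2 μ01 := memLp_of_contOn hG1.continuous.continuousOn
    have hmem : hm.toLp G ∈ C1c n :=
      ⟨G, hG1, (tsupport_smul_subset_left g fun _ => v).trans hgs, hm.coeFn_toLp⟩
    have := hh _ hmem
    rw [L2.inner_def] at this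
    rw [← this]
    refine integral_congr_ae ?_
    filter_upwards [hm.coeFn_toLp] with x hx
    rw [hx, hG, inner_smul_right, inner_smul_left]; rfl
  rw [Lp.eq_zero_iff_ae_eq_zero]
  exact (ae_restrict_iff' measurableSet_Ioo).2 key

/-! ### A smooth step in time -/

lemma exists_step {t0 s : ℝ} (h : t0 < s) : ∃ (H H1 H2 : ℝ → ℝ) (M : ℝ),
    Continuous H1 ∧ Continuous H2 ∧ (∀ t, HasDerivAt H (H1 t) t) ∧
    (∀ t, HasDerivAt H1 (H2 t) t) ∧ (∀ t, t ≤ t0 → H t = 0 ∧ H1 t = 0 ∧ H2 t = 0) ∧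
    (∀ t, s ≤ t → H t = 1 ∧ H1 t = 0 ∧ H2 t = 0) ∧ (∀ t, |H t| ≤ 1) ∧
    (∀ t, |H1 t| ≤ M) ∧ (∀ t, |H2 t| ≤ M) := by
  set d := (s - t0) / 3 with hd
  have hd0 : 0 < d := by rw [hd]; linarith
  set H : ℝ → ℝ := fun t => Real.smoothTransition ((t - t0 - d) / d) with hH
  have hs : ContDiff ℝ 3 H := by
    have : ContDiff ℝ ((3 : ℕ∞) : WithTop ℕ∞) Real.smoothTransition := Real.smoothTransition.contDiff
    exact ContDiff.comp (g := Real.smoothTransition) (by exact_mod_cast this) (by fun_prop)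
  have hs1 : ContDiff ℝ 2 (deriv H) := by
    have : ContDiff ℝ (2 + 1) H := by
      have e : (2 + 1 : WithTop ℕ∞) = 3 := by norm_num
      rw [e]; exact hs
    exact (contDiff_succ_iff_deriv.1 this).2.2
  have hs2 : ContDiff ℝ 1 (deriv (deriv H)) := by
    have : ContDiff ℝ (1 + 1) (deriv H) := by
      have e : (1 + 1 : WithTop ℕ∞) = 2 := by norm_num
      rw [e]; exact hs1
    exact (contDiff_succ_iff_deriv.1 this).2.2
  have hd1 : ∀ t, HasDerivAt H (deriv H t) t := fun t =>
    (hs.differentiable (by norm_num) t).hasDerivAt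
  have hd2 : ∀ t, HasDerivAt (deriv H) (deriv (deriv H) t) t := fun t =>
    (hs1.differentiable (by norm_num) t).hasDerivAt
  have hloc : ∀ (U : Set ℝ) (c : ℝ), IsOpen U → (∀ t ∈ U, H t = c) → ∀ t ∈ U,
      deriv H t = 0 ∧ deriv (deriv H) t = 0 := by
    intro U c hU hc t ht
    have a1 : ∀ t ∈ U, deriv H t = 0 := by
      intro t ht
      have : H =ᶠ[nhds t] fun _ => c := by
        filter_upwards [hU.mem_nhds ht] with x hx using hc x hx
      rw [this.deriv_eq, deriv_const]
    refine ⟨a1 t ht, ?_⟩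
    have : deriv H =ᶠ[nhds t] fun _ => 0 := by
      filter_upwards [hU.mem_nhds ht] with x hx using a1 x hx
    rw [this.deriv_eq, deriv_const]
  have hlow : ∀ t ∈ Iio (t0 + d), H t = 0 := by
    intro t ht
    refine Real.smoothTransition.zero_of_nonpos (div_nonpos_of_nonpos_of_nonneg ?_ hd0.le)
    linarith [mem_Iio.1 ht]
  have hhigh : ∀ t ∈ Ioi (t0 + 2 * d), H t = 1 := by
    intro t ht
    refine Real.smoothTransition.one_of_one_le ?_
    rw [le_div_iff₀ hd0]
    linarith [mem_Ioi.1 ht]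
  have hl2 := hloc _ _ isOpen_Iio hlow
  have hh2 := hloc _ _ isOpen_Ioi hhigh
  have hm1 : ∀ t, t ≤ t0 → t ∈ Iio (t0 + d) := fun t ht => mem_Iio.2 (by linarith)
  have hm2 : ∀ t, s ≤ t → t ∈ Ioi (t0 + 2 * d) := fun t ht => mem_Ioi.2 (by rw [hd]; linarith)
  have hbd : ∀ F : ℝ → ℝ, Continuous F → (∀ t, t ≤ t0 → F t = 0) → (∀ t, s ≤ t → F t = 0) →
      ∃ M, 0 ≤ M ∧ ∀ t, |F t| ≤ M := by
    intro F hF h1 h2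
    obtain ⟨M, hM⟩ := (isCompact_Icc (a := t0) (b := s)).exists_bound_of_continuousOn hF.continuousOn
    have hM0 : 0 ≤ M := (norm_nonneg _).trans (hM t0 (by simp [h.le]))
    refine ⟨M, hM0, fun t => ?_⟩
    rcases le_total t t0 with k1 | k1
    · rw [h1 t k1, abs_zero]; exact hM0
    rcases le_total s t with k2 | k2
    · rw [h2 t k2, abs_zero]; exact hM0
    · exact hM t ⟨k1, k2⟩
  obtain ⟨M1, hM10, hM1⟩ := hbd (deriv H) hs1.continuous (fun t ht => (hl2 t (hm1 t ht)).1)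
    (fun t ht => (hh2 t (hm2 t ht)).1)
  obtain ⟨M2, hM20, hM2⟩ := hbd (deriv (deriv H)) hs2.continuous
    (fun t ht => (hl2 t (hm1 t ht)).2) (fun t ht => (hh2 t (hm2 t ht)).2)
  refine ⟨H, deriv H, deriv (deriv H), M1 + M2, hs1.continuous, hs2.continuous, hd1, hd2,
    fun t ht => ⟨hlow t (hm1 t ht), hl2 t (hm1 t ht)⟩,
    fun t ht => ⟨hhigh t (hm2 t ht), hh2 t (hm2 t ht)⟩, fun t => ?_,
    fun t => (hM1 t).trans (by linarith), fun t => (hM2 t).trans (by linarith)⟩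
  rw [abs_of_nonneg (Real.smoothTransition.nonneg _)]
  exact Real.smoothTransition.le_one _

/-! ### Approximation by classical data -/

lemma hasDerivAt_eucl {n : ℕ} {g : ℝ → Vn n} {g' : Vn n} {x : ℝ} :
    HasDerivAt g g' x ↔ ∀ j, HasDerivAt (fun y => g y j) (g' j) x := by
  constructor
  · intro h j
    exact (EuclideanSpace.proj j : Vn n →L[ℝ] ℝ).hasFDerivAt.comp_hasDerivAt x h
  · intro h
    have h1 : HasDerivAt (fun y => (g y).ofLp) (g'.ofLp) x := hasDerivAt_pi.2 h
    exact (PiLp.continuousLinearEquiv 2 ℝ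
      (fun _ : Fin n => ℝ)).symm.toContinuousLinearMap.hasFDerivAt.comp_hasDerivAt x h1

lemma bcrel_comb {n m : ℕ} {p : Fin n → Fin n → ℝ} {w0 w1 z0 z1 : Vn n} (c d : ℝ)
    (h : BCrel n m p w0 w1) (h' : BCrel n m p z0 z1) :
    BCrel n m p (c • w0 + d • z0) (c • w1 + d • z1) := by
  have key : ∀ j : Fin n, (∑ k : Fin n, if m ≤ (k : ℕ) then p j k * (c • w0 + d • z0) k
        else p j k * (c • w1 + d • z1) k)
      = c * (∑ k : Fin n, if m ≤ (k : ℕ) then p j k * w0 k else p j k * w1 k)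
        + d * (∑ k : Fin n, if m ≤ (k : ℕ) then p j k * z0 k else p j k * z1 k) := by
    intro j
    rw [Finset.mul_sum, Finset.mul_sum, ← Finset.sum_add_distrib]
    refine Finset.sum_congr rfl fun k _ => ?_
    split_ifs <;> simp <;> ring
  intro j
  rw [key]
  refine ⟨fun hj => ?_, fun hj => ?_⟩
  · rw [← (h j).1 hj, ← (h' j).1 hj]; simp
  · rw [← (h j).2 hj, ← (h' j).2 hj]; simp

lemma linSol_comb {n m : ℕ} {p : Fin n → Fin n → ℝ}
    {a : ℝ → ℝ → Fin n → ℝ} {b : ℝ → ℝ → Fin n → Fin n → ℝ}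
    {f f' : ℝ → ℝ → Fin n → ℝ} {s : ℝ} {φ φ' : ℝ → Vn n} {u ux ut v vx vt : ℝ → ℝ → Vn n}
    (c d : ℝ)
    (h : IsLinSol n m p a b f s φ u ux ut) (h' : IsLinSol n m p a b f' s φ' v vx vt) :
    IsLinSol n m p a b (fun x t j => c * f x t j + d * f' x t j) s (fun x => c • φ x + d • φ' x)
      (fun x t => c • u x t + d • v x t) (fun x t => c • ux x t + d • vx x t)
      (fun x t => c • ut x t + d • vt x t) := by
  obtain ⟨c1, c2, c3, dd, eq, bc, ini⟩ := h
  obtain ⟨c1', c2', c3', dd', eq', bc', ini'⟩ := h'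
  refine ⟨(c1.const_smul c).add (c1'.const_smul d), (c2.const_smul c).add (c2'.const_smul d),
    (c3.const_smul c).add (c3'.const_smul d), ?_, ?_, ?_, ?_⟩
  · intro x hx t ht j
    refine ⟨?_, ?_⟩
    · exact ((dd x hx t ht j).1.const_mul c).fun_add ((dd' x hx t ht j).1.const_mul d)
    · exact ((dd x hx t ht j).2.const_mul c).fun_add ((dd' x hx t ht j).2.const_mul d)
  · intro x hx t ht j
    show _ = c * f x t j + d * f' x t j
    rw [← eq x hx t ht j, ← eq' x hx t ht j]
    have : ∑ k : Fin n, b x t j k * (c • u x t + d • v x t) k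
        = c * (∑ k, b x t j k * u x t k) + d * (∑ k, b x t j k * v x t k) := by
      rw [Finset.mul_sum, Finset.mul_sum, ← Finset.sum_add_distrib]
      refine Finset.sum_congr rfl fun k _ => ?_
      simp; ring
    rw [this]
    simp; ring
  · intro t ht
    exact bcrel_comb c d (bc t ht) (bc' t ht)
  · intro x hx
    simp only [ini x hx, ini' x hx]

lemma linSol_mono {n m : ℕ} {p : Fin n → Fin n → ℝ}
    {a : ℝ → ℝ → Fin n → ℝ} {b : ℝ → ℝ → Fin n → Fin n → ℝ}
    {f : ℝ → ℝ → Fin n → ℝ} {s r : ℝ} {φ : ℝ → Vn n} {u ux ut : ℝ → ℝ → Vn n}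
    (h : IsLinSol n m p a b f s φ u ux ut) (hr : s ≤ r) :
    IsLinSol n m p a b f r (fun x => u x r) u ux ut := by
  obtain ⟨c1, c2, c3, dd, eq, bc, ini⟩ := h
  have hI : Ici r ⊆ Ici s := Ici_subset_Ici.2 hr
  have hS : Icc (0:ℝ) 1 ×ˢ Ici r ⊆ Icc (0:ℝ) 1 ×ˢ Ici s := prod_mono le_rfl hI
  exact ⟨c1.mono hS, c2.mono hS, c3.mono hS,
    fun x hx t ht j => ⟨(dd x hx t (hI ht) j).1, (dd x hx t (hI ht) j).2.mono hI⟩,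
    fun x hx t ht j => eq x hx t (hI ht) j, fun t ht => bc t (hI ht), fun x _ => rfl⟩

lemma linSol_congr_f {n m : ℕ} {p : Fin n → Fin n → ℝ}
    {a : ℝ → ℝ → Fin n → ℝ} {b : ℝ → ℝ → Fin n → Fin n → ℝ}
    {f f' : ℝ → ℝ → Fin n → ℝ} {s : ℝ} {φ φ' : ℝ → Vn n} {u ux ut : ℝ → ℝ → Vn n}
    (h : IsLinSol n m p a b f s φ u ux ut)
    (hf : ∀ x ∈ Icc (0:ℝ) 1, ∀ t ∈ Ici s, ∀ j, f x t j = f' x t j)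
    (hφ : ∀ x ∈ Icc (0:ℝ) 1, φ x = φ' x) :
    IsLinSol n m p a b f' s φ' u ux ut := by
  obtain ⟨c1, c2, c3, dd, eq, bc, ini⟩ := h
  exact ⟨c1, c2, c3, dd, fun x hx t ht j => (eq x hx t ht j).trans (hf x hx t ht j), bc,
    fun x hx => (ini x hx).trans (hφ x hx)⟩

/-- `H(t) g(x)` as a classical solution of an inhomogeneous problem. -/
lemma linSol_tensor {n m : ℕ} (p : Fin n → Fin n → ℝ)
    (a : ℝ → ℝ → Fin n → ℝ) (b : ℝ → ℝ → Fin n → Fin n → ℝ)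
    {g : ℝ → Vn n} (hg : ContDiff ℝ 1 g) (hg0 : g 0 = 0) (hg1 : g 1 = 0)
    {H H1 : ℝ → ℝ} (hH1 : Continuous H1) (hH : ∀ t, HasDerivAt H (H1 t) t) (s : ℝ) :
    IsLinSol n m p a b
      (fun x t j => H1 t * g x j + H t * (a x t j * deriv g x j + ∑ k, b x t j k * g x k)) s
      (fun x => H s • g x) (fun x t => H t • g x) (fun x t => H t • deriv g x)
      (fun x t => H1 t • g x) := by
  have hgc := hg.continuous
  have hgd : Continuous (deriv g) := hg.continuous_deriv le_rfl
  have hHc : Continuous H := continuous_iff_continuousAt.2 fun t => (hH t).continuousAt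
  have hgj : ∀ x j, HasDerivAt (fun y => g y j) (deriv g x j) x := by
    intro x j
    have h1 : HasDerivAt g (deriv g x) x :=
      ((hg.differentiable one_ne_zero) x).hasDerivAt
    exact (hasDerivAt_eucl.1 h1) j
  refine ⟨?_, ?_, ?_, ?_, ?_, ?_, fun x _ => rfl⟩
  · exact ((hHc.comp continuous_snd).smul (hgc.comp continuous_fst)).continuousOn
  · exact ((hHc.comp continuous_snd).smul (hgd.comp continuous_fst)).continuousOn
  · exact ((hH1.comp continuous_snd).smul (hgc.comp continuous_fst)).continuousOn
  · intro x hx t ht j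
    refine ⟨((hgj x j).const_mul (H t)).hasDerivWithinAt, ?_⟩
    exact ((hH t).mul_const (g x j)).hasDerivWithinAt
  · intro x hx t ht j
    have : ∑ k : Fin n, b x t j k * (H t • g x) k = H t * ∑ k, b x t j k * g x k := by
      rw [Finset.mul_sum]
      refine Finset.sum_congr rfl fun k _ => ?_
      simp; ring
    rw [this]; simp; ring
  · intro t ht j
    simp [hg0, hg1]

/-- bound of the spatial operator on a fixed `C¹` function -/
lemma spatial_bound {n : ℕ}
    (a : ℝ → ℝ → Fin n → ℝ) (b : ℝ → ℝ → Fin n → Fin n → ℝ)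
    (hab : ∃ C : ℝ, ∀ j : Fin n, BCle 1 (fun x t => a x t j) C ∧
      ∀ k : Fin n, BCle 1 (fun x t => b x t j k) C)
    {g : ℝ → Vn n} (hg : ContDiff ℝ 1 g) :
    ∃ F : ℝ, 0 ≤ F ∧ ∀ x ∈ Icc (0:ℝ) 1, ∀ t j,
      |a x t j * deriv g x j + ∑ k, b x t j k * g x k| ≤ F := by
  obtain ⟨C, hC⟩ := hab
  have hC' : ∀ j x t, x ∈ Icc (0:ℝ) 1 → |a x t j| ≤ |C| ∧ ∀ k, |b x t j k| ≤ |C| := by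
    intro j x t hx
    obtain ⟨_, _, _, _, _, h⟩ := bc1_extract (hC j).1
    refine ⟨(h x hx t).1.trans (le_abs_self C), fun k => ?_⟩
    obtain ⟨_, _, _, _, _, h'⟩ := bc1_extract ((hC j).2 k)
    exact (h' x hx t).1.trans (le_abs_self C)
  obtain ⟨M1, hM1⟩ := isCompact_Icc.exists_bound_of_continuousOn
    (hg.continuous.continuousOn (s := Icc (0:ℝ) 1))
  obtain ⟨M2, hM2⟩ := isCompact_Icc.exists_bound_of_continuousOn
    ((hg.continuous_deriv le_rfl).continuousOn (s := Icc (0:ℝ) 1))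
  refine ⟨|C| * |M2| + n * (|C| * |M1|), by positivity, fun x hx t j => ?_⟩
  refine (abs_add_le _ _).trans (add_le_add ?_ ?_)
  · rw [abs_mul]
    refine mul_le_mul (hC' j x t hx).1 ?_ (abs_nonneg _) (abs_nonneg _)
    have := PiLp.norm_apply_le (deriv g x) j
    rw [Real.norm_eq_abs] at this
    exact this.trans ((hM2 x hx).trans (le_abs_self _))
  · refine (Finset.abs_sum_le_sum_abs _ _).trans ?_
    have : ∀ k ∈ (Finset.univ : Finset (Fin n)), |b x t j k * g x k| ≤ |C| * |M1| := by
      intro k _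
      rw [abs_mul]
      refine mul_le_mul ((hC' j x t hx).2 k) ?_ (abs_nonneg _) (abs_nonneg _)
      have := PiLp.norm_apply_le (g x) k
      rw [Real.norm_eq_abs] at this
      exact this.trans ((hM1 x hx).trans (le_abs_self _))
    refine (Finset.sum_le_sum this).trans ?_
    simp

lemma supp_gap {n : ℕ} {g : ℝ → Vn n} (hs : tsupport g ⊆ Ioo 0 1) :
    ∃ ε > 0, ∀ x : ℝ, min x (1 - x) < ε → g x = 0 := by
  have hcp : IsCompact (tsupport g) :=
    isCompact_Icc.of_isClosed_subset (isClosed_tsupport g) (hs.trans Ioo_subset_Icc_self)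
  rcases (tsupport g).eq_empty_or_nonempty with h0 | hne
  · refine ⟨1, one_pos, fun x _ => ?_⟩
    exact image_eq_zero_of_notMem_tsupport (by rw [h0]; exact notMem_empty x)
  · obtain ⟨x0, hx0, hmin⟩ := hcp.exists_isMinOn hne
      (f := fun x : ℝ => min x (1 - x)) (by fun_prop)
    refine ⟨min x0 (1 - x0), lt_min (hs hx0).1 (by linarith [(hs hx0).2]), fun x hx => ?_⟩
    refine image_eq_zero_of_notMem_tsupport fun hxm => ?_
    exact absurd (hmin hxm) (not_le.2 hx)

/-- a function on `[0,1]`, `C¹` there, vanishing near the end points, extends by zero -/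
lemma extend_zero {n : ℕ} {w wx : ℝ → Vn n} {ε : ℝ} (hε : 0 < ε)
    (hwx : ContinuousOn wx (Icc 0 1))
    (hd : ∀ x ∈ Icc (0:ℝ) 1, ∀ j, HasDerivWithinAt (fun y => w y j) (wx x j) (Icc 0 1) x)
    (hz : ∀ x ∈ Icc (0:ℝ) 1, min x (1 - x) < ε → w x = 0) :
    ∃ φ : ℝ → Vn n, ContDiff ℝ 1 φ ∧ tsupport φ ⊆ Ioo 0 1 ∧ ∀ x ∈ Icc (0:ℝ) 1, φ x = w x := by
  have hz' : ∀ x : ℝ, min x (1 - x) < min ε 1 → w (pj x) = 0 := by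
    intro x hx
    have hx1 : min x (1 - x) < ε := hx.trans_le (min_le_left _ _)
    refine hz _ (pj_mem x) ?_
    rcases le_or_gt x 0 with h | h
    · have : pj x = 0 := by simp [pj, h]
      rw [this]; simpa using hε
    rcases le_or_gt 1 x with h' | h'
    · have : pj x = 1 := by simp [pj, h']
      rw [this]; simpa using hε
    · rw [pj_eq ⟨h.le, h'.le⟩]; exact hx1
  have hwz : ∀ x ∈ Icc (0:ℝ) 1, min x (1 - x) < ε → wx x = 0 := by
    intro x hx hxe
    ext j
    have h1 := hd x hx j
    have h2 : HasDerivWithinAt (fun y => w y j) 0 (Icc 0 1) x := by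
      have h3 : HasDerivWithinAt (fun _ : ℝ => (0:ℝ)) 0 (Icc 0 1) x :=
        hasDerivWithinAt_const _ _ _
      refine h3.congr_of_eventuallyEq ?_ ?_
      · have : ∀ᶠ y in nhdsWithin x (Icc 0 1), min y (1 - y) < ε :=
          nhdsWithin_le_nhds ((show Continuous fun y : ℝ => min y (1 - y) by fun_prop).continuousAt.eventually
            (gt_mem_nhds hxe))
        filter_upwards [this, self_mem_nhdsWithin] with y hy hy1
        rw [hz y hy1 hy]; rfl
      · rw [hz x hx hxe]; rfl
    have hu : UniqueDiffWithinAt ℝ (Icc (0:ℝ) 1) x := uniqueDiffOn_Icc zero_lt_one x hx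
    have := h1.derivWithin hu
    rw [h2.derivWithin hu] at this
    simpa using this.symm
  have hder : ∀ x, HasDerivAt (fun y => w (pj y)) (wx (pj x)) x := by
    intro x
    by_cases hx : min x (1 - x) < min ε 1
    · have e0 : wx (pj x) = 0 := by
        refine hwz _ (pj_mem x) ?_
        have hx1 : min x (1 - x) < ε := hx.trans_le (min_le_left _ _)
        rcases le_or_gt x 0 with h | h
        · have : pj x = 0 := by simp [pj, h]
          rw [this]; simpa using hε
        rcases le_or_gt 1 x with h' | h'
        · have : pj x = 1 := by simp [pj, h']
          rw [this]; simpa using hε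
        · rw [pj_eq ⟨h.le, h'.le⟩]; exact hx1
      rw [e0]
      refine (hasDerivAt_const x (0 : Vn n)).congr_of_eventuallyEq ?_
      filter_upwards [(show Continuous fun y : ℝ => min y (1 - y) by fun_prop).continuousAt.eventually
            (gt_mem_nhds hx)] with y hy
      exact hz' y hy
    · have hx0 : x ∈ Ioo (0:ℝ) 1 := by
        have h1 : 0 < min x (1 - x) := (lt_min hε one_pos).trans_le (not_lt.1 hx)
        exact ⟨(lt_min_iff.1 h1).1, by linarith [(lt_min_iff.1 h1).2]⟩
      rw [hasDerivAt_eucl]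
      intro j
      have hI := Icc_mem_nhds hx0.1 hx0.2
      have h1 := (hd x (Ioo_subset_Icc_self hx0) j).hasDerivAt hI
      rw [pj_eq (Ioo_subset_Icc_self hx0)]
      refine h1.congr_of_eventuallyEq ?_
      filter_upwards [hI] with y hy
      rw [pj_eq hy]
  refine ⟨fun x => w (pj x), ?_, ?_, fun x hx => by show w (pj x) = w x; rw [pj_eq hx]⟩
  · rw [contDiff_one_iff_deriv]
    refine ⟨fun x => (hder x).differentiableAt, ?_⟩
    have : deriv (fun y => w (pj y)) = fun x => wx (pj x) := funext fun x => (hder x).deriv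
    rw [this]
    exact hwx.comp_continuous continuous_pj pj_mem
  · have hcl : IsClosed {x : ℝ | min ε 1 ≤ min x (1 - x)} :=
      isClosed_le continuous_const (by fun_prop)
    have : tsupport (fun x => w (pj x)) ⊆ {x : ℝ | min ε 1 ≤ min x (1 - x)} := by
      refine closure_minimal (fun x hx => ?_) hcl
      by_contra h
      exact hx (hz' x (not_le.1 h))
    refine this.trans fun x hx => ?_
    have h1 : 0 < min x (1 - x) := (lt_min hε one_pos).trans_le hx
    exact ⟨(lt_min_iff.1 h1).1, by linarith [(lt_min_iff.1 h1).2]⟩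

set_option maxHeartbeats 1000000 in
theorem approx_classical (n m : ℕ) (hn : 1 ≤ n) (p : Fin n → Fin n → ℝ)
    (a : ℝ → ℝ → Fin n → ℝ) (b : ℝ → ℝ → Fin n → Fin n → ℝ)
    (hab : ∃ C : ℝ, ∀ j : Fin n, BCle 1 (fun x t => a x t j) C ∧
      ∀ k : Fin n, BCle 1 (fun x t => b x t j k) C)
    (Λ₀ : ℝ) (hΛ₀ : 0 < Λ₀) (hLam : LamCond n m Λ₀ a)
    (g : ℝ → Vn n) (hg : ContDiff ℝ 1 g) (hgs : tsupport g ⊆ Ioo 0 1) (s η : ℝ) (hη : 0 < η) :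
    ∃ φ : ℝ → Vn n, ContDiff ℝ 1 φ ∧ tsupport φ ⊆ Ioo 0 1 ∧
      (∃ u ux ut, IsLinSol n m p a b (fun _ _ _ => 0) s φ u ux ut) ∧
      ∫ x in (0:ℝ)..1, ‖φ x - g x‖ ^ 2 ≤ η := by
  obtain ⟨K, ν, hK, hν, hE⟩ := energy_est n m hn p a b hab Λ₀ hΛ₀ hLam
  obtain ⟨A, hA, hS⟩ := strip_solve n m hn p a b hab Λ₀ hΛ₀ hLam
  obtain ⟨ε, hε, hgz⟩ := supp_gap hgs
  obtain ⟨F, hF, hFb⟩ := spatial_bound a b hab hg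
  obtain ⟨δ, hδ, hδ1, hδ2, hδ3⟩ : ∃ δ : ℝ, 0 < δ ∧ δ ≤ 1 ∧ A * δ ≤ ε / 2 ∧
      K * Real.exp ν * (F ^ 2 * δ) ≤ η := by
    set B := K * Real.exp ν * F ^ 2 + 1 with hB
    have hK0 : 0 < K := by linarith
    have hBp : 0 < B := by positivity
    refine ⟨min 1 (min (ε / 2 / A) (η / B)), by positivity, min_le_left _ _, ?_, ?_⟩
    · calc A * min 1 (min (ε / 2 / A) (η / B)) ≤ A * (ε / 2 / A) := by
            gcongr; exact (min_le_right _ _).trans (min_le_left _ _)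
        _ = ε / 2 := by field_simp
    · have h1 : min 1 (min (ε / 2 / A) (η / B)) ≤ η / B :=
        (min_le_right _ _).trans (min_le_right _ _)
      have h0 : 0 < min 1 (min (ε / 2 / A) (η / B)) := by positivity
      rw [le_div_iff₀ hBp] at h1
      nlinarith [h1]
  obtain ⟨H, H1, H2, M, hH1c, hH2c, hdH, hdH1, hlow, hup, hHb, hH1b, hH2b⟩ :=
    exists_step (show s - δ < s by linarith)
  have hg0 : g 0 = 0 := hgz 0 (by simpa using hε)
  have hg1 : g 1 = 0 := hgz 1 (by simpa using hε)
  have hgcj : ∀ j, Continuous fun x => g x j := fun j =>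
    (EuclideanSpace.proj (𝕜 := ℝ) j).continuous.comp hg.continuous
  obtain ⟨G, hG⟩ := isCompact_Icc.exists_bound_of_continuousOn
    (hg.continuous.continuousOn (s := Icc (0:ℝ) 1))
  have hGa : ∀ x j, |g x j| ≤ |G| := by
    intro x j
    by_cases hx : x ∈ Icc (0:ℝ) 1
    · have := PiLp.norm_apply_le (g x) j
      rw [Real.norm_eq_abs] at this
      exact this.trans ((hG x hx).trans (le_abs_self _))
    · have : g x = 0 := image_eq_zero_of_notMem_tsupport fun h => hx (Ioo_subset_Icc_self (hgs h))
      rw [this]; simp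
  have hM : 0 ≤ M := (abs_nonneg _).trans (hH1b 0)
  obtain ⟨w, wx, wt, hw, hwz⟩ := hS (s - δ) ε (M * |G|) (fun x t j => H1 t * g x j)
    (fun x t j => H2 t * g x j) hε
    (fun j => (hH1c.comp continuous_snd).mul ((hgcj j).comp continuous_fst))
    (fun j => (hH2c.comp continuous_snd).mul ((hgcj j).comp continuous_fst))
    (fun x t j => (hdH1 t).mul_const _)
    (fun x t j => by rw [abs_mul]; exact mul_le_mul (hH1b t) (hGa x j) (abs_nonneg _) hM)
    (fun x t j => by rw [abs_mul]; exact mul_le_mul (hH2b t) (hGa x j) (abs_nonneg _) hM)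
    (by
      intro x hx t ht j
      rcases le_or_gt t (s - δ) with h | h
      · rw [(hlow t h).2.1, (hlow t h).2.2]; simp
      · rcases ht with h' | h'
        · exact absurd h' (not_le.2 h)
        · have : g x = 0 := hgz x (by nlinarith [mul_pos hA (sub_pos.2 h)])
          rw [this]; simp)
  have hws := hw s
  have hwx : ContinuousOn (fun x => wx x s) (Icc 0 1) :=
    hws.2.1.comp (f := fun x : ℝ => (x, s)) (by fun_prop) (fun x hx => ⟨hx, self_mem_Ici⟩)
  obtain ⟨φ, hφ1, hφ2, hφ3⟩ := extend_zero (w := fun x => w x s) (wx := fun x => wx x s)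
    (ε := ε / 2) (by linarith) hwx (fun x hx j => (hws.2.2.2.1 x hx s self_mem_Ici j).1)
    (fun x hx hxe => hwz x hx s (Or.inr (by
      have : A * (s - (s - δ)) = A * δ := by ring
      rw [this]; linarith)))
  refine ⟨φ, hφ1, hφ2, ⟨w, wx, wt, linSol_congr_f hws ?_ (fun x hx => (hφ3 x hx).symm)⟩, ?_⟩
  · intro x hx t ht j
    rw [(hup t ht).2.1]; simp
  · have hT := linSol_tensor (m := m) p a b hg hg0 hg1 hH1c hdH (s - δ)
    have hv := linSol_comb 1 (-1) (hw (s - δ)) hT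
    have h := hE (s - δ) F _ _ _ _ _ hv (by
      intro x hx t ht j
      have e : 1 * (H1 t * g x j) + (-1) * (H1 t * g x j + H t * (a x t j * deriv g x j
          + ∑ k, b x t j k * g x k)) = - (H t * (a x t j * deriv g x j
          + ∑ k, b x t j k * g x k)) := by ring
      rw [e, abs_neg, abs_mul]
      calc |H t| * |a x t j * deriv g x j + ∑ k, b x t j k * g x k| ≤ 1 * F :=
            mul_le_mul (hHb t) (hFb x hx t j) (abs_nonneg _) zero_le_one
        _ = F := one_mul F) s (by linarith)
    have e1 : ∫ x in (0:ℝ)..1, ‖(1:ℝ) • w x (s - δ) + (-1:ℝ) • (H (s - δ) • g x)‖ ^ 2 = 0 := by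
      have : EqOn (fun x : ℝ => ‖(1:ℝ) • w x (s - δ) + (-1:ℝ) • (H (s - δ) • g x)‖ ^ 2)
          (fun _ => (0:ℝ)) (uIcc 0 1) := by
        intro x hx
        rw [uIcc_of_le zero_le_one] at hx
        simp only
        rw [hwz x hx _ (Or.inl le_rfl), (hlow _ le_rfl).1]; simp
      rw [intervalIntegral.integral_congr this]; simp
    have e2 : ∫ x in (0:ℝ)..1, ‖φ x - g x‖ ^ 2
        = ∫ x in (0:ℝ)..1, ‖(1:ℝ) • w x s + (-1:ℝ) • (H s • g x)‖ ^ 2 := by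
      refine intervalIntegral.integral_congr fun x hx => ?_
      rw [uIcc_of_le zero_le_one] at hx
      show ‖φ x - g x‖ ^ 2 = ‖(1:ℝ) • w x s + (-1:ℝ) • (H s • g x)‖ ^ 2
      rw [hφ3 x hx, (hup s le_rfl).1, one_smul, one_smul, neg_one_smul, sub_eq_add_neg]
    rw [e1, ← e2] at h
    refine h.trans (le_trans ?_ hδ3)
    have : s - (s - δ) = δ := by ring
    rw [this, zero_add]
    have : Real.exp (ν * δ) ≤ Real.exp ν := Real.exp_le_exp.2 (by nlinarith)
    gcongr

/-! ### Abstract construction of the evolution family -/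

lemma tendsto_of_dense {X ι : Type*} [NormedAddCommGroup X] [NormedSpace ℝ X] {l : Filter ι}
    {T : ι → X →L[ℝ] X} {T0 : X →L[ℝ] X} {B : ℝ} (hB : ∀ᶠ i in l, ‖T i‖ ≤ B)
    {D : Set X} (hD : Dense D)
    (h : ∀ ψ ∈ D, Tendsto (fun i => T i ψ) l (nhds (T0 ψ))) (φ : X) :
    Tendsto (fun i => T i φ) l (nhds (T0 φ)) := by
  rw [Metric.tendsto_nhds]
  intro ε hε
  set c := |B| + ‖T0‖ + 1 with hc
  have hcp : 0 < c := by positivity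
  obtain ⟨ψ, hψ, hd⟩ := Metric.dense_iff.1 hD φ (ε / (2 * c)) (by positivity)
  rw [Metric.mem_ball, dist_eq_norm] at hψ
  rw [lt_div_iff₀ (by positivity)] at hψ
  filter_upwards [hB, Metric.tendsto_nhds.1 (h ψ hd) (ε / 2) (by positivity)] with i h1 h2
  rw [dist_eq_norm] at h2 ⊢
  have e : T i φ - T0 φ = (T i ψ - T0 ψ) - T i (ψ - φ) + T0 (ψ - φ) := by
    simp only [map_sub]; abel
  rw [e]
  have h3 : ‖T i (ψ - φ)‖ ≤ |B| * ‖ψ - φ‖ :=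
    ((T i).le_opNorm _).trans (by gcongr; exact h1.trans (le_abs_self B))
  have h4 : ‖T0 (ψ - φ)‖ ≤ ‖T0‖ * ‖ψ - φ‖ := T0.le_opNorm _
  have h5 := norm_add_le ((T i ψ - T0 ψ) - T i (ψ - φ)) (T0 (ψ - φ))
  have h6 := norm_sub_le (T i ψ - T0 ψ) (T i (ψ - φ))
  have h7 : (|B| + ‖T0‖) * ‖ψ - φ‖ ≤ c * ‖ψ - φ‖ := by gcongr; linarith
  nlinarith

lemma extend_graph {X : Type*} [NormedAddCommGroup X] [NormedSpace ℝ X] [CompleteSpace X]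
    (G : Submodule ℝ (X × X)) {C : ℝ} (hC : 0 ≤ C) (hb : ∀ q ∈ G, ‖q.2‖ ≤ C * ‖q.1‖)
    (hd : Dense {x : X | ∃ y, (x, y) ∈ G}) :
    ∃ T : X →L[ℝ] X, (∀ q ∈ G, T q.1 = q.2) ∧ ‖T‖ ≤ C := by
  let e : G →ₗ[ℝ] X := (LinearMap.fst ℝ X X).comp G.subtype
  let f : G →ₗ[ℝ] X := (LinearMap.snd ℝ X X).comp G.subtype
  have hde : DenseRange e := by
    refine hd.mono ?_
    rintro x ⟨y, hy⟩
    exact ⟨⟨(x, y), hy⟩, rfl⟩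
  have hn : ∀ x : G, ‖f x‖ ≤ C * ‖e x‖ := fun x => hb x.1 x.2
  refine ⟨f.extendOfNorm e, fun q hq => ?_, LinearMap.opNorm_extendOfNorm_le hde hC hn⟩
  exact LinearMap.extendOfNorm_eq hde ⟨C, hn⟩ (⟨q, hq⟩ : G)

set_option maxHeartbeats 1000000 in
theorem evo_abstract {X : Type*} [NormedAddCommGroup X] [NormedSpace ℝ X] [CompleteSpace X]
    (Traj : ℝ → (ℝ → X) → Prop) (K ν : ℝ) (hK : 1 ≤ K) (hν : 0 ≤ ν)
    (hlin : ∀ s z z', Traj s z → Traj s z' → ∀ c d : ℝ, Traj s (fun t => c • z t + d • z' t))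
    (hbd : ∀ s z, Traj s z → ∀ t, s ≤ t → ‖z t‖ ≤ K * Real.exp (ν * (t - s)) * ‖z s‖)
    (hres : ∀ s z, Traj s z → ∀ r, s ≤ r → Traj r z)
    (hcont : ∀ s z, Traj s z → ContinuousOn z (Ici s))
    (hdense : ∀ s, Dense {x : X | ∃ z, Traj s z ∧ z s = x})
    (D : Set X) (hD : Dense D)
    (hDb : ∀ ψ ∈ D, ∃ L μ F : ℝ, 0 ≤ L ∧ 0 ≤ μ ∧ 0 ≤ F ∧ ∀ s z, Traj s z → ∀ t, s ≤ t →
      ‖z t - ψ‖ ^ 2 ≤ L * Real.exp (μ * (t - s)) * (‖z s - ψ‖ ^ 2 + F * (t - s))) :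
    ∃ U : ℝ → ℝ → X →L[ℝ] X,
      (∀ s z, Traj s z → ∀ t, s ≤ t → U t s (z s) = z t) ∧
      (∀ t, U t t = ContinuousLinearMap.id ℝ X) ∧
      (∀ s r t, s ≤ r → r ≤ t → ∀ φ, U t r (U r s φ) = U t s φ) ∧
      (∀ φ, ContinuousOn (fun q : ℝ × ℝ => U q.1 q.2 φ) {q : ℝ × ℝ | q.2 ≤ q.1}) ∧
      (∀ s t, s ≤ t → ‖U t s‖ ≤ K * Real.exp (ν * (t - s))) := by
  have hK0 : 0 < K := by linarith
  have hex : ∀ t s, ∃ T : X →L[ℝ] X, s ≤ t → (∀ z, Traj s z → T (z s) = z t) ∧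
      ‖T‖ ≤ K * Real.exp (ν * (t - s)) := by
    intro t s
    by_cases hst : s ≤ t
    swap
    · exact ⟨0, fun h => absurd h hst⟩
    have hne : ∃ z, Traj s z := by
      obtain ⟨x, z, hz, _⟩ := (hdense s).nonempty
      exact ⟨z, hz⟩
    let G : Submodule ℝ (X × X) :=
      { carrier := {q | ∃ z, Traj s z ∧ z s = q.1 ∧ z t = q.2}
        add_mem' := by
          rintro q q' ⟨z, h1, h2, h3⟩ ⟨z', h1', h2', h3'⟩
          exact ⟨_, hlin s z z' h1 h1' 1 1, by simp [h2, h2'], by simp [h3, h3']⟩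
        zero_mem' := by
          obtain ⟨z, hz⟩ := hne
          exact ⟨_, hlin s z z hz hz 0 0, by simp, by simp⟩
        smul_mem' := by
          rintro c q ⟨z, h1, h2, h3⟩
          exact ⟨_, hlin s z z h1 h1 c 0, by simp [h2], by simp [h3]⟩ }
    obtain ⟨T, hT, hTn⟩ := extend_graph G (C := K * Real.exp (ν * (t - s))) (by positivity)
      (by
        rintro ⟨x, y⟩ ⟨z, h1, h2, h3⟩
        have := hbd s z h1 t hst
        rw [h2, h3] at this
        exact this)
      (by
        refine (hdense s).mono ?_
        rintro x ⟨z, h1, h2⟩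
        exact ⟨z t, z, h1, h2, rfl⟩)
    exact ⟨T, fun _ => ⟨fun z hz => hT (z s, z t) ⟨z, hz, rfl, rfl⟩, hTn⟩⟩
  choose U hU using hex
  have hU1 : ∀ s z, Traj s z → ∀ t, s ≤ t → U t s (z s) = z t := fun s z hz t ht =>
    (hU t s ht).1 z hz
  have hU2 : ∀ s t, s ≤ t → ‖U t s‖ ≤ K * Real.exp (ν * (t - s)) := fun s t ht => (hU t s ht).2
  have hid : ∀ t, U t t = ContinuousLinearMap.id ℝ X := by
    intro t
    refine ContinuousLinearMap.coeFn_injective ?_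
    refine Continuous.ext_on (hdense t) (U t t).continuous continuous_id ?_
    rintro x ⟨z, hz, rfl⟩
    exact hU1 t z hz t le_rfl
  have hco : ∀ s r t, s ≤ r → r ≤ t → ∀ φ, U t r (U r s φ) = U t s φ := by
    intro s r t hsr hrt φ
    have : (fun φ => U t r (U r s φ)) = fun φ => U t s φ := by
      refine Continuous.ext_on (hdense s) (by fun_prop) (by fun_prop) ?_
      rintro x ⟨z, hz, rfl⟩
      simp only
      rw [hU1 s z hz r hsr, hU1 r z (hres s z hz r hsr) t hrt, hU1 s z hz t (hsr.trans hrt)]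
    exact congrFun this φ
  have hc1 : ∀ s φ, ContinuousOn (fun t => U t s φ) (Ici s) := by
    intro s φ t0 ht0
    have hB : ∀ᶠ t in nhdsWithin t0 (Ici s), ‖U t s‖ ≤ K * Real.exp (ν * (t0 + 1 - s)) := by
      have : ∀ᶠ t in nhdsWithin t0 (Ici s), t < t0 + 1 :=
        nhdsWithin_le_nhds (gt_mem_nhds (by linarith))
      filter_upwards [this, self_mem_nhdsWithin] with t h1 h2
      refine (hU2 s t h2).trans ?_
      gcongr
    refine tendsto_of_dense (T := fun t => U t s) (T0 := U t0 s) hB (hdense s) ?_ φ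
    rintro x ⟨z, hz, rfl⟩
    have := hcont s z hz t0 ht0
    have e : U t0 s (z s) = z t0 := hU1 s z hz t0 ht0
    rw [e]
    refine Tendsto.congr' ?_ this
    filter_upwards [self_mem_nhdsWithin] with t h2
    exact (hU1 s z hz t h2).symm
  have hA : ∀ ψ ∈ D, ∃ C, 0 ≤ C ∧ ∀ s t, s ≤ t → t ≤ s + 1 →
      ‖U t s ψ - ψ‖ ≤ C * Real.sqrt (t - s) := by
    intro ψ hψ
    obtain ⟨L, μ, F, hL, hμ, hF, h⟩ := hDb ψ hψ
    refine ⟨Real.sqrt (L * Real.exp μ * F), Real.sqrt_nonneg _, fun s t hst hts => ?_⟩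
    have key : ∀ χ, ‖U t s χ - ψ‖ ^ 2
        ≤ L * Real.exp (μ * (t - s)) * (‖χ - ψ‖ ^ 2 + F * (t - s)) := by
      intro χ
      refine (hdense s).induction (P := fun χ => ‖U t s χ - ψ‖ ^ 2
        ≤ L * Real.exp (μ * (t - s)) * (‖χ - ψ‖ ^ 2 + F * (t - s))) ?_
        (isClosed_le (by fun_prop) (by fun_prop)) χ
      rintro x ⟨z, hz, rfl⟩
      rw [hU1 s z hz t hst]
      exact h s z hz t hst
    have k2 := key ψ
    have h0 : 0 ≤ t - s := by linarith
    rw [← Real.sqrt_mul (by positivity)]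
    refine Real.le_sqrt_of_sq_le (k2.trans ?_)
    rw [sub_self, norm_zero, zero_pow two_ne_zero, zero_add]
    have : Real.exp (μ * (t - s)) ≤ Real.exp μ := Real.exp_le_exp.2 (by nlinarith)
    calc L * Real.exp (μ * (t - s)) * (F * (t - s)) ≤ L * Real.exp μ * (F * (t - s)) := by
          gcongr
      _ = _ := by ring
  refine ⟨U, hU1, hid, hco, ?_, hU2⟩
  intro φ
  rintro ⟨t0, s0⟩ h00
  have h0 : s0 ≤ t0 := h00
  have hnear : ∀ᶠ q : ℝ × ℝ in nhdsWithin (t0, s0) {q : ℝ × ℝ | q.2 ≤ q.1},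
      q.2 ≤ q.1 ∧ q.1 < t0 + 1 ∧ s0 - 1 < q.2 ∧ q.2 < s0 + 1 := by
    have e1 : ∀ᶠ q : ℝ × ℝ in nhds (t0, s0), q.1 < t0 + 1 :=
      continuous_fst.continuousAt.eventually (gt_mem_nhds (show t0 < t0 + 1 by linarith))
    have e2 : ∀ᶠ q : ℝ × ℝ in nhds (t0, s0), s0 - 1 < q.2 :=
      continuous_snd.continuousAt.eventually (lt_mem_nhds (show s0 - 1 < s0 by linarith))
    have e3 : ∀ᶠ q : ℝ × ℝ in nhds (t0, s0), q.2 < s0 + 1 :=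
      continuous_snd.continuousAt.eventually (gt_mem_nhds (show s0 < s0 + 1 by linarith))
    filter_upwards [self_mem_nhdsWithin, nhdsWithin_le_nhds e1, nhdsWithin_le_nhds e2,
      nhdsWithin_le_nhds e3] with q h1 h2 h3 h4
    exact ⟨h1, h2, h3, h4⟩
  set B := K * Real.exp (ν * (t0 - s0 + 2)) with hBdef
  have hB1 : 1 ≤ B := by
    have : 1 ≤ Real.exp (ν * (t0 - s0 + 2)) := Real.one_le_exp (mul_nonneg hν (by linarith))
    nlinarith
  have hUB : ∀ s t, s ≤ t → t - s ≤ t0 - s0 + 2 → ‖U t s‖ ≤ B := by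
    intro s t h1 h2
    refine (hU2 s t h1).trans ?_
    rw [hBdef]; gcongr
  refine tendsto_of_dense (T := fun q : ℝ × ℝ => U q.1 q.2) (T0 := U t0 s0) (B := B) ?_ hD ?_ φ
  · filter_upwards [hnear] with q hq
    exact hUB _ _ hq.1 (by linarith [hq.2.1, hq.2.2.1])
  · intro ψ hψ
    obtain ⟨C, hC, hCb⟩ := hA ψ hψ
    have est : ∀ᶠ q : ℝ × ℝ in nhdsWithin (t0, s0) {q : ℝ × ℝ | q.2 ≤ q.1},
        ‖U q.1 q.2 ψ - U (max q.1 s0) s0 ψ‖ ≤ B * (C * Real.sqrt |q.2 - s0|) := by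
      filter_upwards [hnear] with q hq
      obtain ⟨t, s⟩ := q
      obtain ⟨hst, ht1, hs1, hs2⟩ := hq
      simp only at hst ht1 hs1 hs2 ⊢
      rcases le_total s0 s with h | h
      · rw [max_eq_left (h.trans hst), ← hco s0 s t h hst ψ, ← map_sub, abs_of_nonneg (by linarith)]
        refine ((U t s).le_opNorm _).trans ?_
        rw [norm_sub_rev]
        exact mul_le_mul (hUB s t hst (by linarith)) (hCb s0 s h (by linarith)) (norm_nonneg _)
          (by linarith)
      · rw [abs_of_nonpos (by linarith), neg_sub]
        rcases le_total s0 t with h' | h'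
        · rw [max_eq_left h', ← hco s s0 t h h' ψ, ← map_sub]
          refine ((U t s0).le_opNorm _).trans ?_
          exact mul_le_mul (hUB s0 t h' (by linarith)) (hCb s s0 h (by linarith)) (norm_nonneg _)
            (by linarith)
        · rw [max_eq_right h', hid]
          refine (hCb s t hst (by linarith)).trans ?_
          have : C * Real.sqrt (t - s) ≤ C * Real.sqrt (s0 - s) := by gcongr
          refine this.trans ?_
          have h8 : 0 ≤ C * Real.sqrt (s0 - s) := by positivity
          nlinarith
    have lim1 : Tendsto (fun q : ℝ × ℝ => U (max q.1 s0) s0 ψ)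
        (nhdsWithin (t0, s0) {q : ℝ × ℝ | q.2 ≤ q.1}) (nhds (U t0 s0 ψ)) := by
      have hc : Continuous fun τ : ℝ => U (max τ s0) s0 ψ :=
        (hc1 s0 ψ).comp_continuous (by fun_prop) (fun τ => mem_Ici.2 (le_max_right _ _))
      have h3 : Continuous fun q : ℝ × ℝ => U (max q.1 s0) s0 ψ := hc.comp continuous_fst
      have h4 := h3.continuousAt (x := (t0, s0))
      unfold ContinuousAt at h4
      simp only [max_eq_left h0] at h4
      exact h4.mono_left nhdsWithin_le_nhds
    have lim2 : Tendsto (fun q : ℝ × ℝ => U q.1 q.2 ψ - U (max q.1 s0) s0 ψ)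
        (nhdsWithin (t0, s0) {q : ℝ × ℝ | q.2 ≤ q.1}) (nhds 0) := by
      refine squeeze_zero_norm' est ?_
      have hc : Continuous fun q : ℝ × ℝ => B * (C * Real.sqrt |q.2 - s0|) := by fun_prop
      have h4 := hc.continuousAt (x := (t0, s0))
      unfold ContinuousAt at h4
      simp only [sub_self, abs_zero, Real.sqrt_zero, mul_zero] at h4
      exact h4.mono_left nhdsWithin_le_nhds
    have := lim2.add lim1
    simpa using this

/-! ### The concrete trajectories -/

/-- `z` is (the `L²`-version of) a classical solution of the homogeneous problem on `[s,∞)`. -/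
def TrajL (n m : ℕ) (p : Fin n → Fin n → ℝ)
    (a : ℝ → ℝ → Fin n → ℝ) (b : ℝ → ℝ → Fin n → Fin n → ℝ) (s : ℝ) (z : ℝ → L2 n) : Prop :=
  ∃ u ux ut, IsLinSol n m p a b (fun _ _ _ => 0) s (fun x => u x s) u ux ut ∧
    ∀ t ∈ Ici s, ∀ᵐ x ∂μ01, z t x = u x t

lemma slice_contOn {n : ℕ} {u : ℝ → ℝ → Vn n} {s t : ℝ}
    (h : ContinuousOn (fun q : ℝ × ℝ => u q.1 q.2) (Icc 0 1 ×ˢ Ici s)) (ht : t ∈ Ici s) :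
    ContinuousOn (fun x => u x t) (Icc 0 1) :=
  h.comp (f := fun x : ℝ => (x, t)) (by fun_prop) (fun x hx => ⟨hx, ht⟩)

/-- every classical solution gives a trajectory in `L²` -/
lemma exists_lift {n : ℕ} {u : ℝ → ℝ → Vn n} {s : ℝ}
    (h : ContinuousOn (fun q : ℝ × ℝ => u q.1 q.2) (Icc 0 1 ×ˢ Ici s)) :
    ∃ z : ℝ → L2 n, ∀ t ∈ Ici s, ∀ᵐ x ∂μ01, z t x = u x t := by
  classical
  refine ⟨fun t => if ht : t ∈ Ici s then (memLp_of_contOn (slice_contOn h ht)).toLp _ else 0,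
    fun t ht => ?_⟩
  simp only [dif_pos ht]
  exact MemLp.coeFn_toLp _

lemma ae_sub {n : ℕ} {φ ψ : L2 n} {u v : ℝ → Vn n} (h : ∀ᵐ x ∂μ01, φ x = u x)
    (h' : ∀ᵐ x ∂μ01, ψ x = v x) : ∀ᵐ x ∂μ01, (φ - ψ : L2 n) x = u x - v x := by
  filter_upwards [h, h', Lp.coeFn_sub φ ψ] with x e1 e2 e3
  rw [e3, Pi.sub_apply, e1, e2]

lemma ae_of_Icc {n : ℕ} {φ : L2 n} {u v : ℝ → Vn n} (h : ∀ᵐ x ∂μ01, φ x = u x)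
    (huv : ∀ x ∈ Icc (0:ℝ) 1, u x = v x) : ∀ᵐ x ∂μ01, φ x = v x := by
  filter_upwards [h, ae_restrict_mem measurableSet_Ioo] with x e1 hx
  rw [e1, huv x (Ioo_subset_Icc_self hx)]

lemma traj_cont {n m : ℕ} {p : Fin n → Fin n → ℝ}
    {a : ℝ → ℝ → Fin n → ℝ} {b : ℝ → ℝ → Fin n → Fin n → ℝ} {s : ℝ} {z : ℝ → L2 n}
    (h : TrajL n m p a b s z) : ContinuousOn z (Ici s) := by
  obtain ⟨u, ux, ut, hu, hz⟩ := h
  intro t0 ht0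
  have hs := slice_contOn hu.1 ht0
  have hG : ContinuousOn (fun q : ℝ × ℝ => ‖u q.1 q.2 - u q.1 t0‖ ^ 2) (Icc 0 1 ×ˢ Ici s) :=
    ((hu.1.sub (hs.comp continuousOn_fst (fun q hq => hq.1))).norm).pow 2
  have hI := continuousOn_param (G := fun x t => ‖u x t - u x t0‖ ^ 2) hG
  have h1 := hI t0 ht0
  unfold ContinuousWithinAt at h1 ⊢
  have e0 : ∫ x in (0:ℝ)..1, ‖u x t0 - u x t0‖ ^ 2 = 0 := by simp
  beta_reduce at h1
  rw [e0] at h1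
  rw [tendsto_iff_norm_sub_tendsto_zero]
  have h2 : Tendsto (fun t => Real.sqrt (∫ x in (0:ℝ)..1, ‖u x t - u x t0‖ ^ 2))
      (nhdsWithin t0 (Ici s)) (nhds 0) := by
    have := (Real.continuous_sqrt.tendsto 0).comp h1
    rw [Real.sqrt_zero] at this
    exact this
  refine h2.congr' ?_
  filter_upwards [self_mem_nhdsWithin] with t ht
  rw [← l2_norm_sq (z t - z t0) (ae_sub (hz t ht) (hz t0 ht0)), Real.sqrt_sq (norm_nonneg _)]

set_option maxHeartbeats 1000000 in
theorem approx_seq (n m : ℕ) (hn : 1 ≤ n) (p : Fin n → Fin n → ℝ)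
    (a : ℝ → ℝ → Fin n → ℝ) (b : ℝ → ℝ → Fin n → Fin n → ℝ)
    (hab : ∃ C : ℝ, ∀ j : Fin n, BCle 1 (fun x t => a x t j) C ∧
      ∀ k : Fin n, BCle 1 (fun x t => b x t j k) C)
    (Λ₀ : ℝ) (hΛ₀ : 0 < Λ₀) (hLam : LamCond n m Λ₀ a) (s : ℝ) (φ : L2 n) (η : ℝ) (hη : 0 < η) :
    ∃ (g : ℝ → Vn n) (gh : L2 n) (u ux ut : ℝ → ℝ → Vn n) (z : ℝ → L2 n),
      ContDiff ℝ 1 g ∧ tsupport g ⊆ Ioo 0 1 ∧ (∀ᵐ x ∂μ01, gh x = g x) ∧ ‖gh - φ‖ < η ∧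
      IsLinSol n m p a b (fun _ _ _ => 0) s g u ux ut ∧
      ∀ t ∈ Ici s, ∀ᵐ x ∂μ01, z t x = u x t := by
  obtain ⟨ψ, hψ, g, hg, hgs, hψg⟩ := Metric.dense_iff.1 (C1c_dense n) φ (η / 2) (by positivity)
  rw [Metric.mem_ball, dist_eq_norm] at hψ
  obtain ⟨g', hg', hgs', ⟨u, ux, ut, hu⟩, hIntv⟩ :=
    approx_classical n m hn p a b hab Λ₀ hΛ₀ hLam g hg hgs s ((η / 2) ^ 2 / 4) (by positivity)
  obtain ⟨z, hz⟩ := exists_lift hu.1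
  have hgm := memLp_of_contOn (hg'.continuous.continuousOn (s := Icc (0:ℝ) 1))
  have hgh := MemLp.coeFn_toLp hgm
  refine ⟨g', hgm.toLp _, u, ux, ut, z, hg', hgs', hgh, ?_, hu, hz⟩
  have h1 : ‖hgm.toLp _ - ψ‖ ≤ η / 4 := by
    refine l2_norm_le _ (ae_sub hgh hψg) (by positivity) (hIntv.trans (le_of_eq (by ring)))
  have := norm_sub_le_norm_sub_add_norm_sub (hgm.toLp _) ψ φ
  linarith

set_option maxHeartbeats 1000000 in
theorem evo_exists (n m : ℕ) (hn : 1 ≤ n) (p : Fin n → Fin n → ℝ)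
    (a : ℝ → ℝ → Fin n → ℝ) (b : ℝ → ℝ → Fin n → Fin n → ℝ)
    (hab : ∃ C : ℝ, ∀ j : Fin n, BCle 1 (fun x t => a x t j) C ∧
      ∀ k : Fin n, BCle 1 (fun x t => b x t j k) C)
    (Λ₀ : ℝ) (hΛ₀ : 0 < Λ₀) (hLam : LamCond n m Λ₀ a) :
    ∃ (K ν : ℝ) (U : ℝ → ℝ → L2 n →L[ℝ] L2 n), 1 ≤ K ∧ 0 ≤ ν ∧
      (∀ s z, TrajL n m p a b s z → ∀ t, s ≤ t → U t s (z s) = z t) ∧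
      (∀ t, U t t = ContinuousLinearMap.id ℝ (L2 n)) ∧
      (∀ s r t, s ≤ r → r ≤ t → ∀ φ, U t r (U r s φ) = U t s φ) ∧
      (∀ φ, ContinuousOn (fun q : ℝ × ℝ => U q.1 q.2 φ) {q : ℝ × ℝ | q.2 ≤ q.1}) ∧
      (∀ s t, s ≤ t → ‖U t s‖ ≤ K * Real.exp (ν * (t - s))) := by
  obtain ⟨K, ν, hK, hν, hE⟩ := energy_est n m hn p a b hab Λ₀ hΛ₀ hLam
  have hK0 : 0 ≤ K := by linarith
  have hK' : 1 ≤ Real.sqrt K := Real.one_le_sqrt.2 hK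
  obtain ⟨U, h⟩ := evo_abstract (TrajL n m p a b) (Real.sqrt K) (ν / 2) hK' (by linarith)
    (by
      rintro s z z' ⟨u, ux, ut, hu, hz⟩ ⟨v, vx, vt, hv, hz'⟩ c d
      refine ⟨_, _, _, linSol_congr_f (linSol_comb c d hu hv) (fun x _ t _ j => by simp)
        (fun x _ => rfl), fun t ht => ?_⟩
      filter_upwards [hz t ht, hz' t ht, Lp.coeFn_add (c • z t) (d • z' t),
        Lp.coeFn_smul c (z t), Lp.coeFn_smul d (z' t)] with x e1 e2 e3 e4 e5
      rw [e3, Pi.add_apply, e4, e5, Pi.smul_apply, Pi.smul_apply, e1, e2])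
    (by
      rintro s z ⟨u, ux, ut, hu, hz⟩ t ht
      have h := hE s 0 _ _ _ _ _ hu (fun x _ t _ j => by simp) t ht
      rw [← l2_norm_sq _ (hz t ht), ← l2_norm_sq _ (hz s self_mem_Ici)] at h
      refine (abs_le_of_sq_le_sq' (h.trans (le_of_eq ?_)) (by positivity)).2
      have e : Real.exp (ν * (t - s)) = Real.exp (ν / 2 * (t - s)) ^ 2 := by
        rw [← Real.exp_nat_mul]; congr 1; push_cast; ring
      rw [mul_pow, mul_pow, Real.sq_sqrt hK0, e]; ring)
    (by
      rintro s z ⟨u, ux, ut, hu, hz⟩ r hr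
      exact ⟨u, ux, ut, linSol_mono hu hr, fun t ht => hz t (hr.trans ht)⟩)
    (fun s z hz => traj_cont hz)
    (by
      intro s
      rw [Metric.dense_iff]
      intro φ η hη
      obtain ⟨g, gh, u, ux, ut, z, h1, h2, h3, h4, h5, h6⟩ :=
        approx_seq n m hn p a b hab Λ₀ hΛ₀ hLam s φ η hη
      refine ⟨gh, by rwa [Metric.mem_ball, dist_eq_norm], z,
        ⟨u, ux, ut, linSol_mono h5 le_rfl, h6⟩, ?_⟩
      have h7 := ae_of_Icc (h6 s self_mem_Ici) (fun x hx => h5.2.2.2.2.2.2 x hx)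
      refine Lp.ext ?_
      filter_upwards [h7, h3] with x e1 e2
      rw [e1, e2])
    (C1c n : Set (L2 n)) (C1c_dense n)
    (by
      rintro ψ ⟨g, hg, hgs, hψ⟩
      obtain ⟨F, hF, hFb⟩ := spatial_bound a b hab hg
      obtain ⟨ε, hε, hgz⟩ := supp_gap hgs
      have hg0 : g 0 = 0 := hgz 0 (by simpa using hε)
      have hg1 : g 1 = 0 := hgz 1 (by simpa using hε)
      refine ⟨K, ν, F ^ 2, hK0, hν, by positivity, ?_⟩
      rintro s z ⟨u, ux, ut, hu, hz⟩ t ht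
      have hT := linSol_tensor (m := m) p a b hg hg0 hg1 (H := fun _ => 1) (H1 := fun _ => 0)
        continuous_const (fun t => hasDerivAt_const t 1) s
      have hv := linSol_comb 1 (-1) hu hT
      have h := hE s F _ _ _ _ _ hv (by
        intro x hx t ht j
        have e : 1 * 0 + (-1) * (0 * g x j + 1 * (a x t j * deriv g x j
            + ∑ k, b x t j k * g x k)) = - (a x t j * deriv g x j
            + ∑ k, b x t j k * g x k) := by ring
        rw [e, abs_neg]
        exact hFb x hx t j) t ht
      have e : ∀ τ x, (1:ℝ) • u x τ + (-1:ℝ) • ((1:ℝ) • g x) = u x τ - g x := by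
        intro τ x
        rw [one_smul, one_smul, neg_one_smul, sub_eq_add_neg]
      simp only [e] at h
      rw [← l2_norm_sq _ (ae_sub (hz t ht) hψ), ← l2_norm_sq _ (ae_sub (hz s self_mem_Ici) hψ)] at h
      exact h)
  exact ⟨Real.sqrt K, ν / 2, U, hK', by linarith, h⟩

set_option maxHeartbeats 1000000 in
theorem stmt_5_core (n m : ℕ) (hn : 1 ≤ n) (hmn : m ≤ n)
    (p : Fin n → Fin n → ℝ)
    (a : ℝ → ℝ → Fin n → ℝ) (b : ℝ → ℝ → Fin n → Fin n → ℝ)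
    (hab : ∃ C : ℝ, ∀ j : Fin n, BCle 1 (fun x t => a x t j) C ∧
      ∀ k : Fin n, BCle 1 (fun x t => b x t j k) C)
    (Λ₀ : ℝ) (hΛ₀ : 0 < Λ₀) (hLam : LamCond n m Λ₀ a) :
    (∀ s : ℝ, ∀ φ : L2 n,
      (∃ u : ℝ → L2 n, IsGenSol n m p a b s φ u) ∧
      (∀ u v : ℝ → L2 n, IsGenSol n m p a b s φ u → IsGenSol n m p a b s φ v →
        ∀ t ∈ Set.Ici s, u t = v t)) ∧
    ∃ U : ℝ → ℝ → L2 n →L[ℝ] L2 n,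
      (∀ s : ℝ, ∀ φ : L2 n, ∀ u : ℝ → L2 n,
        IsGenSol n m p a b s φ u → ∀ t ∈ Set.Ici s, U t s φ = u t) ∧
      (∀ t : ℝ, U t t = ContinuousLinearMap.id ℝ (L2 n)) ∧
      (∀ s r t : ℝ, s ≤ r → r ≤ t → ∀ φ : L2 n, U t r (U r s φ) = U t s φ) ∧
      (∀ φ : L2 n,
        ContinuousOn (fun q : ℝ × ℝ => U q.1 q.2 φ) {q : ℝ × ℝ | q.2 ≤ q.1}) ∧
      ∃ K : ℝ, 1 ≤ K ∧ ∃ ν : ℝ, ∀ s t : ℝ, s ≤ t →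
        ‖U t s‖ ≤ K * Real.exp (ν * (t - s)) := by
  obtain ⟨K, ν, U, hK, hν, hU1, hid, hco, hcont, hbd⟩ :=
    evo_exists n m hn p a b hab Λ₀ hΛ₀ hLam
  have hrep : ∀ s (g : ℝ → Vn n) (gh : L2 n) u ux ut (z : ℝ → L2 n),
      (∀ᵐ x ∂μ01, gh x = g x) → IsLinSol n m p a b (fun _ _ _ => 0) s g u ux ut →
      (∀ t ∈ Ici s, ∀ᵐ x ∂μ01, z t x = u x t) → ∀ t ∈ Ici s, z t = U t s gh := by
    intro s g gh u ux ut z h3 h5 h6 t ht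
    have h7 := ae_of_Icc (h6 s self_mem_Ici) (fun x hx => h5.2.2.2.2.2.2 x hx)
    have e : z s = gh := by
      refine Lp.ext ?_
      filter_upwards [h7, h3] with x e1 e2
      rw [e1, e2]
    rw [← e]
    exact (hU1 s z ⟨u, ux, ut, linSol_mono h5 le_rfl, h6⟩ t ht).symm
  have hgen : ∀ s φ, IsGenSol n m p a b s φ (fun t => U t s φ) := by
    intro s φ
    refine ⟨?_, ?_⟩
    · exact (hcont φ).comp (f := fun t : ℝ => (t, s)) (by fun_prop) (fun t ht => ht)
    · intro φl φlh ul ulx ult ulh _ _ h3 h4 h5 h6 T hT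
      rw [Metric.tendstoUniformlyOn_iff]
      intro ε hε
      set B := K * Real.exp (ν * T) with hB
      have hBp : 0 < B := by positivity
      filter_upwards [h4.eventually (gt_mem_nhds (show 0 < ε / B by positivity))] with l hl θ hθ
      rw [lt_div_iff₀ hBp] at hl
      have hθs : θ ∈ Ici s := hθ.1
      rw [hrep s (φl l) (φlh l) _ _ _ (ulh l) (h3 l) (h5 l) (h6 l) θ hθs, dist_eq_norm,
        norm_sub_rev, ← map_sub]
      refine ((U θ s).le_opNorm _).trans_lt ?_
      have : ‖U θ s‖ ≤ B := by
        refine (hbd s θ hθ.1).trans ?_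
        rw [hB]
        have : θ - s ≤ T := by linarith [hθ.2]
        gcongr
      calc ‖U θ s‖ * ‖φlh l - φ‖ ≤ B * ‖φlh l - φ‖ := by gcongr
        _ < ε := by linarith
  have huniq : ∀ s φ u, IsGenSol n m p a b s φ u → ∀ t ∈ Ici s, U t s φ = u t := by
    intro s φ u hu t ht
    have hseq := fun l : ℕ => approx_seq n m hn p a b hab Λ₀ hΛ₀ hLam s φ (1 / ((l : ℝ) + 1))
      (by positivity)
    choose g gh v vx vt z h1 h2 h3 h4 h5 h6 using hseq
    have hlim : Tendsto (fun l => ‖gh l - φ‖) atTop (nhds 0) :=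
      squeeze_zero (fun l => norm_nonneg _) (fun l => (h4 l).le) tendsto_one_div_add_atTop_nhds_zero_nat
    have ht' : s ≤ t := ht
    have hmem : t ∈ Icc s (s + (t - s + 1)) := ⟨ht', by linarith⟩
    have c1 := (hu.2 g gh v vx vt z h1 h2 h3 hlim h5 h6 (t - s + 1) (by linarith)).tendsto_at hmem
    have c2 := ((hgen s φ).2 g gh v vx vt z h1 h2 h3 hlim h5 h6 (t - s + 1)
      (by linarith)).tendsto_at hmem
    exact tendsto_nhds_unique c2 c1
  refine ⟨fun s φ => ⟨⟨_, hgen s φ⟩, fun u v hu hv t ht => ?_⟩, U, huniq, hid, hco, hcont,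
    K, hK, ν, hbd⟩
  rw [← huniq s φ u hu t ht, ← huniq s φ v hv t ht]

/- STATEMENT 5: existence and uniqueness of the `L²`-generalized solution, and
the fact that it defines a strongly continuous exponentially bounded evolution
family on `L²((0,1);ℝⁿ)`. -/
theorem stmt_5 (n m : ℕ) (hn : 1 ≤ n) (hmn : m ≤ n)
    (p : Fin n → Fin n → ℝ)
    (a : ℝ → ℝ → Fin n → ℝ) (b : ℝ → ℝ → Fin n → Fin n → ℝ)
    -- `a`, `b` have bounded continuous partial derivatives up to first order
    (hab : ∃ C : ℝ, ∀ j : Fin n, BCle 1 (fun x t => a x t j) C ∧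
      ∀ k : Fin n, BCle 1 (fun x t => b x t j k) C)
    (Λ₀ : ℝ) (hΛ₀ : 0 < Λ₀) (hLam : LamCond n m Λ₀ a) :
    (∀ s : ℝ, ∀ φ : L2 n,
      (∃ u : ℝ → L2 n, IsGenSol n m p a b s φ u) ∧
      (∀ u v : ℝ → L2 n, IsGenSol n m p a b s φ u → IsGenSol n m p a b s φ v →
        ∀ t ∈ Set.Ici s, u t = v t)) ∧
    ∃ U : ℝ → ℝ → L2 n →L[ℝ] L2 n,
      (∀ s : ℝ, ∀ φ : L2 n, ∀ u : ℝ → L2 n,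
        IsGenSol n m p a b s φ u → ∀ t ∈ Set.Ici s, U t s φ = u t) ∧
      (∀ t : ℝ, U t t = ContinuousLinearMap.id ℝ (L2 n)) ∧
      (∀ s r t : ℝ, s ≤ r → r ≤ t → ∀ φ : L2 n, U t r (U r s φ) = U t s φ) ∧
      (∀ φ : L2 n,
        ContinuousOn (fun q : ℝ × ℝ => U q.1 q.2 φ) {q : ℝ × ℝ | q.2 ≤ q.1}) ∧
      ∃ K : ℝ, 1 ≤ K ∧ ∃ ν : ℝ, ∀ s t : ℝ, s ≤ t →
        ‖U t s‖ ≤ K * Real.exp (ν * (t - s)) := by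
  exact stmt_5_core n m hn hmn p a b hab Λ₀ hΛ₀ hLam
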